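/- There exists a rigid, weakly mixing, rank-one free measure-preserving action T of H₃(ℝ) on a standard probability space (X, ℬ, μ) such that the transformation T_{c(1)} is ergodic and is not conjugate to its inverse, i.e. there is no invertible μ-preserving transformation R of X with R T_{c(1)} R^{-1} = T_{c(1)}^{-1} (mod μ). -/

import Mathlib

open Filter Topology Pointwise

/-- The real Heisenberg group `H₃(ℝ)`: `⟨a, b, c⟩` encodes the upper unitriangular `3 × 3`
matrix with entry `a` at position `(1,2)`, `b` at position `(2,3)` and `c` at position `(1,3)`. -/
@[ext] structure H3 : Type where
  a : ℝ
  b : ℝ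
  c : ℝ

namespace H3

instance : Mul H3 := ⟨fun g h => ⟨g.a + h.a, g.b + h.b, g.c + h.c + g.a * h.b⟩⟩
instance : One H3 := ⟨⟨0, 0, 0⟩⟩
instance : Inv H3 := ⟨fun g => ⟨-g.a, -g.b, g.a * g.b - g.c⟩⟩

@[simp] lemma mul_a (g h : H3) : (g * h).a = g.a + h.a := rfl
@[simp] lemma mul_b (g h : H3) : (g * h).b = g.b + h.b := rfl
@[simp] lemma mul_c (g h : H3) : (g * h).c = g.c + h.c + g.a * h.b := rfl
@[simp] lemma one_a : (1 : H3).a = 0 := rfl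
@[simp] lemma one_b : (1 : H3).b = 0 := rfl
@[simp] lemma one_c : (1 : H3).c = 0 := rfl
@[simp] lemma inv_a (g : H3) : g⁻¹.a = -g.a := rfl
@[simp] lemma inv_b (g : H3) : g⁻¹.b = -g.b := rfl
@[simp] lemma inv_c (g : H3) : g⁻¹.c = g.a * g.b - g.c := rfl

instance : Group H3 where
  mul_assoc g h k := by ext <;> simp <;> ring
  one_mul g := by ext <;> simp
  mul_one g := by ext <;> simp
  inv_mul_cancel g := by ext <;> simp

def toProd (g : H3) : ℝ × ℝ × ℝ := (g.a, g.b, g.c)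
def ofProd (p : ℝ × ℝ × ℝ) : H3 := ⟨p.1, p.2.1, p.2.2⟩

/-- The natural (Euclidean) topology of `H₃(ℝ)`. -/
instance : TopologicalSpace H3 := TopologicalSpace.induced toProd inferInstance
/-- The Borel σ-algebra of `H₃(ℝ)`. -/
instance : MeasurableSpace H3 := MeasurableSpace.comap toProd inferInstance

/-- A Haar measure on `H₃(ℝ)` (Lebesgue measure in the upper-triangular coordinates);
it satisfies `haar (box α β γ) = 8αβγ`. -/
noncomputable def haar : MeasureTheory.Measure H3 :=
  MeasureTheory.Measure.map ofProd MeasureTheory.volume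

/-- The one-parameter subgroup `a(t)` (entry `t` at position `(1,2)`). -/
def A (t : ℝ) : H3 := ⟨t, 0, 0⟩
/-- The one-parameter subgroup `b(t)` (entry `t` at position `(2,3)`). -/
def B (t : ℝ) : H3 := ⟨0, t, 0⟩
/-- The central one-parameter subgroup `c(t)` (entry `t` at position `(1,3)`). -/
def C (t : ℝ) : H3 := ⟨0, 0, t⟩

/-- The flip automorphism `θ` of `H₃(ℝ)`: `θ(a(t)) = b(t)`, `θ(b(t)) = a(t)`, `θ(c(t)) = c(-t)`. -/
def flip (g : H3) : H3 := ⟨g.b, g.a, g.a * g.b - g.c⟩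

/-- The box `I(α,β,γ) = {c(t₃)b(t₂)a(t₁) : |t₁| ≤ α, |t₂| ≤ β, |t₃| ≤ γ}`. -/
def box (α β γ : ℝ) : Set H3 := {g : H3 | |g.a| ≤ α ∧ |g.b| ≤ β ∧ |g.c| ≤ γ}

end H3

/-- A (jointly measurable) measure-preserving action of the Heisenberg group `H₃(ℝ)`
by invertible measure-preserving transformations on a measure space `(X, μ)`. -/
structure H3System : Type 1 where
  X : Type
  [ms : MeasurableSpace X]
  μ : MeasureTheory.Measure X
  T : H3 → X → X
  t_one : ∀ x, T 1 x = x
  t_mul : ∀ g h x, T (g * h) x = T g (T h x)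
  t_meas : Measurable fun p : H3 × X => T p.1 p.2
  t_mp : ∀ g, MeasureTheory.MeasurePreserving (T g) μ μ

attribute [instance] H3System.ms

section BaseDefs

open MeasureTheory

variable {Y : Type*} [MeasurableSpace Y]

/-- Mixing for a family of measure-preserving maps indexed by `H₃(ℝ)`:
`ν (S g A ∩ B) → ν A · ν B` as `g → ∞`. -/
def MixingFam (ν : Measure Y) (S : H3 → Y → Y) : Prop :=
  ∀ A B : Set Y, MeasurableSet A → MeasurableSet B →
    Tendsto (fun g : H3 => ν (S g '' A ∩ B)) (cocompact H3) (𝓝 (ν A * ν B))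

/-- Mixing of order `l` (with `l+1` sets) for a family of maps indexed by `H₃(ℝ)`. -/
def MixingOfOrderFam (ν : Measure Y) (S : H3 → Y → Y) (l : ℕ) : Prop :=
  ∀ ε : ℝ, 0 < ε → ∀ A : Fin (l + 1) → Set Y, (∀ i, MeasurableSet (A i)) →
    ∃ K : Set H3, IsCompact K ∧
      ∀ g : Fin (l + 1) → H3, (∀ i j, i ≠ j → g i * (g j)⁻¹ ∉ K) →
        |(ν (⋂ i, S (g i) '' A i)).toReal - ∏ i, (ν (A i)).toReal| < ε

/-- Mixing for a flow (a family of maps indexed by `ℝ`). -/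
def FlowMixingFam (ν : Measure Y) (S : ℝ → Y → Y) : Prop :=
  ∀ A B : Set Y, MeasurableSet A → MeasurableSet B →
    Tendsto (fun t : ℝ => ν (S t '' A ∩ B)) (cocompact ℝ) (𝓝 (ν A * ν B))

/-- Mixing of order `l` (with `l+1` sets) for a flow. -/
def FlowMixingOfOrderFam (ν : Measure Y) (S : ℝ → Y → Y) (l : ℕ) : Prop :=
  ∀ ε : ℝ, 0 < ε → ∀ A : Fin (l + 1) → Set Y, (∀ i, MeasurableSet (A i)) →
    ∃ K : Set ℝ, IsCompact K ∧
      ∀ t : Fin (l + 1) → ℝ, (∀ i j, i ≠ j → t i - t j ∉ K) →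
        |(ν (⋂ i, S (t i) '' A i)).toReal - ∏ i, (ν (A i)).toReal| < ε

namespace H3System

variable (s : H3System)

/-- `(X, ℬ, μ)` is a standard probability space. -/
def IsStdProb : Prop := StandardBorelSpace s.X ∧ IsProbabilityMeasure s.μ

/-- Freeness: for almost every point, only the identity fixes it. -/
def Free : Prop := ∀ᵐ x ∂s.μ, ∀ g : H3, s.T g x = x → g = 1

/-- Mixing of the whole `H₃(ℝ)`-action. -/
def Mixing : Prop := MixingFam s.μ s.T

/-- Mixing of the central flow `(T_{c(t)})_{t∈ℝ}`. -/
def CentralMixing : Prop := FlowMixingFam s.μ fun t => s.T (H3.C t)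

/-- Ergodicity of the central flow `(T_{c(t)})_{t∈ℝ}`. -/
def CentralErgodic : Prop :=
  ∀ A : Set s.X, MeasurableSet A → (∀ t : ℝ, s.T (H3.C t) ⁻¹' A = A) →
    s.μ A = 0 ∨ s.μ Aᶜ = 0

/-- Rigidity: some sequence `gₙ → ∞` satisfies `μ(T_{gₙ}A ∩ B) → μ(A ∩ B)`. -/
def Rigid : Prop :=
  ∃ g : ℕ → H3, Tendsto g atTop (cocompact H3) ∧
    ∀ A B : Set s.X, MeasurableSet A → MeasurableSet B →
      Tendsto (fun n => s.μ (s.T (g n) '' A ∩ B)) atTop (𝓝 (s.μ (A ∩ B)))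

/-- Weak mixing: the diagonal product action on `(X × X, μ × μ)` is ergodic. -/
def WeaklyMixing : Prop :=
  ∀ A : Set (s.X × s.X), MeasurableSet A →
    (∀ g : H3, (fun p : s.X × s.X => (s.T g p.1, s.T g p.2)) ⁻¹' A = A) →
    (s.μ.prod s.μ) A = 0 ∨ (s.μ.prod s.μ) Aᶜ = 0

/-- Zero type (mixing in infinite measure): `μ(T_g D₁ ∩ D₂) → 0` as `g → ∞`
for sets of finite measure. -/
def ZeroType : Prop :=
  ∀ D₁ D₂ : Set s.X, MeasurableSet D₁ → MeasurableSet D₂ → s.μ D₁ < ⊤ → s.μ D₂ < ⊤ →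
    Tendsto (fun g : H3 => s.μ (s.T g '' D₁ ∩ D₂)) (cocompact H3) (𝓝 0)

end H3System

/-- A (one-sided) Følner sequence of relatively compact subsets of positive finite
Haar measure in `H₃(ℝ)`. -/
def IsFolnerSeq (F : ℕ → Set H3) : Prop :=
  (∀ n, IsCompact (closure (F n)) ∧ 0 < H3.haar (F n) ∧ H3.haar (F n) < ⊤) ∧
  ∀ g : H3,
    Tendsto (fun n => H3.haar (symmDiff ((g * ·) '' F n) (F n)) / H3.haar (F n)) atTop (𝓝 0)

/-- A Rokhlin tower `(Y, f, F)` for the system `s`: `f : Y → F` is measurable and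
`f⁻¹(gH) = T_g f⁻¹(H)` for Borel `H ⊆ F` and `g` with `gH ⊆ F`. -/
def IsRokhlinTower (s : H3System) (Y : Set s.X) (f : s.X → H3) (F : Set H3) : Prop :=
  MeasurableSet Y ∧ Measurable f ∧ (∀ x ∈ Y, f x ∈ F) ∧
  ∀ (H : Set H3) (g : H3), MeasurableSet H → H ⊆ F → (g * ·) '' H ⊆ F →
    Y ∩ f ⁻¹' ((g * ·) '' H) = s.T g '' (Y ∩ f ⁻¹' H)

/-- Rank one along a given sequence `(Fₙ)`: there are Rokhlin towers `(Yₙ, fₙ, Fₙ)` such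
that every measurable set is approximated by unions of levels of the towers. -/
def RankOneAlong (s : H3System) (F : ℕ → Set H3) : Prop :=
  ∃ (Y : ℕ → Set s.X) (f : ℕ → s.X → H3),
    (∀ n, IsRokhlinTower s (Y n) (f n) (F n)) ∧
    ∀ Bset : Set s.X, MeasurableSet Bset →
      ∃ Hs : ℕ → Set H3, (∀ n, MeasurableSet (Hs n) ∧ Hs n ⊆ F n) ∧
        Tendsto (fun n => s.μ (symmDiff Bset (Y n ∩ (f n) ⁻¹' Hs n))) atTop (𝓝 0)

/-- Rank one: rank one along some Følner sequence. -/
def RankOne (s : H3System) : Prop := ∃ F : ℕ → Set H3, IsFolnerSeq F ∧ RankOneAlong s F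

section Joinings

variable (s : H3System) {ι : Type} (φ : ι → H3)

/-- A 2-fold self-joining of the sub-action `(T_{φ i})_{i∈ι}`: a measure on `X × X`,
invariant under the diagonal action, whose both marginals equal `μ`. -/
def IsSelfJoining2 (ν : Measure (s.X × s.X)) : Prop :=
  IsProbabilityMeasure ν ∧ ν.map Prod.fst = s.μ ∧ ν.map Prod.snd = s.μ ∧
  ∀ i : ι, MeasurePreserving (fun p : s.X × s.X => (s.T (φ i) p.1, s.T (φ i) p.2)) ν ν

/-- An ergodic 2-fold self-joining. -/
def IsErgodicSelfJoining2 (ν : Measure (s.X × s.X)) : Prop :=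
  IsSelfJoining2 s φ ν ∧
  ∀ A : Set (s.X × s.X), MeasurableSet A →
    (∀ i : ι, (fun p : s.X × s.X => (s.T (φ i) p.1, s.T (φ i) p.2)) ⁻¹' A = A) →
    ν A = 0 ∨ ν Aᶜ = 0

/-- The centralizer of the sub-action `(T_{φ i})_{i∈ι}`: invertible measure-preserving
transformations commuting (a.e.) with every `T_{φ i}`. -/
def InCentralizer (R : s.X → s.X) : Prop :=
  Measurable R ∧ MeasurePreserving R s.μ s.μ ∧
  (∃ R' : s.X → s.X, Measurable R' ∧ MeasurePreserving R' s.μ s.μ ∧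
    (∀ᵐ x ∂s.μ, R' (R x) = x) ∧ (∀ᵐ x ∂s.μ, R (R' x) = x)) ∧
  ∀ i : ι, ∀ᵐ x ∂s.μ, R (s.T (φ i) x) = s.T (φ i) (R x)

/-- The off-diagonal (graph) self-joining `μ_R` determined by `R`,
i.e. `μ_R(A × B) = μ(A ∩ R⁻¹B) = μ(RA ∩ B)`. -/
noncomputable def graphJoining (R : s.X → s.X) : Measure (s.X × s.X) :=
  s.μ.map fun x => (x, R x)

/-- 2-fold simplicity of the sub-action `(T_{φ i})_{i∈ι}`: every ergodic 2-fold
self-joining is either off-diagonal over the centralizer or product measure. -/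
def TwoFoldSimple : Prop :=
  ∀ ν : Measure (s.X × s.X), IsErgodicSelfJoining2 s φ ν →
    (∃ R : s.X → s.X, InCentralizer s φ R ∧ ν = graphJoining s R) ∨ ν = s.μ.prod s.μ

/-- An `l`-fold self-joining of the sub-action `(T_{φ i})_{i∈ι}`. -/
def IsSelfJoining (l : ℕ) (ν : Measure (Fin l → s.X)) : Prop :=
  IsProbabilityMeasure ν ∧ (∀ k : Fin l, ν.map (fun x => x k) = s.μ) ∧
  ∀ i : ι, MeasurePreserving (fun (x : Fin l → s.X) k => s.T (φ i) (x k)) ν ν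

/-- Simplicity: 2-fold simple, and for every `l ≥ 2` the only `l`-fold self-joining all of
whose pairwise 2-dimensional projections are `μ × μ` is the product measure. -/
def Simple : Prop :=
  TwoFoldSimple s φ ∧
  ∀ l : ℕ, 2 ≤ l → ∀ ν : Measure (Fin l → s.X), IsSelfJoining s φ l ν →
    (∀ j k : Fin l, j ≠ k → ν.map (fun x => (x j, x k)) = s.μ.prod s.μ) →
    ν = Measure.pi fun _ => s.μ

/-- The centralizer of the sub-action `(T_{φ i})_{i∈ι}` equals `{T_g : g ∈ H₃(ℝ)}`
(modulo null sets). -/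
def CentralizerEq : Prop :=
  ∀ R : s.X → s.X, InCentralizer s φ R ↔ ∃ g : H3, ∀ᵐ x ∂s.μ, R x = s.T g x

/-- Minimal self-joinings (MSJ) of the sub-action `(T_{φ i})_{i∈ι}`: simple, and the
centralizer consists of the transformations of the sub-action itself. -/
def HasMSJ : Prop :=
  Simple s φ ∧ ∀ R : s.X → s.X, InCentralizer s φ R → ∃ i : ι, ∀ᵐ x ∂s.μ, R x = s.T (φ i) x

end Joinings

end BaseDefs

namespace HW
open MeasureTheory Set

/-! ### Part one: the Heisenberg group -/

def mEquiv : H3 ≃ᵐ ℝ × ℝ × ℝ where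
  toFun := H3.toProd
  invFun := H3.ofProd
  left_inv _ := rfl
  right_inv _ := rfl
  measurable_toFun := comap_measurable _
  measurable_invFun := by
    rintro s ⟨t, ht, rfl⟩
    exact ht

def homeo : H3 ≃ₜ ℝ × ℝ × ℝ where
  toFun := H3.toProd
  invFun := H3.ofProd
  left_inv _ := rfl
  right_inv _ := rfl
  continuous_toFun := continuous_induced_dom
  continuous_invFun := continuous_induced_rng.2 continuous_id

lemma continuous_a : Continuous H3.a := continuous_fst.comp homeo.continuous
lemma continuous_b : Continuous H3.b := (continuous_fst.comp continuous_snd).comp homeo.continuous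
lemma continuous_c : Continuous H3.c := (continuous_snd.comp continuous_snd).comp homeo.continuous

lemma continuous_mk {Y : Type*} [TopologicalSpace Y] {f g h : Y → ℝ} (hf : Continuous f)
    (hg : Continuous g) (hh : Continuous h) : Continuous fun y => (⟨f y, g y, h y⟩ : H3) :=
  homeo.symm.continuous.comp (hf.prodMk (hg.prodMk hh))

instance : SecondCountableTopology H3 := homeo.isEmbedding.secondCountableTopology
instance : T2Space H3 := homeo.symm.t2Space
instance : LocallyCompactSpace H3 := homeo.isClosedEmbedding.locallyCompactSpace
instance : BorelSpace H3 := by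
  constructor
  have h : (inferInstance : MeasurableSpace H3) =
      MeasurableSpace.comap H3.toProd (borel (ℝ × ℝ × ℝ)) := by
    rw [← (inferInstance : BorelSpace (ℝ × ℝ × ℝ)).measurable_eq]; rfl
  have h2 := @borel_comap H3 (ℝ × ℝ × ℝ) H3.toProd inferInstance
  exact h.trans h2.symm
instance : PolishSpace H3 := homeo.isClosedEmbedding.polishSpace
instance : IsTopologicalGroup H3 where
  continuous_mul := by
    have a1 := continuous_a.comp (continuous_fst (X := H3) (Y := H3))
    have a2 := continuous_a.comp (continuous_snd (X := H3) (Y := H3))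
    have b1 := continuous_b.comp (continuous_fst (X := H3) (Y := H3))
    have b2 := continuous_b.comp (continuous_snd (X := H3) (Y := H3))
    have c1 := continuous_c.comp (continuous_fst (X := H3) (Y := H3))
    have c2 := continuous_c.comp (continuous_snd (X := H3) (Y := H3))
    exact continuous_mk (a1.add a2) (b1.add b2) ((c1.add c2).add (a1.mul b2))
  continuous_inv :=
    continuous_mk continuous_a.neg continuous_b.neg
      ((continuous_a.mul continuous_b).sub continuous_c)


lemma haar_eq : H3.haar = Measure.map homeo.symm volume := rfl

lemma mp_homeo : MeasurePreserving (mEquiv.symm) volume H3.haar :=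
  mEquiv.symm.measurable.measurePreserving _

lemma mp_homeo' : MeasurePreserving (mEquiv) H3.haar volume := mp_homeo.symm

instance : SigmaFinite H3.haar := by
  rw [haar_eq]
  exact (MeasurableEquiv.sigmaFinite_map mEquiv.symm)

instance : H3.haar.Regular := by
  rw [haar_eq]
  exact Measure.Regular.map _

lemma mp_lin (p q r : ℝ) : MeasurePreserving
    (fun x : ℝ × ℝ => (p + x.1, q + x.2 + r * x.1)) volume volume := by
  refine MeasurePreserving.skew_product (g := fun x y => q + y + r * x)
    (measurePreserving_add_left volume p) (by fun_prop) ?_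
  refine ae_of_all _ fun x => ?_
  have : (fun y : ℝ => q + y + r * x) = fun y => (q + r * x) + y := by ext y; ring
  rw [this]
  exact (measurePreserving_add_left volume _).map_eq

lemma mp_left (g : H3) : MeasurePreserving (fun x => g * x) H3.haar H3.haar := by
  have : MeasurePreserving
      (fun x : ℝ × ℝ × ℝ => (g.a + x.1, (g.b + x.2.1, g.c + x.2.2 + g.a * x.2.1)))
      volume volume := by
    refine MeasurePreserving.skew_product (g := fun (_ : ℝ) (y : ℝ × ℝ) => (g.b + y.1, g.c + y.2 + g.a * y.1))
      (measurePreserving_add_left volume g.a) (by fun_prop) ?_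
    exact ae_of_all _ fun x => (mp_lin _ _ _).map_eq
  exact mp_homeo.comp (this.comp mp_homeo')

lemma mp_right (g : H3) : MeasurePreserving (fun x => x * g) H3.haar H3.haar := by
  have : MeasurePreserving
      (fun x : ℝ × ℝ × ℝ => (x.1 + g.a, (x.2.1 + g.b, x.2.2 + g.c + x.1 * g.b)))
      volume volume := by
    refine MeasurePreserving.skew_product
      (g := fun (x : ℝ) (y : ℝ × ℝ) => (y.1 + g.b, y.2 + g.c + x * g.b))
      (measurePreserving_add_right volume g.a) (by fun_prop) ?_
    refine ae_of_all _ fun x => ?_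
    have := (measurePreserving_add_right (volume : Measure ℝ) g.b).prod
      (measurePreserving_add_right (volume : Measure ℝ) (g.c + x * g.b))
    have h2 := this.map_eq
    convert h2 using 2
    · ext y <;> simp
      ring
    all_goals rfl
  exact mp_homeo.comp (this.comp mp_homeo')

instance : H3.haar.IsMulLeftInvariant := ⟨fun g => (mp_left g).map_eq⟩
instance : H3.haar.IsMulRightInvariant := ⟨fun g => (mp_right g).map_eq⟩

/-- half-open box -/
def Bx (x y z : ℝ) : Set H3 :=
  {g | (0 ≤ g.a ∧ g.a < x) ∧ (0 ≤ g.b ∧ g.b < y) ∧ (0 ≤ g.c ∧ g.c < z)}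

def Bxx (x0 x1 y0 y1 z0 z1 : ℝ) : Set H3 :=
  {g | (x0 ≤ g.a ∧ g.a < x1) ∧ (y0 ≤ g.b ∧ g.b < y1) ∧ (z0 ≤ g.c ∧ g.c < z1)}

lemma Bx_eq (x y z : ℝ) : Bx x y z = Bxx 0 x 0 y 0 z := rfl

lemma Bxx_eq (x0 x1 y0 y1 z0 z1 : ℝ) : Bxx x0 x1 y0 y1 z0 z1 =
    mEquiv ⁻¹' (Ico x0 x1 ×ˢ (Ico y0 y1 ×ˢ Ico z0 z1)) := rfl

lemma meas_Bxx (x0 x1 y0 y1 z0 z1 : ℝ) : MeasurableSet (Bxx x0 x1 y0 y1 z0 z1) := by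
  rw [Bxx_eq]
  exact mEquiv.measurable
    (measurableSet_Ico.prod (measurableSet_Ico.prod measurableSet_Ico))

lemma haar_Bxx (x0 x1 y0 y1 z0 z1 : ℝ) : H3.haar (Bxx x0 x1 y0 y1 z0 z1) =
    ENNReal.ofReal (x1 - x0) * (ENNReal.ofReal (y1 - y0) * ENNReal.ofReal (z1 - z0)) := by
  rw [Bxx_eq, mp_homeo'.measure_preimage
    (measurableSet_Ico.prod (measurableSet_Ico.prod measurableSet_Ico)).nullMeasurableSet]
  erw [Measure.prod_prod, Measure.prod_prod]
  simp

lemma haar_Bxx_ne_top (x0 x1 y0 y1 z0 z1 : ℝ) : H3.haar (Bxx x0 x1 y0 y1 z0 z1) ≠ ⊤ := by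
  rw [haar_Bxx]
  exact ENNReal.mul_ne_top ENNReal.ofReal_ne_top
    (ENNReal.mul_ne_top ENNReal.ofReal_ne_top ENNReal.ofReal_ne_top)

lemma haarR_Bxx (x0 x1 y0 y1 z0 z1 : ℝ) (hx : x0 ≤ x1) (hy : y0 ≤ y1) (hz : z0 ≤ z1) :
    H3.haar.real (Bxx x0 x1 y0 y1 z0 z1) = (x1 - x0) * ((y1 - y0) * (z1 - z0)) := by
  rw [Measure.real, haar_Bxx, ENNReal.toReal_mul, ENNReal.toReal_mul, ENNReal.toReal_ofReal,
    ENNReal.toReal_ofReal, ENNReal.toReal_ofReal] <;> linarith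

lemma meas_Bx (x y z : ℝ) : MeasurableSet (Bx x y z) := meas_Bxx _ _ _ _ _ _
lemma haar_Bx_ne_top (x y z : ℝ) : H3.haar (Bx x y z) ≠ ⊤ := haar_Bxx_ne_top _ _ _ _ _ _
lemma haarR_Bx (x y z : ℝ) (hx : 0 ≤ x) (hy : 0 ≤ y) (hz : 0 ≤ z) :
    H3.haar.real (Bx x y z) = x * y * z := by
  rw [Bx_eq, haarR_Bxx _ _ _ _ _ _ hx hy hz]; ring

/-- points deep inside a box -/
def deep (k x y z : ℝ) : Set H3 := Bxx k (x - k) k (y - k) (k + k * y) (z - k - k * y)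

lemma meas_deep (k x y z : ℝ) : MeasurableSet (deep k x y z) := meas_Bxx _ _ _ _ _ _

/-- `g` has all coordinates bounded by `k` -/
def bd (k : ℝ) (g : H3) : Prop := |g.a| ≤ k ∧ |g.b| ≤ k ∧ |g.c| ≤ k

lemma deep_zero (x y z : ℝ) : deep 0 x y z = Bx x y z := by
  ext g; simp [deep, Bx, Bxx]

lemma deep_move {j k x y z : ℝ} {g s : H3} (_hk : 0 ≤ k) (hg : bd j g)
    (hs : s ∈ deep (k + j) x y z) : g * s ∈ deep k x y z := by
  obtain ⟨ga, gb, gc⟩ := hg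
  rw [abs_le] at ga gb gc
  obtain ⟨⟨h1, h2⟩, ⟨h3, h4⟩, ⟨h5, h6⟩⟩ := hs
  have hj : 0 ≤ j := by linarith
  have e1 : g.a * s.b ≤ j * y := by nlinarith
  have e2 : - (j * y) ≤ g.a * s.b := by nlinarith
  refine ⟨⟨?_, ?_⟩, ⟨?_, ?_⟩, ⟨?_, ?_⟩⟩ <;> simp <;> nlinarith

lemma deep_sub {j k x y z : ℝ} (hy : 0 ≤ y) (_hk : 0 ≤ k) (hjk : k ≤ j) :
    deep j x y z ⊆ deep k x y z := by
  rintro s ⟨⟨h1, h2⟩, ⟨h3, h4⟩, ⟨h5, h6⟩⟩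
  refine ⟨⟨?_, ?_⟩, ⟨?_, ?_⟩, ⟨?_, ?_⟩⟩ <;> nlinarith

lemma deep_sub_Bx {k x y z : ℝ} (hy : 0 ≤ y) (hk : 0 ≤ k) : deep k x y z ⊆ Bx x y z := by
  rw [← deep_zero]; exact deep_sub hy le_rfl hk

lemma Bx_diff_deep {k x y z : ℝ} (hx : 0 ≤ x) (hy : 0 ≤ y) (hz : 0 ≤ z) (hk : 0 ≤ k) :
    H3.haar.real (Bx x y z \ deep k x y z) ≤
      2 * k * (y * z) + 2 * k * (x * z) + (2 * k + 2 * k * y) * (x * y) := by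
  have hky : 0 ≤ k * y := mul_nonneg hk hy
  have hsub : Bx x y z \ deep k x y z ⊆
      ((Bxx 0 k 0 y 0 z ∪ Bxx (x - k) x 0 y 0 z) ∪ (Bxx 0 x 0 k 0 z ∪ Bxx 0 x (y - k) y 0 z)) ∪
      (Bxx 0 x 0 y 0 (k + k * y) ∪ Bxx 0 x 0 y (z - (k + k * y)) z) := by
    rintro s ⟨⟨⟨h1, h2⟩, ⟨h3, h4⟩, ⟨h5, h6⟩⟩, hd⟩
    by_contra hcon
    apply hd
    simp only [mem_union, not_or] at hcon
    obtain ⟨⟨⟨a1, a2⟩, a3, a4⟩, a5, a6⟩ := hcon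
    refine ⟨⟨?_, ?_⟩, ⟨?_, ?_⟩, ⟨?_, ?_⟩⟩ <;> by_contra hh
    · exact a1 ⟨⟨h1, by linarith⟩, ⟨h3, h4⟩, ⟨h5, h6⟩⟩
    · exact a2 ⟨⟨by linarith, h2⟩, ⟨h3, h4⟩, ⟨h5, h6⟩⟩
    · exact a3 ⟨⟨h1, h2⟩, ⟨h3, by linarith⟩, ⟨h5, h6⟩⟩
    · exact a4 ⟨⟨h1, h2⟩, ⟨by linarith, h4⟩, ⟨h5, h6⟩⟩
    · exact a5 ⟨⟨h1, h2⟩, ⟨h3, h4⟩, ⟨h5, by linarith⟩⟩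
    · exact a6 ⟨⟨h1, h2⟩, ⟨h3, h4⟩, ⟨by linarith, h6⟩⟩
  have hfin : H3.haar (((Bxx 0 k 0 y 0 z ∪ Bxx (x - k) x 0 y 0 z) ∪
      (Bxx 0 x 0 k 0 z ∪ Bxx 0 x (y - k) y 0 z)) ∪
      (Bxx 0 x 0 y 0 (k + k * y) ∪ Bxx 0 x 0 y (z - (k + k * y)) z)) ≠ ⊤ := by
    simp only [Ne, measure_union_eq_top_iff, haar_Bxx_ne_top, or_self, not_false_eq_true]
  refine (measureReal_mono hsub hfin).trans ?_
  refine (measureReal_union_le _ _).trans ?_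
  have e1 := measureReal_union_le (μ := H3.haar)
    (Bxx 0 k 0 y 0 z ∪ Bxx (x - k) x 0 y 0 z) (Bxx 0 x 0 k 0 z ∪ Bxx 0 x (y - k) y 0 z)
  have e2 := measureReal_union_le (μ := H3.haar) (Bxx 0 k 0 y 0 z) (Bxx (x - k) x 0 y 0 z)
  have e3 := measureReal_union_le (μ := H3.haar) (Bxx 0 x 0 k 0 z) (Bxx 0 x (y - k) y 0 z)
  have e4 := measureReal_union_le (μ := H3.haar) (Bxx 0 x 0 y 0 (k + k * y))
    (Bxx 0 x 0 y (z - (k + k * y)) z)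
  rw [haarR_Bxx _ _ _ _ _ _ (by linarith) (by linarith) (by linarith),
    haarR_Bxx _ _ _ _ _ _ (by linarith) (by linarith) (by linarith)] at e2 e3 e4
  nlinarith

end HW

namespace HW
open MeasureTheory Set

/-! ### Part two, A: lattices and tilings -/

abbrev Z3 := ℤ × ℤ × ℤ

/-- lattice points -/
def lat (u v : ℝ) (t : Z3) : H3 := ⟨u * t.1, v * t.2.1, u * v * t.2.2⟩

def zm (t t' : Z3) : Z3 := (t.1 + t'.1, t.2.1 + t'.2.1, t.2.2 + t'.2.2 + t.1 * t'.2.1)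

lemma lat_mul (u v : ℝ) (t t' : Z3) : lat u v t * lat u v t' = lat u v (zm t t') := by
  ext <;> simp [lat, zm] <;> ring

lemma int_unique {u x x' : ℝ} {i i' : ℤ} (hx : 0 ≤ x ∧ x < u) (hx' : 0 ≤ x' ∧ x' < u)
    (h : x + u * i = x' + u * i') : i = i' := by
  have hu : 0 < u := by linarith
  have h1 : u * ((i : ℝ) - i') < u * 1 := by linarith
  have h2 : u * ((i' : ℝ) - i) < u * 1 := by linarith
  have h3 := lt_of_mul_lt_mul_left h1 hu.le
  have h4 := lt_of_mul_lt_mul_left h2 hu.le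
  have h5 : i - i' < 1 := by exact_mod_cast h3
  have h6 : i' - i < 1 := by exact_mod_cast h4
  omega

lemma tile_unique {u v : ℝ} {e e' : H3} {t t' : Z3}
    (he : e ∈ Bx u v (u * v)) (he' : e' ∈ Bx u v (u * v))
    (h : e * lat u v t = e' * lat u v t') : t = t' := by
  obtain ⟨h1, h2, h3⟩ := he
  obtain ⟨h1', h2', h3'⟩ := he'
  have ha : e.a + u * t.1 = e'.a + u * t'.1 := congrArg H3.a h
  have hb : e.b + v * t.2.1 = e'.b + v * t'.2.1 := congrArg H3.b h
  have hc : e.c + u * v * t.2.2 + e.a * (v * t.2.1) =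
    e'.c + u * v * t'.2.2 + e'.a * (v * t'.2.1) := congrArg H3.c h
  have i1 := int_unique h1 h1' ha
  have i2 := int_unique h2 h2' hb
  rw [i1] at ha
  have ha' : e.a = e'.a := by linarith
  rw [i2, ha'] at hc
  have i3 := int_unique h3 h3' (by linarith : e.c + u * v * t.2.2 = e'.c + u * v * t'.2.2)
  ext <;> simp [*]

lemma floor_tile {u : ℝ} (hu : 0 < u) (x : ℝ) :
    0 ≤ x - u * ⌊x / u⌋ ∧ x - u * ⌊x / u⌋ < u := by
  have h1 := Int.floor_le (x / u)
  have h2 := Int.lt_floor_add_one (x / u)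
  rw [le_div_iff₀ hu] at h1
  rw [div_lt_iff₀ hu] at h2
  constructor <;> linarith

lemma tile_exists {u v : ℝ} (hu : 0 < u) (hv : 0 < v) (s : H3) :
    ∃ e ∈ Bx u v (u * v), ∃ t, s = e * lat u v t := by
  have huv := mul_pos hu hv
  set i := ⌊s.a / u⌋
  set j := ⌊s.b / v⌋
  set w := s.c - (s.a - u * i) * (v * j)
  refine ⟨⟨s.a - u * i, s.b - v * j, w - u * v * ⌊w / (u * v)⌋⟩,
    ⟨floor_tile hu _, floor_tile hv _, floor_tile huv _⟩, (i, j, ⌊w / (u * v)⌋), ?_⟩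
  ext <;> simp [lat, w]

lemma rt_preim (A : Set H3) (x : H3) : (· * x) '' A = (· * x⁻¹) ⁻¹' A := by
  ext s; constructor
  · rintro ⟨a, ha, rfl⟩; simpa using ha
  · intro hs; exact ⟨s * x⁻¹, hs, by simp⟩

lemma haar_rt (A : Set H3) (x : H3) : H3.haar ((· * x) '' A) = H3.haar A := by
  rw [rt_preim, measure_preimage_mul_right]

lemma haar_lt (A : Set H3) (x : H3) : H3.haar ((x * ·) '' A) = H3.haar A := by
  have : (x * ·) '' A = (x⁻¹ * ·) ⁻¹' A := by
    ext s; constructor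
    · rintro ⟨a, ha, rfl⟩; simpa using ha
    · intro hs; exact ⟨x⁻¹ * s, hs, by simp⟩
  rw [this, measure_preimage_mul]

lemma meas_rt {A : Set H3} (hA : MeasurableSet A) (x : H3) : MeasurableSet ((· * x) '' A) := by
  rw [rt_preim]; exact (measurable_mul_const _) hA

lemma meas_lt {A : Set H3} (hA : MeasurableSet A) (x : H3) : MeasurableSet ((x * ·) '' A) :=
  (MeasurableEquiv.mulLeft x).measurableSet_image.2 hA

/-- counting tiles inside a set of finite measure -/
lemma tile_count {u v : ℝ} (o : H3) {U : Set H3}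
    (T : Finset Z3) (hT : ∀ t ∈ T, ∀ e ∈ Bx u v (u * v), e * lat u v t * o ∈ U) :
    T.card * H3.haar (Bx u v (u * v)) ≤ H3.haar U := by
  have h1 : H3.haar (⋃ t ∈ T, (· * (lat u v t * o)) '' Bx u v (u * v)) =
      ∑ t ∈ T, H3.haar ((· * (lat u v t * o)) '' Bx u v (u * v)) := by
    apply measure_biUnion_finset
    · intro t _ t' _ htt
      refine Set.disjoint_left.2 ?_
      rintro s ⟨e, he, rfl⟩ ⟨e', he', h⟩
      apply htt
      apply tile_unique he he'
      have h' : e' * (lat u v t' * o) = e * (lat u v t * o) := h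
      rw [← mul_assoc, ← mul_assoc] at h'
      exact (mul_right_cancel h').symm
    · intro t _; exact meas_rt (meas_Bx _ _ _) _
  have h2 : (⋃ t ∈ T, (· * (lat u v t * o)) '' Bx u v (u * v)) ⊆ U := by
    intro s hs
    simp only [mem_iUnion] at hs
    obtain ⟨t, ht, e, he, rfl⟩ := hs
    have := hT t ht e he
    rwa [mul_assoc] at this
  have h3 := measure_mono (μ := H3.haar) h2
  rw [h1] at h3
  simpa [haar_rt] using h3

lemma haar_E_pos {u v : ℝ} (hu : 0 < u) (hv : 0 < v) : 0 < H3.haar (Bx u v (u * v)) := by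
  have := haarR_Bx u v (u * v) hu.le hv.le (mul_pos hu hv).le
  have h2 : 0 < H3.haar.real (Bx u v (u * v)) := by rw [this]; positivity
  exact (ENNReal.toReal_pos_iff.1 h2).1

lemma tile_finite {u v : ℝ} (hu : 0 < u) (hv : 0 < v) (o : H3) {U : Set H3}
    (hU : H3.haar U ≠ ⊤) : {t : Z3 | ∀ e ∈ Bx u v (u * v), e * lat u v t * o ∈ U}.Finite := by
  by_contra hinf
  have hinf : {t : Z3 | ∀ e ∈ Bx u v (u * v), e * lat u v t * o ∈ U}.Infinite := hinf
  have hE := haar_E_pos hu hv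
  obtain ⟨n, hn⟩ := ENNReal.exists_nat_mul_gt hE.ne' hU
  obtain ⟨T, hT, hc⟩ := hinf.exists_subset_card_eq n
  have := tile_count (u := u) (v := v) o T (fun t ht => hT ht)
  rw [hc] at this
  exact absurd hn (not_lt.2 this)

lemma nhds_bd {W : Set H3} (hW : W ∈ 𝓝 (1 : H3)) : ∃ r > 0, ∀ g, bd r g → g ∈ W := by
  have h1 : homeo.symm ⁻¹' W ∈ 𝓝 ((0 : ℝ), (0 : ℝ), (0 : ℝ)) :=
    homeo.symm.continuous.continuousAt.preimage_mem_nhds hW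
  obtain ⟨r, hr, hsub⟩ := Metric.nhds_basis_closedBall.mem_iff.1 h1
  refine ⟨r, hr, fun g hg => ?_⟩
  have : homeo g ∈ Metric.closedBall ((0 : ℝ), (0 : ℝ), (0 : ℝ)) r := by
    obtain ⟨h1, h2, h3⟩ := hg
    simp only [Metric.mem_closedBall, Prod.dist_eq, sup_le_iff, Real.dist_eq, sub_zero]
    exact ⟨h1, h2, h3⟩
  exact hsub this

lemma approx_cover (α β : ℝ) (hα : 0 < α) (hβ : 0 < β) (A : Set H3) (hA : MeasurableSet A)
    (hfin : H3.haar A ≠ ⊤) (δ : ENNReal) (hδ : δ ≠ 0) :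
    ∃ K ⊆ A, IsCompact K ∧ H3.haar (A \ K) ≤ δ ∧ ∃ q0 : ℕ, ∀ q : ℕ, q0 ≤ q → 0 < q →
      ∃ T : Finset Z3, (∀ s ∈ K, ∃ t ∈ T, ∃ e ∈ Bx (α / q) (β / q) (α / q * (β / q)),
          s = e * lat (α / q) (β / q) t) ∧
        T.card * H3.haar (Bx (α / q) (β / q) (α / q * (β / q))) ≤ H3.haar A + δ := by
  obtain ⟨K, hKA, hK, hAK⟩ := hA.exists_isCompact_sdiff_lt hfin hδ
  have hKfin : H3.haar K ≠ ⊤ := (measure_mono hKA).trans_lt (lt_top_iff_ne_top.2 hfin) |>.ne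
  obtain ⟨U, hKU, hU, hUm⟩ := K.exists_isOpen_lt_of_lt (μ := H3.haar) (H3.haar K + δ)
    (ENNReal.lt_add_right hKfin hδ)
  obtain ⟨V, hV, hVK⟩ := compact_open_separated_mul_left hK hU hKU
  obtain ⟨r, hr, hrV⟩ := nhds_bd hV
  refine ⟨K, hKA, hK, hAK.le, ⌈(α + β + 3 * (α * β)) / r⌉₊, fun q hq hq0 => ?_⟩
  have hq1 : (1 : ℝ) ≤ q := by exact_mod_cast hq0
  have hqpos : (0 : ℝ) < q := by linarith
  have hu : 0 < α / q := by positivity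
  have hv : 0 < β / q := by positivity
  have hbig : α + β + 3 * (α * β) ≤ r * q := by
    have := (Nat.le_ceil _).trans (Nat.cast_le (α := ℝ).2 hq)
    rw [div_le_iff₀ hr] at this
    linarith
  have hαβ : 0 < α * β := mul_pos hα hβ
  have ha : α / q ≤ r := by rw [div_le_iff₀ hqpos]; nlinarith
  have hb : β / q ≤ r := by rw [div_le_iff₀ hqpos]; nlinarith
  have hc : 3 * (α / q * (β / q)) ≤ r := by
    have : α / q * (β / q) ≤ α * β / q := by
      rw [div_mul_div_comm]
      apply div_le_div_of_nonneg_left hαβ.le hqpos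
      nlinarith
    have h3 : 3 * (α * β / q) ≤ r := by
      rw [← mul_div_assoc, div_le_iff₀ hqpos]; nlinarith
    linarith
  generalize α / q = u at *
  generalize β / q = v at *
  have hsub : ∀ t : Z3, (∃ e ∈ Bx u v (u * v), e * lat u v t ∈ K) →
      ∀ e ∈ Bx u v (u * v), e * lat u v t * 1 ∈ U := by
    rintro t ⟨e, he, hk⟩ e' he'
    apply hVK
    refine ⟨e' * e⁻¹, hrV _ ?_, e * lat u v t, hk, by simp⟩
    obtain ⟨⟨x1, x2⟩, ⟨x3, x4⟩, ⟨x5, x6⟩⟩ := he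
    obtain ⟨⟨y1, y2⟩, ⟨y3, y4⟩, ⟨y5, y6⟩⟩ := he'
    have m1 : e.a * e.b ≤ u * v := mul_le_mul x2.le x4.le x3 hu.le
    have m2 : e'.a * e.b ≤ u * v := mul_le_mul y2.le x4.le x3 hu.le
    have m3 : 0 ≤ e.a * e.b := mul_nonneg x1 x3
    have m4 : 0 ≤ e'.a * e.b := mul_nonneg y1 x3
    refine ⟨?_, ?_, ?_⟩ <;> rw [abs_le] <;> constructor <;> simp <;> linarith
  have hUfin : H3.haar U ≠ ⊤ := (hUm.trans_le le_top).ne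
  have hfinT : {t : Z3 | ∃ e ∈ Bx u v (u * v), e * lat u v t ∈ K}.Finite :=
    (tile_finite hu hv 1 hUfin).subset hsub
  refine ⟨hfinT.toFinset, ?_, ?_⟩
  · intro s hs
    obtain ⟨e, he, t, rfl⟩ := tile_exists hu hv s
    exact ⟨t, hfinT.mem_toFinset.2 ⟨e, he, hs⟩, e, he, rfl⟩
  · refine (tile_count (U := U) 1 _ ?_).trans ?_
    · intro t ht
      exact hsub t (hfinT.mem_toFinset.1 ht)
    · refine hUm.le.trans ?_
      gcongr

/-- sums of measures and multiplicities -/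
lemma sum_meas_le {ι : Type*} (I : Finset ι) (Q : ι → Set H3) (S : Set H3)
    (hQ : ∀ i ∈ I, MeasurableSet (Q i)) (hS : MeasurableSet S) (hQS : ∀ i ∈ I, Q i ⊆ S) (c : ℕ)
    (hc : ∀ s ∈ S, ∀ I' ⊆ I, (∀ i ∈ I', s ∈ Q i) → I'.card ≤ c) :
    ∑ i ∈ I, H3.haar (Q i) ≤ c * H3.haar S := by
  classical
  calc ∑ i ∈ I, H3.haar (Q i) = ∑ i ∈ I, ∫⁻ s, (Q i).indicator 1 s ∂H3.haar := by
        refine Finset.sum_congr rfl fun i hi => ?_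
        rw [lintegral_indicator_one (hQ i hi)]
    _ = ∫⁻ s, ∑ i ∈ I, (Q i).indicator 1 s ∂H3.haar := by
        rw [lintegral_finsetSum' (μ := H3.haar) I
          (fun i hi => (measurable_one.indicator (hQ i hi)).aemeasurable)]
    _ ≤ ∫⁻ s, S.indicator (fun _ => (c : ENNReal)) s ∂H3.haar := by
        refine lintegral_mono fun s => ?_
        by_cases hs : s ∈ S
        · rw [indicator_of_mem hs]
          have h1 : ∑ i ∈ I, (Q i).indicator (1 : H3 → ENNReal) s =
              ∑ i ∈ I with s ∈ Q i, 1 := by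
            rw [Finset.sum_filter]
            rfl
          rw [h1]
          have := hc s hs (I.filter fun i => s ∈ Q i) (Finset.filter_subset _ _) (by simp)
          simpa using this
        · rw [indicator_of_notMem hs]
          refine le_of_eq (Finset.sum_eq_zero fun i hi => ?_)
          exact indicator_of_notMem (fun h => hs (hQS i hi h)) _
    _ = c * H3.haar S := by
        rw [lintegral_indicator hS, lintegral_const, Measure.restrict_apply_univ]

end HW

namespace HW
open MeasureTheory Set

/-! ### Part two, B: one step of the construction -/

lemma C_comm (t : ℝ) (g : H3) : H3.C t * g = g * H3.C t := by
  ext <;> simp [H3.C]; ring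

lemma C_add (s t : ℝ) : H3.C s * H3.C t = H3.C (s + t) := by
  ext <;> simp [H3.C]

lemma C_inv (t : ℝ) : (H3.C t)⁻¹ = H3.C (-t) := by
  ext <;> simp [H3.C]

abbrev JJ (q : ℕ) := Fin q × Fin q × Fin (q ^ 2)

def jz {q : ℕ} (j : JJ q) : Z3 := (((j.1 : ℕ) : ℤ), ((j.2.1 : ℕ) : ℤ), ((j.2.2 : ℕ) : ℤ))

/-- the tower shapes -/
def FF (α β : ℕ) : Set H3 := Bx α β (α * β)

lemma meas_FF (α β : ℕ) : MeasurableSet (FF α β) := meas_Bx _ _ _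
lemma haar_FF_ne_top (α β : ℕ) : H3.haar (FF α β) ≠ ⊤ := haar_Bx_ne_top _ _ _
lemma haarR_FF (α β : ℕ) : H3.haar.real (FF α β) = (α : ℝ) * β * (α * β) :=
  haarR_Bx _ _ _ (by positivity) (by positivity) (by positivity)

structure Par where
  α : ℕ
  β : ℕ
  q : ℕ
  N : ℕ
  R : ℕ
  hα : 0 < α
  hβ : 0 < β
  hq : 0 < q
  hN : 0 < N
  hR : 0 < R

def kap (p : ℕ) : Fin 3 := ![0, 0, 2, 0, 1, 2, 1, 2] ⟨p % 8, Nat.mod_lt _ (by norm_num)⟩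

namespace Par
variable (P : Par)

def M : ℕ := Fintype.card (Fin 3 → JJ P.q)
def L : ℕ := 8 * P.M * P.N
def G : ℝ := (P.R : ℝ) * P.R
def S : Set H3 := Bx (P.L * P.R) P.R P.G
def F : Set H3 := FF P.α P.β
def F' : Set H3 := FF (P.L * P.R) P.R
noncomputable def u : ℝ := P.α / P.q
noncomputable def v : ℝ := P.β / P.q
noncomputable def ofs (j : JJ P.q) : H3 := lat P.u P.v (jz j)

lemma M_pos : 0 < P.M := by
  have : Nonempty (Fin 3 → JJ P.q) := by
    have := P.hq
    exact ⟨fun _ => (⟨0, this⟩, ⟨0, this⟩, ⟨0, by positivity⟩)⟩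
  exact Fintype.card_pos
lemma L_pos : 0 < P.L := by
  have := P.M_pos; have := P.hN; unfold L; positivity
lemma G_pos : 0 < P.G := by
  have : (0 : ℝ) < P.R := by exact_mod_cast P.hR
  unfold G; positivity
lemma qR : (0 : ℝ) < P.q := by exact_mod_cast P.hq
lemma u_pos : 0 < P.u := div_pos (by exact_mod_cast P.hα) P.qR
lemma v_pos : 0 < P.v := div_pos (by exact_mod_cast P.hβ) P.qR

noncomputable def dec (m : ℕ) : Fin 3 → JJ P.q :=
  (Fintype.equivFin (Fin 3 → JJ P.q)).symm ⟨m % P.M, Nat.mod_lt _ P.M_pos⟩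

noncomputable def off (l : ℕ) : H3 := P.ofs (P.dec l (kap (l / P.M)))

lemma dec_add (l i : ℕ) : P.dec (l + i * P.M) = P.dec l := by
  unfold dec; congr 2; simp

lemma div_add (l i : ℕ) : (l + i * P.M) / P.M = l / P.M + i := Nat.add_mul_div_right _ _ P.M_pos

lemma off_add (l i : ℕ) (h : kap (l / P.M + i) = kap (l / P.M)) :
    P.off (l + i * P.M) = P.off l := by
  unfold off; rw [dec_add, div_add, h]

def ok (o : H3) (d : Z3) : Prop := ∀ f ∈ P.F, f * lat P.α P.β d * o ∈ P.S

lemma S_ne_top : H3.haar P.S ≠ ⊤ := haar_Bx_ne_top _ _ _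

lemma ok_finite (o : H3) : {d | P.ok o d}.Finite := by
  have := tile_finite (u := P.α) (v := P.β) (by exact_mod_cast P.hα) (by exact_mod_cast P.hβ)
    o P.S_ne_top
  exact this

def Cs : Set H3 := {x | ∃ l < P.L, ∃ d, P.ok (P.off l) d ∧
  x = lat P.α P.β d * P.off l * H3.C (l * P.G)}

lemma Cs_finite : P.Cs.Finite := by
  have : P.Cs = ⋃ l ∈ Finset.range P.L,
      (fun d => lat P.α P.β d * P.off l * H3.C (l * P.G)) '' {d | P.ok (P.off l) d} := by
    ext x
    simp only [Cs, mem_ofPred_eq, mem_iUnion, Finset.mem_range, mem_image, exists_prop]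
    constructor
    · rintro ⟨l, hl, d, hd, rfl⟩; exact ⟨l, hl, d, hd, rfl⟩
    · rintro ⟨l, hl, d, hd, rfl⟩; exact ⟨l, hl, d, hd, rfl⟩
  rw [this]
  exact Set.Finite.biUnion (Finset.finite_toSet _) fun l _ => (P.ok_finite _).image _

noncomputable def Cf : Finset H3 := P.Cs_finite.toFinset

lemma mem_Cf {x : H3} : x ∈ P.Cf ↔ x ∈ P.Cs := P.Cs_finite.mem_toFinset

lemma layer_unique {s s' : H3} (hs : s ∈ P.S) (hs' : s' ∈ P.S) {l l' : ℕ}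
    (h : s * H3.C (l * P.G) = s' * H3.C (l' * P.G)) : l = l' ∧ s = s' := by
  have hc : s.c + P.G * (l : ℤ) = s'.c + P.G * (l' : ℤ) := by
    have := congrArg H3.c h
    simp [H3.C] at this
    push_cast; linarith
  have : (l : ℤ) = l' := int_unique hs.2.2 hs'.2.2 hc
  have hl : l = l' := by exact_mod_cast this
  subst hl
  exact ⟨rfl, mul_right_cancel h⟩

lemma layer_mem {s : H3} (hs : s ∈ P.S) {l : ℕ} (hl : l < P.L) :
    s * H3.C (l * P.G) ∈ P.F' := by
  obtain ⟨h1, h2, h3, h4⟩ := hs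
  have hl' : (l : ℝ) + 1 ≤ P.L := by exact_mod_cast hl
  have := P.G_pos
  refine ⟨?_, ?_, ?_, ?_⟩
  · simpa [H3.C] using h1
  · simpa [H3.C] using h2
  · simp [H3.C]; positivity
  · have : (P.L : ℝ) * P.R * P.R = P.L * P.G := by unfold G; ring
    simp [H3.C]; rw [this]; nlinarith

lemma layer_exists {s : H3} (hs : s ∈ P.F') :
    ∃ l < P.L, ∃ s0 ∈ P.S, s = s0 * H3.C (l * P.G) := by
  obtain ⟨h1, h2, h3, h4⟩ := hs
  have hG := P.G_pos
  have e : (((P.L * P.R : ℕ) : ℝ)) * P.R = P.L * P.G := by unfold G; push_cast; ring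
  rw [e] at h4
  have h5 : s.c / P.G < P.L := by rw [div_lt_iff₀ hG]; exact h4
  have h6 : 0 ≤ s.c / P.G := div_nonneg h3 hG.le
  have f1 := Nat.floor_le h6
  have f2 := Nat.lt_floor_add_one (s.c / P.G)
  rw [le_div_iff₀ hG] at f1
  rw [div_lt_iff₀ hG] at f2
  refine ⟨⌊s.c / P.G⌋₊, ?_, ⟨s.a, s.b, s.c - ⌊s.c / P.G⌋₊ * P.G⟩, ⟨?_, h2, ?_, ?_⟩, ?_⟩
  · exact (Nat.floor_lt h6).2 h5
  · simpa using h1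
  · simp; linarith
  · simp; linarith
  · ext <;> simp [H3.C]

lemma S1 {f f' x x' : H3} (hf : f ∈ P.F) (hf' : f' ∈ P.F) (hx : x ∈ P.Cf) (hx' : x' ∈ P.Cf)
    (h : f * x = f' * x') : x = x' := by
  obtain ⟨l, hl, d, hd, rfl⟩ := P.mem_Cf.1 hx
  obtain ⟨l', hl', d', hd', rfl⟩ := P.mem_Cf.1 hx'
  have m1 := hd f hf
  have m2 := hd' f' hf'
  simp only [← mul_assoc] at h
  obtain ⟨rfl, h2⟩ := P.layer_unique m1 m2 h
  have h3 := mul_right_cancel h2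
  rw [tile_unique hf hf' h3]

lemma S2 {f x : H3} (hf : f ∈ P.F) (hx : x ∈ P.Cf) : f * x ∈ P.F' := by
  obtain ⟨l, hl, d, hd, rfl⟩ := P.mem_Cf.1 hx
  have := P.layer_mem (hd f hf) hl
  simpa only [mul_assoc] using this

def kk : ℝ := 3 * (P.α * P.β)

lemma kk_nonneg : 0 ≤ P.kk := by unfold kk; positivity

def D : Set H3 := deep P.kk (P.L * P.R) P.R P.G

lemma D_sub : P.D ⊆ P.S := deep_sub_Bx (by positivity) P.kk_nonneg

lemma cover {s : H3} (hs : s ∈ P.D) (o : H3) :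
    ∃ f ∈ P.F, ∃ d, P.ok o d ∧ s = f * lat P.α P.β d * o := by
  have hα : (1 : ℝ) ≤ P.α := by exact_mod_cast P.hα
  have hβ : (1 : ℝ) ≤ P.β := by exact_mod_cast P.hβ
  obtain ⟨f, hf, d, hd⟩ := tile_exists (u := P.α) (v := P.β) (by linarith) (by linarith) (s * o⁻¹)
  have hs' : s = f * lat P.α P.β d * o := by rw [← hd]; simp
  refine ⟨f, hf, d, ?_, hs'⟩
  intro f' hf'
  have e : f' * lat P.α P.β d * o = (f' * f⁻¹) * s := by rw [hs']; group
  rw [e]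
  have : f' * f⁻¹ * s ∈ deep 0 (P.L * P.R) P.R P.G := by
    apply deep_move (j := P.kk) le_rfl _ (by rw [zero_add]; exact hs)
    obtain ⟨⟨x1, x2⟩, ⟨x3, x4⟩, ⟨x5, x6⟩⟩ := hf
    obtain ⟨⟨y1, y2⟩, ⟨y3, y4⟩, ⟨y5, y6⟩⟩ := hf'
    have m1 : f.a * f.b ≤ P.α * P.β := mul_le_mul x2.le x4.le x3 (by linarith)
    have m2 : f'.a * f.b ≤ P.α * P.β := mul_le_mul y2.le x4.le x3 (by linarith)
    have m3 : 0 ≤ f.a * f.b := mul_nonneg x1 x3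
    have m4 : 0 ≤ f'.a * f.b := mul_nonneg y1 x3
    have m5 : (P.α : ℝ) ≤ P.α * P.β := by nlinarith
    have m6 : (P.β : ℝ) ≤ P.α * P.β := by nlinarith
    unfold kk
    refine ⟨?_, ?_, ?_⟩ <;> rw [abs_le] <;> constructor <;> simp <;> linarith
  rwa [deep_zero] at this

lemma mem_C_of {l : ℕ} (hl : l < P.L) {o : H3} (ho : P.off l = o) {d : Z3} (hd : P.ok o d) :
    lat P.α P.β d * o * H3.C (l * P.G) ∈ P.Cf := by
  subst ho
  exact P.mem_Cf.2 ⟨l, hl, d, hd, rfl⟩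

def h : ℕ := P.M * (P.R * P.R)

lemma C_shift (i l : ℕ) (g : H3) : H3.C (i * P.h : ℕ) * (g * H3.C (l * P.G)) =
    g * H3.C ((l + i * P.M : ℕ) * P.G) := by
  rw [C_comm, mul_assoc, C_add]
  congr 2
  unfold h G; push_cast; ring

/-- copies of `F` that stay in the tower under the given shifts -/
lemma cover_shift {s : H3} (hs : s ∈ P.D) {l : ℕ} (hl : l < P.L) :
    ∃ f ∈ P.F, ∃ x ∈ P.Cf, s * H3.C (l * P.G) = f * x ∧
      ∀ i, kap (l / P.M + i) = kap (l / P.M) → l + i * P.M < P.L → H3.C (i * P.h : ℕ) * x ∈ P.Cf := by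
  obtain ⟨f, hf, d, hd, rfl⟩ := P.cover hs (P.off l)
  refine ⟨f, hf, _, P.mem_C_of hl rfl hd, by simp only [mul_assoc], ?_⟩
  intro i hi hL
  rw [C_shift]
  exact P.mem_C_of hL (P.off_add l i hi) hd

lemma haar_layer (A : Set H3) (l : ℕ) : H3.haar ((· * H3.C (l * P.G)) '' A) = H3.haar A :=
  haar_rt _ _

lemma haar_layers (A : Set H3) (I : Finset ℕ) :
    H3.haar (⋃ l ∈ I, (· * H3.C (l * P.G)) '' A) ≤ I.card * H3.haar A := by
  refine (measure_biUnion_finset_le _ _).trans ?_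
  simp

lemma haar_layers_eq {A : Set H3} (hA : MeasurableSet A) (hAS : A ⊆ P.S) (I : Finset ℕ) :
    H3.haar (⋃ l ∈ I, (· * H3.C (l * P.G)) '' A) = I.card * H3.haar A := by
  rw [measure_biUnion_finset]
  · simp
  · intro l _ l' _ hll
    refine Set.disjoint_left.2 ?_
    rintro _ ⟨s, hs, rfl⟩ ⟨s', hs', h⟩
    exact hll (P.layer_unique (hAS hs) (hAS hs') h.symm).1
  · intro l _; exact meas_rt hA _

lemma meas_S : MeasurableSet P.S := meas_Bx _ _ _
lemma meas_D : MeasurableSet P.D := meas_deep _ _ _ _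
lemma meas_F : MeasurableSet P.F := meas_FF _ _

lemma haar_F' : H3.haar P.F' = P.L * H3.haar P.S := by
  have : P.F' = ⋃ l ∈ Finset.range P.L, (· * H3.C (l * P.G)) '' P.S := by
    ext s
    simp only [mem_iUnion, Finset.mem_range, exists_prop]
    constructor
    · intro hs
      obtain ⟨l, hl, s0, h0, rfl⟩ := P.layer_exists hs
      exact ⟨l, hl, s0, h0, rfl⟩
    · rintro ⟨l, hl, s0, h0, rfl⟩
      exact P.layer_mem h0 hl
  rw [this, haar_layers_eq _ P.meas_S le_rfl, Finset.card_range]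

lemma haar_mul_le (A : Set H3) (W : Finset H3) : H3.haar (A * (W : Set H3)) ≤ W.card * H3.haar A := by
  have : A * (W : Set H3) = ⋃ x ∈ W, (· * x) '' A := by
    ext s
    simp only [mem_iUnion, exists_prop, Set.mem_mul, mem_image, Finset.mem_coe]
    constructor
    · rintro ⟨a, ha, x, hx, rfl⟩; exact ⟨x, hx, a, ha, rfl⟩
    · rintro ⟨x, hx, a, ha, rfl⟩; exact ⟨a, ha, x, hx, rfl⟩
  rw [this]
  refine (measure_biUnion_finset_le _ _).trans ?_
  simp

lemma S6 : H3.haar (P.F' \ (P.F * {x | x ∈ P.Cf ∧ H3.C (8 * P.h : ℕ) * x ∈ P.Cf})) ≤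
    (8 * P.M : ℕ) * H3.haar P.S + P.L * H3.haar (P.S \ P.D) := by
  have hsub : P.F' \ (P.F * {x | x ∈ P.Cf ∧ H3.C (8 * P.h : ℕ) * x ∈ P.Cf}) ⊆
      (⋃ l ∈ Finset.Ico (P.L - 8 * P.M) P.L, (· * H3.C (l * P.G)) '' P.S) ∪
      ⋃ l ∈ Finset.range P.L, (· * H3.C (l * P.G)) '' (P.S \ P.D) := by
    rintro s ⟨hs, hn⟩
    obtain ⟨l, hl, s0, h0, rfl⟩ := P.layer_exists hs
    by_cases hD : s0 ∈ P.D
    · left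
      by_cases hlL : l + 8 * P.M < P.L
      · exfalso
        obtain ⟨f, hf, x, hx, e, hsh⟩ := P.cover_shift hD hl
        apply hn
        rw [e]
        refine Set.mul_mem_mul hf ⟨hx, hsh 8 ?_ hlL⟩
        simp [kap]
      · simp only [mem_iUnion, Finset.mem_Ico]
        exact ⟨l, ⟨by omega, hl⟩, s0, h0, rfl⟩
    · right
      simp only [mem_iUnion, Finset.mem_range]
      exact ⟨l, hl, s0, ⟨h0, hD⟩, rfl⟩
  refine (measure_mono hsub).trans ((measure_union_le _ _).trans ?_)
  refine add_le_add ((P.haar_layers _ _).trans ?_) ((P.haar_layers _ _).trans ?_)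
  · gcongr
    simp only [Nat.card_Ico]
    omega
  · simp

lemma S7 [DecidablePred fun x => H3.C P.h * x ∈ P.Cf ∧ H3.C (3 * P.h : ℕ) * x ∈ P.Cf] :
    (P.M * P.N : ℕ) * H3.haar P.D ≤
    (P.Cf.filter fun x => H3.C P.h * x ∈ P.Cf ∧ H3.C (3 * P.h : ℕ) * x ∈ P.Cf).card *
      H3.haar P.F := by
  classical
  set I : Finset ℕ := (Finset.range P.N ×ˢ Finset.range P.M).image fun z => 8 * P.M * z.1 + z.2
  have hM := P.M_pos
  have hI : I.card = P.M * P.N := by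
    rw [Finset.card_image_of_injOn]
    · simp [mul_comm]
    · rintro ⟨n, m⟩ h1 ⟨n', m'⟩ h2 h
      simp only [Finset.coe_product, Finset.coe_range, mem_prod, mem_Iio] at h1 h2
      have e1 : (8 * P.M * n + m) / (8 * P.M) = n := by
        rw [Nat.mul_add_div (by omega), Nat.div_eq_of_lt (by omega), add_zero]
      have e2 : (8 * P.M * n' + m') / (8 * P.M) = n' := by
        rw [Nat.mul_add_div (by omega), Nat.div_eq_of_lt (by omega), add_zero]
      have h' : 8 * P.M * n + m = 8 * P.M * n' + m' := h
      have : n = n' := by rw [← e1, ← e2, h']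
      subst this
      have : m = m' := by omega
      rw [this]
  rw [← hI, ← P.haar_layers_eq P.meas_D P.D_sub I]
  refine le_trans (measure_mono ?_) (haar_mul_le P.F _)
  intro s hs
  simp only [mem_iUnion] at hs
  obtain ⟨l, hl, s0, h0, rfl⟩ := hs
  simp only [I, Finset.mem_image, Finset.mem_product, Finset.mem_range, Prod.exists] at hl
  obtain ⟨n, m, ⟨hn, hm⟩, rfl⟩ := hl
  have hlt : 8 * P.M * n + m + 3 * P.M < P.L := by
    have : 8 * P.M * (n + 1) ≤ 8 * P.M * P.N := Nat.mul_le_mul_left _ hn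
    unfold L
    rw [mul_add, mul_one] at this
    omega
  obtain ⟨f, hf, x, hx, e, hsh⟩ := P.cover_shift h0 (l := 8 * P.M * n + m) (by omega)
  refine ⟨f, hf, x, ?_, e.symm⟩
  have hd : (8 * P.M * n + m) / P.M = 8 * n := by
    rw [show 8 * P.M * n + m = P.M * (8 * n) + m by ring, Nat.mul_add_div hM,
      Nat.div_eq_of_lt hm, add_zero]
  rw [hd] at hsh
  have k0 : kap (8 * n) = 0 := by simp [kap]
  have k1 : kap (8 * n + 1) = 0 := by simp [kap, Nat.add_mod]
  have k3 : kap (8 * n + 3) = 0 := by simp [kap, Nat.add_mod]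
  simp only [Finset.coe_filter, mem_ofPred_eq]
  refine ⟨hx, ?_, ?_⟩
  · have := hsh 1 (by rw [k0, k1]) (by omega)
    simpa using this
  · exact hsh 3 (by rw [k0, k3]) (by omega)

end Par
end HW

namespace HW
open MeasureTheory Set

lemma mul_fin_eq (A : Set H3) (W : Finset H3) : A * (W : Set H3) = ⋃ x ∈ W, (· * x) '' A := by
  ext s
  simp only [mem_iUnion, exists_prop, Set.mem_mul, mem_image, Finset.mem_coe]
  constructor
  · rintro ⟨a, ha, x, hx, rfl⟩; exact ⟨x, hx, a, ha, rfl⟩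
  · rintro ⟨x, hx, a, ha, rfl⟩; exact ⟨a, ha, x, hx, rfl⟩

lemma meas_mul_fin {A : Set H3} (hA : MeasurableSet A) (W : Finset H3) :
    MeasurableSet (A * (W : Set H3)) := by
  rw [mul_fin_eq]
  exact Finset.measurableSet_biUnion _ fun x _ => meas_rt hA x

lemma haar_mul_eq {F A : Set H3} (hA : MeasurableSet A) (hAF : A ⊆ F) (W : Finset H3)
    (h1 : ∀ f ∈ F, ∀ f' ∈ F, ∀ x ∈ W, ∀ x' ∈ W, f * x = f' * x' → x = x') :
    H3.haar (A * (W : Set H3)) = W.card * H3.haar A := by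
  rw [mul_fin_eq, measure_biUnion_finset]
  · simp
  · intro x hx x' hx' hne
    refine Set.disjoint_left.2 ?_
    rintro _ ⟨f, hf, rfl⟩ ⟨f', hf', h⟩
    exact hne (h1 f' (hAF hf') f (hAF hf) x' hx' x hx h).symm
  · intro x _; exact meas_rt hA x

namespace Par
variable (P : Par)

lemma lat_refine (d : Z3) : lat P.α P.β d =
    lat P.u P.v (P.q * d.1, P.q * d.2.1, (P.q : ℤ) ^ 2 * d.2.2) := by
  have := P.qR
  ext <;> simp [lat, u, v] <;> field_simp

lemma lat_inj {t t' : Z3} (h : lat P.u P.v t = lat P.u P.v t') : t = t' := by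
  have h1 := P.u_pos
  have h2 := P.v_pos
  have h0 : (1 : H3) ∈ Bx P.u P.v (P.u * P.v) := by
    simp [Bx]; refine ⟨h1, h2, by positivity⟩
  exact tile_unique h0 h0 (by rw [h])

lemma ofs_inj {d d' : Z3} {j j' : JJ P.q}
    (h : lat P.α P.β d * P.ofs j = lat P.α P.β d' * P.ofs j') : j = j' := by
  unfold ofs at h
  rw [lat_refine, lat_refine, lat_mul, lat_mul] at h
  have h := P.lat_inj h
  simp only [zm, jz, Prod.mk.injEq] at h
  obtain ⟨h1, h2, h3⟩ := h
  have key : ∀ (m : ℕ) (i i' : ℤ) (a a' : Fin m), (m : ℤ) * i + ((a : ℕ) : ℤ) =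
      m * i' + ((a' : ℕ) : ℤ) → i = i' ∧ a = a' := by
    intro m i i' a a' h
    have e : i = i' := by
      have h' : ((a : ℕ) : ℝ) + (m : ℝ) * i = ((a' : ℕ) : ℝ) + m * i' := by
        have : (((m : ℤ) * i + ((a : ℕ) : ℤ) : ℤ) : ℝ) = ((m * i' + ((a' : ℕ) : ℤ) : ℤ) : ℝ) := by
          rw [h]
        push_cast at this; linarith
      exact int_unique ⟨by positivity, by exact_mod_cast a.2⟩
        ⟨by positivity, by exact_mod_cast a'.2⟩ h'
    subst e
    refine ⟨rfl, Fin.ext ?_⟩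
    have : ((a : ℕ) : ℤ) = a' := by linarith
    exact_mod_cast this
  obtain ⟨e1, f1⟩ := key _ _ _ _ _ h1
  obtain ⟨e2, f2⟩ := key _ _ _ _ _ h2
  rw [e1, f2] at h3
  obtain ⟨e3, f3⟩ := key (P.q ^ 2) d.2.2 d'.2.2 j.2.2 j'.2.2 (by push_cast; linarith)
  ext1
  · exact f1
  · ext1
    · exact f2
    · exact f3

def KD (K : Set H3) (j : JJ P.q) : Set H3 := {s | ∃ k ∈ K, ∃ d, s = k * lat P.α P.β d * P.ofs j}

lemma meas_KD {K : Set H3} (hK : MeasurableSet K) (j : JJ P.q) : MeasurableSet (P.KD K j) := by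
  have : P.KD K j = ⋃ d : Z3, (· * (lat P.α P.β d * P.ofs j)) '' K := by
    ext s
    simp only [KD, mem_ofPred_eq, mem_iUnion, mem_image]
    constructor
    · rintro ⟨k, hk, d, rfl⟩; exact ⟨d, k, hk, by simp only [mul_assoc]⟩
    · rintro ⟨d, k, hk, rfl⟩; exact ⟨k, hk, d, by simp only [mul_assoc]⟩
  rw [this]
  exact MeasurableSet.iUnion fun d => meas_rt hK _

def covers (K : Set H3) (T : Finset Z3) : Prop :=
  ∀ s ∈ K, ∃ t ∈ T, ∃ e ∈ Bx P.u P.v (P.u * P.v), s = e * lat P.u P.v t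

lemma jcount {K : Set H3} {T : Finset Z3} (hT : P.covers K T) (s : H3) (J' : Finset (JJ P.q))
    (hJ : ∀ j ∈ J', s ∈ P.KD K j) : J'.card ≤ T.card := by
  have h : ∀ j ∈ J', ∃ t ∈ T, ∃ e ∈ Bx P.u P.v (P.u * P.v), ∃ d,
      s = e * lat P.u P.v t * lat P.α P.β d * P.ofs j := by
    intro j hj
    obtain ⟨k, hk, d, hd⟩ := hJ j hj
    obtain ⟨t, ht, e, he, hke⟩ := hT k hk
    exact ⟨t, ht, e, he, d, by rw [hd, hke]⟩
  choose! t ht e he d hd using h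
  refine Finset.card_le_card_of_injOn t ht ?_
  intro j hj j' hj' hjj
  have h1 := (hd j hj).symm.trans (hd j' hj')
  rw [← hjj] at h1
  simp only [ofs, lat_refine, mul_assoc, lat_mul] at h1
  have h3 := tile_unique (he j hj) (he j' hj') h1
  have h4 : lat P.u P.v (t j) * lat P.α P.β (d j) * P.ofs j =
      lat P.u P.v (t j) * lat P.α P.β (d j') * P.ofs j' := by
    simp only [ofs, lat_refine, lat_mul]
    rw [h3]
  rw [mul_assoc, mul_assoc] at h4
  exact P.ofs_inj (mul_left_cancel h4)

lemma fun_count {J : Type*} [Fintype J] [DecidableEq J] (GA GB : Finset J) {x y : Fin 3}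
    (hxy : x ≠ y) (I : Finset (Fin 3 → J)) (h : ∀ j ∈ I, j x ∈ GA ∧ j y ∈ GB) :
    I.card ≤ Fintype.card J * GA.card * GB.card := by
  have hsub : I ⊆ Fintype.piFinset
      (fun i => if i = x then GA else if i = y then GB else Finset.univ) := by
    intro j hj
    rw [Fintype.mem_piFinset]
    intro i
    obtain ⟨h1, h2⟩ := h j hj
    by_cases hx : i = x
    · subst hx; simpa using h1
    · by_cases hy : i = y
      · subst hy; simpa [hx] using h2
      · simp [hx, hy]
  refine (Finset.card_le_card hsub).trans (le_of_eq ?_)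
  rw [Fintype.card_piFinset, Fin.prod_univ_three]
  fin_cases x <;> fin_cases y <;> simp at hxy ⊢ <;> first | ring1 | simp [mul_comm, mul_assoc, mul_left_comm]

lemma pair_sum {KA KB : Set H3} (hKA : MeasurableSet KA) (hKB : MeasurableSet KB)
    {TA TB : Finset Z3} (hTA : P.covers KA TA) (hTB : P.covers KB TB) {x y : Fin 3}
    (hxy : x ≠ y) :
    ∑ j : Fin 3 → JJ P.q, H3.haar (P.S ∩ (P.KD KA (j x) ∩ P.KD KB (j y))) ≤
      (Fintype.card (JJ P.q) * TA.card * TB.card : ℕ) * H3.haar P.S := by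
  classical
  refine sum_meas_le _ _ _ (fun j _ => ?_) P.meas_S (fun j _ => inter_subset_left) _ ?_
  · exact P.meas_S.inter ((P.meas_KD hKA _).inter (P.meas_KD hKB _))
  · intro s _ I _ hI
    refine (fun_count (Finset.univ.filter fun j => s ∈ P.KD KA j)
      (Finset.univ.filter fun j => s ∈ P.KD KB j) hxy I ?_).trans ?_
    · intro j hj
      simpa using (hI j hj).2
    · gcongr
      · exact P.jcount hTA s _ (by simp)
      · exact P.jcount hTB s _ (by simp)

lemma mem_KD_of {K : Set H3} (hK : K ⊆ P.F) {s0 : H3} (hs0 : s0 ∈ P.S) {l : ℕ}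
    (h : s0 * H3.C (l * P.G) ∈ K * (P.Cf : Set H3)) :
    s0 ∈ P.KD K (P.dec l (kap (l / P.M))) := by
  obtain ⟨k, hk, x, hx, e⟩ := h
  obtain ⟨l', hl', d, hd, rfl⟩ := P.mem_Cf.1 hx
  have e' : k * lat P.α P.β d * P.off l' * H3.C (l' * P.G) = s0 * H3.C (l * P.G) := by
    simp only [mul_assoc] at e ⊢; exact e
  obtain ⟨rfl, h2⟩ := P.layer_unique (hd k (hK hk)) hs0 e'
  exact ⟨k, hk, d, h2.symm⟩

/-- the set of points of the big tower with prescribed behaviour -/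
def Zs (A B : Set H3) (i2 : ℕ → ℕ) : Set H3 :=
  {s | s ∈ P.F' ∧ s ∈ A * (P.Cf : Set H3) ∧ ∀ l : ℕ, ∀ s0 ∈ P.S, s = s0 * H3.C (l * P.G) →
    (H3.C (i2 (l / P.M) * P.h : ℕ) * s ∈ B * (P.Cf : Set H3) ∨
      H3.C (i2 (l / P.M) * P.h : ℕ) * s ∉ P.F')}

lemma haar_Zs {A B : Set H3} (hA : A ⊆ P.F) (hB : B ⊆ P.F) {KA KB : Set H3}
    (hKA : MeasurableSet KA) (hKB : MeasurableSet KB) (hKAA : KA ⊆ A) (hKBB : KB ⊆ B)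
    {TA TB : Finset Z3} (hTA : P.covers KA TA) (hTB : P.covers KB TB)
    {δ : ENNReal} (hdA : H3.haar (A \ KA) ≤ δ) (hdB : H3.haar (B \ KB) ≤ δ)
    (i2 : ℕ → ℕ) (hi4 : ∀ p, i2 p ≤ 4) (hi8 : ∀ p, i2 (p % 8) = i2 p)
    (hik : ∀ p, kap p ≠ kap (p + i2 p)) :
    H3.haar (P.Zs A B i2) ≤ (8 * P.M : ℕ) * H3.haar P.S + 6 * (P.Cf.card * δ) +
      (8 * P.N * (Fintype.card (JJ P.q) * TA.card * TB.card) : ℕ) * H3.haar P.S := by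
  classical
  have hM := P.M_pos
  set Q : ℕ → (Fin 3 → JJ P.q) → Set H3 := fun p j =>
    P.S ∩ (P.KD KA (j (kap p)) ∩ P.KD KB (j (kap (p + i2 p)))) with hQ
  set X1 : Set H3 := ⋃ l ∈ Finset.Ico (P.L - 8 * P.M) P.L, (· * H3.C (l * P.G)) '' P.S with hX1
  set X2 : Set H3 := (A \ KA) * (P.Cf : Set H3) with hX2
  set X3 : Set H3 := ⋃ i ∈ Finset.range 5,
    ((H3.C (i * P.h : ℕ))⁻¹ * ·) '' ((B \ KB) * (P.Cf : Set H3)) with hX3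
  set X4 : Set H3 := ⋃ z ∈ Finset.range P.N ×ˢ Finset.range 8, ⋃ j ∈ Finset.univ,
    (· * H3.C (((z.1 * 8 + z.2) * P.M + (Fintype.equivFin (Fin 3 → JJ P.q) j : ℕ) : ℕ) * P.G)) ''
      Q z.2 j with hX4
  have hsub : P.Zs A B i2 ⊆ X1 ∪ (X2 ∪ X3) ∪ X4 := by
    rintro s ⟨hs, hsA, hsB⟩
    obtain ⟨l, hl, s0, h0, rfl⟩ := P.layer_exists hs
    have hsB := hsB l s0 h0 rfl
    by_cases hlL : P.L ≤ l + 8 * P.M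
    · left; left
      simp only [hX1, mem_iUnion, Finset.mem_Ico]
      exact ⟨l, ⟨by omega, hl⟩, s0, h0, rfl⟩
    push Not at hlL
    set i := i2 (l / P.M) with hi
    have hi4' : i ≤ 4 := hi4 _
    have hiM : i * P.M ≤ 4 * P.M := Nat.mul_le_mul_right _ hi4'
    have hin : H3.C (i * P.h : ℕ) * (s0 * H3.C (l * P.G)) ∈ P.F' := by
      rw [C_shift]; exact P.layer_mem h0 (by omega)
    have hsB : H3.C (i * P.h : ℕ) * (s0 * H3.C (l * P.G)) ∈ B * (P.Cf : Set H3) := by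
      rcases hsB with h | h
      · exact h
      · exact absurd hin h
    by_cases c1 : s0 * H3.C (l * P.G) ∈ KA * (P.Cf : Set H3)
    · by_cases c2 : H3.C (i * P.h : ℕ) * (s0 * H3.C (l * P.G)) ∈ KB * (P.Cf : Set H3)
      · right
        have m1 := P.mem_KD_of (hKAA.trans hA) h0 c1
        rw [C_shift] at c2
        have m2 := P.mem_KD_of (hKBB.trans hB) h0 c2
        rw [dec_add, div_add] at m2
        set p := l / P.M with hp
        have hkmod : ∀ a b : ℕ, kap (a % 8 + b) = kap (a + b) := by
          intro a b; simp [kap]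
        have hpN : p / 8 < P.N := by
          rw [hp, Nat.div_div_eq_div_mul, Nat.div_lt_iff_lt_mul (by omega)]
          calc l < P.L := hl
            _ = P.N * (P.M * 8) := by unfold L; ring
        have hidx : (Fintype.equivFin (Fin 3 → JJ P.q) (P.dec l) : ℕ) = l % P.M := by
          simp [dec]
        have hll : (p / 8 * 8 + p % 8) * P.M +
            (Fintype.equivFin (Fin 3 → JJ P.q) (P.dec l) : ℕ) = l := by
          rw [hidx, mul_comm (p / 8) 8, Nat.div_add_mod, hp, mul_comm, Nat.div_add_mod]
        simp only [hX4, mem_iUnion]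
        refine ⟨(p / 8, p % 8), ?_, P.dec l, Finset.mem_univ _, s0, ⟨h0, ?_, ?_⟩, ?_⟩
        · simp [hpN, Nat.mod_lt]
        · have := hkmod p 0
          simp only [add_zero] at this
          rw [this]; exact m1
        · rw [hi8, hkmod]; exact m2
        · simp only [hll]
      · left; right; right
        obtain ⟨b, hb, x, hx, e⟩ := hsB
        simp only [hX3, mem_iUnion, Finset.mem_range]
        refine ⟨i, by omega, b * x, ⟨b, ⟨hb, fun hbk => ?_⟩, x, hx, rfl⟩, ?_⟩
        · exact c2 ⟨b, hbk, x, hx, e⟩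
        · simp only [] at e ⊢
          rw [e]; group
    · left; right; left
      obtain ⟨a, ha, x, hx, e⟩ := hsA
      exact ⟨a, ⟨ha, fun hak => c1 ⟨a, hak, x, hx, e⟩⟩, x, hx, e⟩
  have b1 : H3.haar X1 ≤ (8 * P.M : ℕ) * H3.haar P.S := by
    refine (P.haar_layers _ _).trans ?_
    gcongr
    simp only [Nat.card_Ico]
    omega
  have b2 : H3.haar X2 ≤ P.Cf.card * δ := (haar_mul_le _ _).trans (by gcongr)
  have b3 : H3.haar X3 ≤ 5 * (P.Cf.card * δ) := by
    refine (measure_biUnion_finset_le _ _).trans ?_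
    have : ∀ i ∈ Finset.range 5, H3.haar (((H3.C (i * P.h : ℕ))⁻¹ * ·) ''
        ((B \ KB) * (P.Cf : Set H3))) ≤ P.Cf.card * δ := by
      intro i _
      rw [haar_lt]
      exact (haar_mul_le _ _).trans (by gcongr)
    refine (Finset.sum_le_sum this).trans ?_
    simp
  have b4 : H3.haar X4 ≤
      (8 * P.N * (Fintype.card (JJ P.q) * TA.card * TB.card) : ℕ) * H3.haar P.S := by
    refine (measure_biUnion_finset_le _ _).trans ?_
    have : ∀ z ∈ Finset.range P.N ×ˢ Finset.range 8, H3.haar (⋃ j ∈ Finset.univ,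
        (· * H3.C (((z.1 * 8 + z.2) * P.M +
          (Fintype.equivFin (Fin 3 → JJ P.q) j : ℕ) : ℕ) * P.G)) '' Q z.2 j) ≤
        (Fintype.card (JJ P.q) * TA.card * TB.card : ℕ) * H3.haar P.S := by
      intro z _
      refine (measure_biUnion_finset_le _ _).trans ?_
      simp only [haar_layer]
      exact P.pair_sum hKA hKB hTA hTB (hik _)
    refine (Finset.sum_le_sum this).trans (le_of_eq ?_)
    rw [Finset.sum_const, Finset.card_product, Finset.card_range, Finset.card_range, nsmul_eq_mul]
    push_cast; ring
  calc H3.haar (P.Zs A B i2) ≤ H3.haar (X1 ∪ (X2 ∪ X3) ∪ X4) := measure_mono hsub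
    _ ≤ H3.haar X1 + (H3.haar X2 + H3.haar X3) + H3.haar X4 :=
        (measure_union_le _ _).trans (add_le_add ((measure_union_le _ _).trans
          (add_le_add le_rfl (measure_union_le _ _))) le_rfl)
    _ ≤ (8 * P.M : ℕ) * H3.haar P.S + (P.Cf.card * δ + 5 * (P.Cf.card * δ)) +
      (8 * P.N * (Fintype.card (JJ P.q) * TA.card * TB.card) : ℕ) * H3.haar P.S := by gcongr
    _ = _ := by ring

end Par
end HW

namespace HW
open MeasureTheory Set

lemma kap_mod (a b : ℕ) : kap (a % 8 + b) = kap (a + b) := by simp [kap]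

lemma kap_four (p : ℕ) : kap p ≠ kap (p + 4) := by
  have h0 := kap_mod p 0
  rw [add_zero, add_zero] at h0
  rw [← h0, ← kap_mod p 4]
  have : p % 8 < 8 := Nat.mod_lt _ (by norm_num)
  generalize p % 8 = r at *
  interval_cases r <;> decide

def i23 (p : ℕ) : ℕ := if kap p ≠ kap (p + 2) then 2 else 3

lemma i23_mod (p : ℕ) : i23 (p % 8) = i23 p := by
  have h0 := kap_mod p 0
  rw [add_zero, add_zero] at h0
  unfold i23; rw [h0, kap_mod]

lemma kap_i23 (p : ℕ) : kap p ≠ kap (p + i23 p) := by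
  have h0 := kap_mod p 0
  rw [add_zero, add_zero] at h0
  rw [← h0, ← kap_mod p (i23 p), ← i23_mod]
  have : p % 8 < 8 := Nat.mod_lt _ (by norm_num)
  generalize p % 8 = r at *
  interval_cases r <;> decide

lemma i23_le (p : ℕ) : i23 p ≤ 4 := by unfold i23; split_ifs <;> norm_num

structure Step (α β : ℕ) (fam : ℕ → Set H3) (n : ℕ) (ε : ℝ) (α' β' h : ℕ) (C : Finset H3) :
    Prop where
  s1 : ∀ f ∈ FF α β, ∀ f' ∈ FF α β, ∀ x ∈ C, ∀ x' ∈ C, f * x = f' * x' → x = x'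
  s2 : ∀ f ∈ FF α β, ∀ x ∈ C, f * x ∈ FF α' β'
  s6 : H3.haar.real (FF α' β' \ (FF α β * {x | x ∈ C ∧ H3.C (8 * h : ℕ) * x ∈ C})) ≤
    ε * H3.haar.real (FF α' β')
  s7 : ∃ W ⊆ C, (∀ x ∈ W, H3.C h * x ∈ C ∧ H3.C (3 * h : ℕ) * x ∈ C) ∧
    (1 / 8 - ε) * H3.haar.real (FF α' β') ≤ W.card * H3.haar.real (FF α β)
  s5 : ∀ i < n, ∀ j < n, H3.haar.real {s | s ∈ FF α' β' ∧ s ∈ (fam i ∩ FF α β) * (C : Set H3) ∧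
      (H3.C (4 * h : ℕ) * s ∈ (fam j ∩ FF α β) * (C : Set H3) ∨
        H3.C (4 * h : ℕ) * s ∉ FF α' β')} ≤
    (H3.haar.real (fam i ∩ FF α β) / H3.haar.real (FF α β) *
      (H3.haar.real (fam j ∩ FF α β) / H3.haar.real (FF α β)) + ε) * H3.haar.real (FF α' β')
  s8 : ∀ i < n, H3.haar.real {s | s ∈ FF α' β' ∧ s ∈ (fam i ∩ FF α β) * (C : Set H3) ∧
      (H3.C (2 * h : ℕ) * s ∈ (fam i ∩ FF α β) * (C : Set H3) ∨
        H3.C (2 * h : ℕ) * s ∉ FF α' β') ∧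
      (H3.C (3 * h : ℕ) * s ∈ (fam i ∩ FF α β) * (C : Set H3) ∨
        H3.C (3 * h : ℕ) * s ∉ FF α' β')} ≤
    (H3.haar.real (fam i ∩ FF α β) / H3.haar.real (FF α β) *
      (H3.haar.real (fam i ∩ FF α β) / H3.haar.real (FF α β)) + ε) * H3.haar.real (FF α' β')

lemma arith58 {a b ta tb ε s L M N c f d J : ℝ} (hε : 0 < ε) (hε1 : ε ≤ 1) (hf : 0 < f)
    (hs : 0 ≤ s) (hJ : 0 < J) (hM : M = J ^ 3) (hN : 1 ≤ ε / 2 * N) (hL : L = 8 * M * N)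
    (hd : d = ε / 18 * f) (hc : c * f ≤ L * s) (ha : 0 ≤ a) (hb : 0 ≤ b) (haf : a ≤ f)
    (hbf : b ≤ f) (_hta0 : 0 ≤ ta) (htb0 : 0 ≤ tb)
    (hta : ta * (f / J) ≤ a + d) (htb : tb * (f / J) ≤ b + d) :
    8 * M * s + 6 * (c * d) + 8 * N * (J * ta * tb) * s ≤ (a / f * (b / f) + ε) * (L * s) := by
  have hM0 : 0 < M := by rw [hM]; positivity
  have hN0 : 0 < N := by by_contra h; push Not at h; nlinarith
  have hL0 : 0 < L := by rw [hL]; positivity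
  have hLs : 0 ≤ L * s := by positivity
  have t1 : 8 * M * s ≤ ε / 2 * (L * s) := by
    rw [hL]
    have : 8 * M * s * 1 ≤ 8 * M * s * (ε / 2 * N) := by gcongr
    linarith
  have t2 : 6 * (c * d) ≤ ε / 3 * (L * s) := by
    rw [hd]
    have := mul_le_mul_of_nonneg_left hc (by positivity : 0 ≤ ε / 3)
    linarith
  have e1 : ta / J ≤ a / f + ε / 18 := by
    rw [hd] at hta
    rw [div_add' _ _ _ hf.ne', le_div_iff₀ hf]
    calc ta / J * f = ta * (f / J) := by ring
      _ ≤ _ := hta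
  have e2 : tb / J ≤ b / f + ε / 18 := by
    rw [hd] at htb
    rw [div_add' _ _ _ hf.ne', le_div_iff₀ hf]
    calc tb / J * f = tb * (f / J) := by ring
      _ ≤ _ := htb
  have a1 : a / f ≤ 1 := (div_le_one hf).2 haf
  have b1 : b / f ≤ 1 := (div_le_one hf).2 hbf
  have a0 : 0 ≤ a / f := by positivity
  have b0 : 0 ≤ b / f := by positivity
  have e3 : ta / J * (tb / J) ≤ a / f * (b / f) + ε / 6 := by
    calc ta / J * (tb / J) ≤ (a / f + ε / 18) * (b / f + ε / 18) := by gcongr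
      _ ≤ _ := by nlinarith
  have t3 : 8 * N * (J * ta * tb) * s = (ta / J * (tb / J)) * (L * s) := by
    rw [hL, hM]; field_simp
  rw [t3]
  have t4 := mul_le_mul_of_nonneg_right e3 hLs
  linarith

set_option maxHeartbeats 1000000 in
theorem exists_step (α β : ℕ) (hα : 0 < α) (hβ : 0 < β) (fam : ℕ → Set H3)
    (hfam : ∀ i, MeasurableSet (fam i)) (n : ℕ) (ε : ℝ) (hε : 0 < ε) (hε1 : ε ≤ 1) (R0 : ℕ) :
    ∃ α' β' h : ℕ, ∃ C : Finset H3, 0 < α' ∧ 0 < β' ∧ R0 ≤ α' ∧ R0 ≤ β' ∧ R0 ≤ h ∧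
      Step α β fam n ε α' β' h C := by
  classical
  have hαR : (0 : ℝ) < α := by exact_mod_cast hα
  have hβR : (0 : ℝ) < β := by exact_mod_cast hβ
  set f := H3.haar.real (FF α β) with hf
  have hfpos : 0 < f := by rw [hf, haarR_FF]; positivity
  set d := ε / 18 * f with hd
  have hd0 : 0 < d := by positivity
  have hmA : ∀ i, MeasurableSet (fam i ∩ FF α β) := fun i => (hfam i).inter (meas_FF _ _)
  have hfinA : ∀ i, H3.haar (fam i ∩ FF α β) ≠ ⊤ := fun i =>
    ne_top_of_le_ne_top (haar_FF_ne_top α β) (measure_mono inter_subset_right)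
  have := fun i => approx_cover α β hαR hβR (fam i ∩ FF α β) (hmA i) (hfinA i)
    (ENNReal.ofReal d) (by simpa using hd0)
  choose K hKA hKc hKd q0 hT using this
  set q := (Finset.range n).sup q0 + 1 with hq
  obtain ⟨N, hN⟩ := exists_nat_gt (2 / ε)
  obtain ⟨R1, hR1⟩ := exists_nat_gt (16 * (3 * (α * β)) / ε : ℝ)
  have hN0 : 0 < N := by
    have : (0 : ℝ) < N := lt_trans (by positivity) hN
    exact_mod_cast this
  set P : Par := ⟨α, β, q, N, R1 + R0 + 1, hα, hβ, by omega, hN0, by omega⟩ with hP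
  have hTq : ∀ i < n, ∃ T : Finset Z3, P.covers (K i) T ∧
      T.card * (f / Fintype.card (JJ q)) ≤ H3.haar.real (fam i ∩ FF α β) + d := by
    intro i hi
    obtain ⟨T, hT1, hT2⟩ := hT i q
      (by have := Finset.le_sup (f := q0) (Finset.mem_range.2 hi); omega) (by omega)
    refine ⟨T, hT1, ?_⟩
    have hqR : (0 : ℝ) < q := by rw [hq]; positivity
    have h2 := ENNReal.toReal_mono (ENNReal.add_ne_top.2 ⟨hfinA i, ENNReal.ofReal_ne_top⟩) hT2
    rw [ENNReal.toReal_mul, ENNReal.toReal_add (hfinA i) ENNReal.ofReal_ne_top,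
      ENNReal.toReal_ofReal hd0.le, ENNReal.toReal_natCast] at h2
    have h3 := haarR_Bx (α / q) (β / q) (α / q * (β / q)) (by positivity) (by positivity)
      (by positivity)
    rw [Measure.real] at h3
    rw [h3] at h2
    refine le_trans (le_of_eq ?_) h2
    rw [hf, haarR_FF]
    simp only [Fintype.card_prod, Fintype.card_fin]
    push_cast
    field_simp
  have hR' : (16 * (3 * (α * β)) / ε : ℝ) < P.R := by
    refine hR1.trans_le ?_
    have : P.R = R1 + (R0 + 1) := rfl
    rw [this]; push_cast
    have : (0 : ℝ) ≤ R0 := by positivity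
    linarith
  have hRpos : (0 : ℝ) < P.R := by exact_mod_cast P.hR
  have hM := P.M_pos
  have hLpos : (0 : ℝ) < P.L := by exact_mod_cast P.L_pos
  have hL1 : (1 : ℝ) ≤ P.L := by exact_mod_cast P.L_pos
  set σ := H3.haar.real P.S with hσ
  have hσe : σ = P.L * P.R * P.R * (P.R * P.R) := by
    rw [hσ]
    exact haarR_Bx _ _ _ (by positivity) (by positivity) P.G_pos.le
  have hσ0 : 0 < σ := by rw [hσe]; positivity
  have hSfin := P.S_ne_top
  have hSD : H3.haar.real (P.S \ P.D) ≤ ε / 2 * σ := by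
    have := Bx_diff_deep (k := P.kk) (x := P.L * P.R) (y := P.R) (z := P.G) (by positivity)
      (by positivity) P.G_pos.le P.kk_nonneg
    refine this.trans ?_
    have hk : 16 * P.kk ≤ ε * P.R := by
      have := hR'.le
      rw [div_le_iff₀ hε] at this
      have e : P.kk = 3 * (α * β) := rfl
      rw [e]; linarith
    have hk0 := P.kk_nonneg
    have hR1 : (1 : ℝ) ≤ P.R := by exact_mod_cast P.hR
    have hGe : P.G = P.R * P.R := rfl
    rw [hGe, hσe]
    generalize (P.R : ℝ) = r at *
    generalize (P.L : ℝ) = l at *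
    generalize P.kk = k at *
    have hr3 : 0 ≤ k * r ^ 3 := by positivity
    have i1 : 2 * k * (r * (r * r)) ≤ 2 * k * l * r ^ 3 := by nlinarith
    have i2 : k * l * r ^ 2 ≤ k * l * r ^ 3 := by
      have : r ^ 2 ≤ r ^ 3 := pow_le_pow_right₀ hR1 (by norm_num)
      have h0 : 0 ≤ k * l := by positivity
      nlinarith
    have i3 : 16 * k * (l * r ^ 3) ≤ ε * r * (l * r ^ 3) := by gcongr
    nlinarith
  have hSDfin : H3.haar (P.S \ P.D) ≠ ⊤ := ne_top_of_le_ne_top hSfin (measure_mono sdiff_subset)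
  have hF' : H3.haar.real P.F' = P.L * σ := by
    rw [Measure.real, P.haar_F', ENNReal.toReal_mul, ENNReal.toReal_natCast]; rfl
  have hLN : (P.L : ℝ) = 8 * P.M * N := by
    have : P.L = 8 * P.M * N := rfl
    rw [this]; push_cast; ring
  have hN2 : 1 ≤ ε / 2 * N := by
    rw [div_lt_iff₀ hε] at hN; linarith
  have h8M : 8 * (P.M : ℝ) * σ ≤ ε / 2 * (P.L * σ) := by
    rw [hLN]
    have : 8 * (P.M : ℝ) * σ * 1 ≤ 8 * P.M * σ * (ε / 2 * N) := by gcongr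
    linarith
  have hS1 : ∀ f ∈ FF α β, ∀ f' ∈ FF α β, ∀ x ∈ P.Cf, ∀ x' ∈ P.Cf, f * x = f' * x' → x = x' :=
    fun f hf f' hf' x hx x' hx' h => P.S1 hf hf' hx hx' h
  have hF'fin : H3.haar P.F' ≠ ⊤ := haar_FF_ne_top _ _
  have hcard : (P.Cf.card : ℝ) * f ≤ P.L * σ := by
    have h1 := haar_mul_eq (meas_FF α β) le_rfl P.Cf hS1
    have h2 : H3.haar (FF α β * (P.Cf : Set H3)) ≤ H3.haar P.F' := by
      apply measure_mono
      rintro _ ⟨a, ha, x, hx, rfl⟩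
      exact P.S2 ha hx
    rw [h1] at h2
    have h3 := ENNReal.toReal_mono hF'fin h2
    rw [ENNReal.toReal_mul, ENNReal.toReal_natCast] at h3
    rw [← hF']; exact h3
  have hJpos : (0 : ℝ) < Fintype.card (JJ q) := by
    have : Nonempty (JJ q) := ⟨⟨0, by omega⟩, ⟨0, by omega⟩, ⟨0, by positivity⟩⟩
    exact_mod_cast Fintype.card_pos
  have hMJ : (P.M : ℝ) = (Fintype.card (JJ q) : ℝ) ^ 3 := by
    have : P.M = Fintype.card (JJ q) ^ 3 := by
      unfold Par.M
      rw [Fintype.card_fun, Fintype.card_fin]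
    rw [this]; push_cast; ring
  have main : ∀ i < n, ∀ j < n, ∀ i2 : ℕ → ℕ, (∀ p, i2 p ≤ 4) → (∀ p, i2 (p % 8) = i2 p) →
      (∀ p, kap p ≠ kap (p + i2 p)) → ∀ X ⊆ P.Zs (fam i ∩ FF α β) (fam j ∩ FF α β) i2,
      H3.haar.real X ≤ (H3.haar.real (fam i ∩ FF α β) / f *
        (H3.haar.real (fam j ∩ FF α β) / f) + ε) * (P.L * σ) := by
    intro i hi j hj i2 h4 h8 hk X hX
    obtain ⟨TA, hTA, hTAc⟩ := hTq i hi
    obtain ⟨TB, hTB, hTBc⟩ := hTq j hj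
    have hz := P.haar_Zs (A := fam i ∩ FF α β) (B := fam j ∩ FF α β) inter_subset_right
      inter_subset_right (hKc i).measurableSet (hKc j).measurableSet (hKA i) (hKA j) hTA hTB
      (hKd i) (hKd j) i2 h4 h8 hk
    have hz := (measure_mono hX).trans hz
    have hfin : (8 * P.M : ℕ) * H3.haar P.S + 6 * (P.Cf.card * ENNReal.ofReal d) +
      (8 * P.N * (Fintype.card (JJ P.q) * TA.card * TB.card) : ℕ) * H3.haar P.S ≠ ⊤ := by
      finiteness
    have hz := ENNReal.toReal_mono hfin hz
    rw [ENNReal.toReal_add (by finiteness) (by finiteness),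
      ENNReal.toReal_add (by finiteness) (by finiteness)] at hz
    simp only [ENNReal.toReal_mul, ENNReal.toReal_natCast, ENNReal.toReal_ofReal hd0.le,
      ENNReal.toReal_ofNat] at hz
    push_cast at hz
    refine hz.trans ?_
    refine arith58 (ta := TA.card) (tb := TB.card) (M := P.M) (N := N) (d := d)
      (J := Fintype.card (JJ q)) hε hε1 hfpos hσ0.le hJpos hMJ hN2 hLN hd hcard
      measureReal_nonneg measureReal_nonneg
      (measureReal_mono inter_subset_right (haar_FF_ne_top _ _))
      (measureReal_mono inter_subset_right (haar_FF_ne_top _ _)) (by positivity) (by positivity)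
      hTAc hTBc
  have hRR : R0 ≤ P.R := by
    have : P.R = R1 + R0 + 1 := rfl
    omega
  have hP1 := P.L_pos
  have hR := P.hR
  refine ⟨P.L * P.R, P.R, P.h, P.Cf, by positivity, hR, ?_, hRR, ?_, ?_⟩
  · exact hRR.trans (Nat.le_mul_of_pos_left _ hP1)
  · unfold Par.h
    exact hRR.trans ((Nat.le_mul_of_pos_left _ hR).trans (Nat.le_mul_of_pos_left _ hM))
  have hF'' : H3.haar.real (FF (P.L * P.R) P.R) = P.L * σ := hF'
  refine ⟨hS1, fun a ha x hx => P.S2 ha hx, ?_, ?_, ?_, ?_⟩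
  · rw [hF'']
    have h1 := ENNReal.toReal_mono (by finiteness) P.S6
    rw [ENNReal.toReal_add (by finiteness) (by finiteness)] at h1
    simp only [ENNReal.toReal_mul, ENNReal.toReal_natCast] at h1
    refine h1.trans ?_
    have h2 : (P.L : ℝ) * H3.haar.real (P.S \ P.D) ≤ P.L * (ε / 2 * σ) := by gcongr
    have h3 : 8 * (P.M : ℝ) * (H3.haar P.S).toReal ≤ ε / 2 * (P.L * σ) := h8M
    push_cast
    have h4 : (P.L : ℝ) * (H3.haar (P.S \ P.D)).toReal ≤ P.L * (ε / 2 * σ) := h2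
    linarith
  · refine ⟨P.Cf.filter fun x => H3.C P.h * x ∈ P.Cf ∧ H3.C (3 * P.h : ℕ) * x ∈ P.Cf,
      Finset.filter_subset _ _, fun x hx => (Finset.mem_filter.1 hx).2, ?_⟩
    rw [hF'']
    have hFfin : H3.haar P.F ≠ ⊤ := haar_FF_ne_top _ _
    have h1 := ENNReal.toReal_mono (by finiteness) P.S7
    simp only [ENNReal.toReal_mul, ENNReal.toReal_natCast] at h1
    have h2 : (H3.haar P.F).toReal = f := rfl
    rw [h2] at h1
    refine le_trans ?_ h1
    have hDS : H3.haar.real (P.S \ P.D) = σ - H3.haar.real P.D :=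
      measureReal_sdiff P.D_sub P.meas_D
        hSfin
    have h3 : (1 - ε / 2) * σ ≤ (H3.haar P.D).toReal := by
      have : H3.haar.real P.D = (H3.haar P.D).toReal := rfl
      linarith
    have h5 : ((P.M * P.N : ℕ) : ℝ) = P.L / 8 := by
      rw [hLN]; push_cast
      have : (P.N : ℝ) = N := rfl
      rw [this]; ring
    rw [h5]
    have h6 : (P.L : ℝ) / 8 * ((1 - ε / 2) * σ) ≤ P.L / 8 * (H3.haar P.D).toReal := by gcongr
    have h7 : 0 ≤ ε * (P.L * σ) := by positivity
    nlinarith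
  · intro i hi j hj
    rw [hF'']
    refine main i hi j hj (fun _ => 4) (fun _ => le_rfl) (fun _ => rfl) kap_four _ ?_
    rintro s ⟨a1, a2, a3⟩
    exact ⟨a1, a2, fun l s0 _ _ => a3⟩
  · intro i hi
    rw [hF'']
    refine main i hi i hi i23 i23_le i23_mod kap_i23 _ ?_
    rintro s ⟨a1, a2, a3, a4⟩
    refine ⟨a1, a2, fun l s0 _ _ => ?_⟩
    unfold i23
    split_ifs
    · exact a3
    · exact a4

end HW

namespace HW
open MeasureTheory Set

open ProbabilityTheory in
theorem inverse_limit {Ω : Type} [MeasurableSpace Ω] [StandardBorelSpace Ω] [Nonempty Ω]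
    (π : ℕ → Ω → Ω) (hπ : ∀ n, Measurable (π n)) (l : ℕ → Measure Ω)
    (hl : ∀ n, IsProbabilityMeasure (l n)) (hc : ∀ n, (l (n+1)).map (π n) = l n) :
    ∃ P : Measure (ℕ → Ω), IsProbabilityMeasure P ∧ (∀ n, P.map (fun x => x n) = l n) ∧
      ∀ᵐ x ∂P, ∀ n, x n = π n (x (n+1)) := by
  let K : (n : ℕ) → Kernel Ω Ω := fun n => condDistrib id (π n) (l (n+1))
  let κ : (n : ℕ) → Kernel (Π _i : Finset.Iic n, Ω) Ω := fun n =>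
    (K n).comap (fun y => y ⟨n, Finset.mem_Iic.2 le_rfl⟩) (by fun_prop)
  have hκ : ∀ n, IsMarkovKernel (κ n) := fun n => by dsimp [κ, K]; infer_instance
  let P : Measure (ℕ → Ω) := Kernel.trajMeasure (X := fun _ => Ω) (l 0) κ
  have hP : IsProbabilityMeasure P := by dsimp [P]; infer_instance
  have h0 : P.map (fun x => x 0) = l 0 := by
    have h1 : P.map (Preorder.frestrictLe (π := fun _ => Ω) 0) =
        (l 0).map (MeasurableEquiv.piUnique (fun _ : Finset.Iic 0 => Ω)).symm := by
      dsimp only [P]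
      rw [Kernel.trajMeasure, Measure.map_comp _ _ (by fun_prop), Kernel.traj_map_frestrictLe,
        Kernel.partialTraj_self]
      exact Measure.id_comp
    have h2 : (fun x : ℕ → Ω => x 0) = (MeasurableEquiv.piUnique (fun _ : Finset.Iic 0 => Ω)) ∘
        (Preorder.frestrictLe (π := fun _ => Ω) 0) := by
      funext x; rfl
    rw [h2, ← Measure.map_map (MeasurableEquiv.measurable _) (by fun_prop), h1,
      Measure.map_map (MeasurableEquiv.measurable _) (MeasurableEquiv.measurable _),
      MeasurableEquiv.self_comp_symm]
    exact Measure.map_id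
  have hstep : ∀ n, P.map (fun x => x n) = l n →
      P.map (fun x => (x n, x (n+1))) = (l (n+1)).map (fun y => (π n y, y)) := by
    intro n hn
    have e1 := Kernel.map_frestrictLe_trajMeasure_compProd_eq_map_trajMeasure
      (X := fun _ => Ω) (κ := κ) (μ₀ := l 0) (a := n)
    have e2 : (l (n+1)).map (fun y => (π n y, y)) = (l n) ⊗ₘ K n := by
      have := compProd_map_condDistrib (mβ := ‹MeasurableSpace Ω›) (μ := l (n+1)) (X := π n) (Y := id) 
        (by fun_prop)
      rw [hc] at this
      exact this.symm
    have e3 : P.map (fun x => (x n, x (n+1))) =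
      (P.map (fun x => (Preorder.frestrictLe (π := fun _ => Ω) n x, x (n+1)))).map
        (Prod.map (fun y => y ⟨n, Finset.mem_Iic.2 le_rfl⟩) id) := by
      rw [Measure.map_map (by fun_prop) (by fun_prop)]; rfl
    rw [e3, e2, ← hn]
    dsimp only [P] at e1 ⊢
    rw [← e1]
    ext s hs
    rw [Measure.map_apply (by fun_prop) hs, Measure.compProd_apply (by measurability),
      Measure.compProd_apply hs, lintegral_map (Kernel.measurable_kernel_prodMk_left hs)
      (by fun_prop), lintegral_map _ (by fun_prop)]
    · rfl
    · exact Kernel.measurable_kernel_prodMk_left (by measurability)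
  have hlaw : ∀ n, P.map (fun x => x n) = l n := by
    intro n
    induction n with
    | zero => exact h0
    | succ n ih =>
      have h1 := hstep n ih
      have h2 : P.map (fun x => x (n+1)) = (P.map (fun x => (x n, x (n+1)))).map Prod.snd := by
        rw [Measure.map_map (by fun_prop) (by fun_prop)]; rfl
      rw [h2, h1, Measure.map_map (by fun_prop) (by fun_prop)]
      exact Measure.map_id
  refine ⟨P, hP, hlaw, ?_⟩
  rw [ae_all_iff]
  intro n
  have h1 := hstep n (hlaw n)
  have hS : MeasurableSet {p : Ω × Ω | p.1 = π n p.2} := measurableSet_eq_fun (by fun_prop) (by fun_prop)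
  have h3 : ∀ᵐ p ∂(P.map (fun x => (x n, x (n+1)))), p.1 = π n p.2 := by
    rw [h1, ae_map_iff (by fun_prop) hS]
    simp
  rw [ae_map_iff (by fun_prop) hS] at h3
  exact h3
end HW

namespace HW
open MeasureTheory Set

/-- The extra point used outside of the towers. -/
def inf : H3 := ⟨-1, 0, 0⟩

lemma inf_notMem (α β : ℕ) : inf ∉ FF α β := by
  intro h
  have := h.1
  norm_num [inf] at this

open Classical in
/-- Projection of one tower to the preceding one. -/
noncomputable def prj (F : Set H3) (C : Finset H3) (s : H3) : H3 :=
  if h : ∃ f ∈ F, ∃ x ∈ C, f * x = s then h.choose else inf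

/-- Disjointness of the translates of `F`. -/
def Dj (F : Set H3) (C : Finset H3) : Prop :=
  ∀ f ∈ F, ∀ f' ∈ F, ∀ x ∈ C, ∀ x' ∈ C, f * x = f' * x' → x = x'

lemma prj_mul {F : Set H3} {C : Finset H3} (h : Dj F C) {f x : H3} (hf : f ∈ F) (hx : x ∈ C) :
    prj F C (f * x) = f := by
  have H : ∃ f' ∈ F, ∃ x' ∈ C, f' * x' = f * x := ⟨f, hf, x, hx, rfl⟩
  rw [prj, dif_pos H]
  obtain ⟨h1, x', hx', h2⟩ := H.choose_spec
  have := h _ h1 _ hf _ hx' _ hx h2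
  subst this
  exact mul_right_cancel h2

lemma prj_out {F : Set H3} {C : Finset H3} {s : H3} (hs : s ∉ F * (C : Set H3)) :
    prj F C s = inf := by
  rw [prj, dif_neg]
  rintro ⟨f, hf, x, hx, e⟩
  exact hs ⟨f, hf, x, hx, e⟩

lemma prj_cases {F : Set H3} {C : Finset H3} (h : Dj F C) (s : H3) :
    (∃ x ∈ C, prj F C s ∈ F ∧ s = prj F C s * x) ∨ (s ∉ F * (C : Set H3) ∧ prj F C s = inf) := by
  by_cases hs : s ∈ F * (C : Set H3)
  · obtain ⟨f, hf, x, hx, rfl⟩ := hs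
    left
    refine ⟨x, hx, ?_⟩
    simp only
    rw [prj_mul h hf hx]
    exact ⟨hf, rfl⟩
  · right; exact ⟨hs, prj_out hs⟩

lemma prj_preim {F : Set H3} {C : Finset H3} (h : Dj F C) (hi : inf ∉ F) (A : Set H3) :
    prj F C ⁻¹' A = (A ∩ F) * (C : Set H3) ∪ {s | s ∉ F * (C : Set H3) ∧ inf ∈ A} := by
  ext s
  constructor
  · intro hs
    rcases prj_cases h s with ⟨x, hx, h1, h2⟩ | ⟨h1, h2⟩
    · left
      exact ⟨_, ⟨hs, h1⟩, x, hx, h2.symm⟩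
    · right; exact ⟨h1, h2 ▸ hs⟩
  · rintro (⟨f, ⟨hf, hf'⟩, x, hx, rfl⟩ | ⟨h1, h2⟩)
    · change prj F C (f * x) ∈ A
      rw [prj_mul h hf' hx]; exact hf
    · change prj F C s ∈ A
      rw [prj_out h1]; exact h2

lemma meas_prj {F : Set H3} (hF : MeasurableSet F) {C : Finset H3} (h : Dj F C) (hi : inf ∉ F) :
    Measurable (prj F C) := by
  intro A hA
  rw [prj_preim h hi]
  refine (meas_mul_fin (hA.inter hF) C).union ?_
  exact (meas_mul_fin hF C).compl.inter (MeasurableSet.const _)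

/-- The data of the whole cutting-and-stacking construction. -/
structure Dat where
  α : ℕ → ℕ
  β : ℕ → ℕ
  h : ℕ → ℕ
  C : ℕ → Finset H3
  fam : ℕ → ℕ → Set H3
  Q : ℕ → Set H3
  α_pos : ∀ n, 0 < α n
  β_pos : ∀ n, 0 < β n
  α_ge : ∀ n, n ≤ α n
  β_ge : ∀ n, n ≤ β n
  h_ge : ∀ n, n ≤ h n
  α_zero : α 0 = 1
  β_zero : β 0 = 1
  Q_alg : IsSetAlgebra (range Q)
  Q_gen : (inferInstance : MeasurableSpace H3) = MeasurableSpace.generateFrom (range Q)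
  fam_meas : ∀ n k, MeasurableSet (fam n k)
  step : ∀ n, Step (α n) (β n) (fam n) n ((1/2)^(n+2)) (α (n+1)) (β (n+1)) (h n) (C n)
  fam_same : ∀ k, fam (Nat.unpair k).1 k = Q (Nat.unpair k).2
  fam_succ : ∀ n k, (Nat.unpair k).1 ≤ n →
    fam (n+1) k = prj (FF (α n) (β n)) (C n) ⁻¹' fam n k

/-- One state of the recursion. -/
structure St where
  α : ℕ
  β : ℕ
  fam : ℕ → Set H3
  hα : 0 < α
  hβ : 0 < β
  hfam : ∀ k, MeasurableSet (fam k)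

lemma exists_Q : ∃ Q : ℕ → Set H3, IsSetAlgebra (range Q) ∧
    (inferInstance : MeasurableSpace H3) = MeasurableSpace.generateFrom (range Q) := by
  obtain ⟨b, hb, e⟩ := (inferInstance : MeasurableSpace.CountablyGenerated H3).isCountablyGenerated
  obtain ⟨Q, hQ⟩ := (countable_generateSetAlgebra hb).exists_eq_range
    ⟨∅, isSetAlgebra_generateSetAlgebra.empty_mem⟩
  refine ⟨Q, hQ ▸ isSetAlgebra_generateSetAlgebra, ?_⟩
  rw [← hQ, generateFrom_generateSetAlgebra_eq]; exact e

lemma exists_Dat : Nonempty Dat := by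
  obtain ⟨Q, hQ, hg⟩ := exists_Q
  have hQm : ∀ i, MeasurableSet (Q i) := fun i => by
    have := MeasurableSpace.measurableSet_generateFrom (mem_range_self (f := Q) i)
    rw [← hg] at this; exact this
  choose fα fβ fh fC p1 p2 p3 p4 p5 p6 using fun (n : ℕ) (s : St) =>
    exists_step s.α s.β s.hα s.hβ s.fam s.hfam n ((1/2)^(n+2)) (by positivity)
      (pow_le_one₀ (by norm_num) (by norm_num)) (n+1)
  let nx : ℕ → St → St := fun n s =>
    { α := fα n s
      β := fβ n s
      fam := fun k => if (Nat.unpair k).1 ≤ n then prj (FF s.α s.β) (fC n s) ⁻¹' s.fam k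
        else Q (Nat.unpair k).2
      hα := p1 n s
      hβ := p2 n s
      hfam := fun k => by
        split_ifs
        · exact meas_prj (meas_FF _ _) (p6 n s).s1 (inf_notMem _ _) (s.hfam k)
        · exact hQm _ }
  let s0 : St := ⟨1, 1, fun k => Q (Nat.unpair k).2, one_pos, one_pos, fun k => hQm _⟩
  let S : ℕ → St := fun n => Nat.rec s0 (fun n s => nx n s) n
  have hS : ∀ n, S (n+1) = nx n (S n) := fun n => rfl
  exact ⟨{
    α := fun n => (S n).α
    β := fun n => (S n).β
    h := fun n => fh n (S n)
    C := fun n => fC n (S n)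
    fam := fun n => (S n).fam
    Q := Q
    α_pos := fun n => (S n).hα
    β_pos := fun n => (S n).hβ
    α_ge := fun n => by
      cases n with
      | zero => exact Nat.zero_le _
      | succ n => exact p3 n (S n)
    β_ge := fun n => by
      cases n with
      | zero => exact Nat.zero_le _
      | succ n => exact p4 n (S n)
    h_ge := fun n => (Nat.le_succ n).trans (p5 n (S n))
    α_zero := rfl
    β_zero := rfl
    Q_alg := hQ
    Q_gen := hg
    fam_meas := fun n => (S n).hfam
    step := fun n => p6 n (S n)
    fam_same := fun k => by
      generalize hm : (Nat.unpair k).1 = m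
      cases m with
      | zero => rfl
      | succ m =>
        change (if (Nat.unpair k).1 ≤ m then _ else _) = _
        rw [if_neg (by omega)]
    fam_succ := fun n k hk => by
      change (if (Nat.unpair k).1 ≤ n then _ else _) = _
      rw [if_pos hk] }⟩
end HW

namespace HW
open MeasureTheory Set

namespace Dat
variable (D : Dat)

/-- The `n`-th tower shape. -/
def F (n : ℕ) : Set H3 := FF (D.α n) (D.β n)
/-- Its Haar measure. -/
noncomputable def v (n : ℕ) : ℝ := H3.haar.real (D.F n)
/-- The projections. -/
noncomputable def π (n : ℕ) : H3 → H3 := prj (D.F n) (D.C n)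
/-- The relative measure of a tower in the next one. -/
noncomputable def r (n : ℕ) : ℝ := (D.C n).card * D.v n / D.v (n+1)
/-- The partial products. -/
noncomputable def q (n : ℕ) : ℝ := ∏ k ∈ Finset.range n, D.r k
/-- Measure of the towers. -/
noncomputable def p (n : ℕ) : ℝ := (⨅ k, D.q k) / D.q n

lemma dj (n : ℕ) : Dj (D.F n) (D.C n) := (D.step n).s1
lemma meas_F (n : ℕ) : MeasurableSet (D.F n) := meas_FF _ _
lemma F_ne_top (n : ℕ) : H3.haar (D.F n) ≠ ⊤ := haar_FF_ne_top _ _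
lemma inf_F (n : ℕ) : inf ∉ D.F n := inf_notMem _ _
lemma v_pos (n : ℕ) : 0 < D.v n := by
  have h1 : (0:ℝ) < D.α n := by exact_mod_cast D.α_pos n
  have h2 : (0:ℝ) < D.β n := by exact_mod_cast D.β_pos n
  unfold v F
  rw [haarR_FF]; positivity
lemma meas_π (n : ℕ) : Measurable (D.π n) := meas_prj (D.meas_F n) (D.dj n) (D.inf_F n)
lemma FC_sub (n : ℕ) : D.F n * (D.C n : Set H3) ⊆ D.F (n+1) := by
  rintro _ ⟨f, hf, x, hx, rfl⟩
  exact (D.step n).s2 f hf x hx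
lemma haar_AC {A : Set H3} (hA : MeasurableSet A) (n : ℕ) (hAF : A ⊆ D.F n) :
    H3.haar (A * (D.C n : Set H3)) = (D.C n).card * H3.haar A :=
  haar_mul_eq hA hAF _ (D.dj n)
lemma haarR_AC {A : Set H3} (hA : MeasurableSet A) (n : ℕ) (hAF : A ⊆ D.F n) :
    H3.haar.real (A * (D.C n : Set H3)) = (D.C n).card * H3.haar.real A := by
  rw [measureReal_def, D.haar_AC hA n hAF]; simp [measureReal_def]
lemma r_le (n : ℕ) : D.r n ≤ 1 := by
  unfold r
  rw [div_le_one (D.v_pos _)]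
  unfold v
  rw [← D.haarR_AC (D.meas_F n) n subset_rfl]
  exact measureReal_mono (D.FC_sub n) (D.F_ne_top _)
lemma r_ge (n : ℕ) : 1 - (1/2)^(n+2) ≤ D.r n := by
  unfold r
  rw [le_div_iff₀ (D.v_pos _)]
  have h1 := (D.step n).s6
  have h2 : D.v (n+1) - (D.C n).card * D.v n ≤ (1/2)^(n+2) * D.v (n+1) := by
    refine le_trans ?_ h1
    unfold v
    rw [← D.haarR_AC (D.meas_F n) n subset_rfl, ← measureReal_sdiff (D.FC_sub n)
      (meas_mul_fin (D.meas_F n) _) (D.F_ne_top _)]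
    refine measureReal_mono ?_ (measure_ne_top_of_subset sdiff_subset (D.F_ne_top (n+1)))
    refine sdiff_subset_sdiff_right ?_
    exact Set.mul_subset_mul_left fun x hx => hx.1
  linarith
lemma r_pos (n : ℕ) : 0 < D.r n := by
  have h1 := D.r_ge n
  have : ((1:ℝ)/2)^(n+2) ≤ (1/2)^1 := pow_le_pow_of_le_one (by norm_num) (by norm_num) (by omega)
  norm_num at this h1 ⊢
  linarith
lemma q_succ (n : ℕ) : D.q (n+1) = D.q n * D.r n := Finset.prod_range_succ _ _
lemma q_pos (n : ℕ) : 0 < D.q n := Finset.prod_pos fun k _ => D.r_pos k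
lemma q_le (n : ℕ) : D.q n ≤ 1 :=
  Finset.prod_le_one (fun k _ => (D.r_pos k).le) fun k _ => D.r_le k
lemma q_ge (n : ℕ) : 1/2 + (1/2)^(n+1) ≤ D.q n := by
  induction n with
  | zero => norm_num [q]
  | succ n ih =>
    rw [q_succ]
    have h1 := D.r_ge n
    have h2 := D.q_le n
    have h3 := D.q_pos n
    have h4 : (0:ℝ) < (1/2)^(n+2) := by positivity
    have h5 : ((1:ℝ)/2)^(n+1) = 2 * (1/2)^(n+2) := by rw [pow_succ _ (n+1)]; ring
    rw [h5] at ih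
    nlinarith
lemma q_anti : Antitone D.q := antitone_nat_of_succ_le fun n => by
  rw [q_succ]; exact mul_le_of_le_one_right (D.q_pos n).le (D.r_le n)
lemma q_bdd : BddBelow (range D.q) := ⟨0, by rintro _ ⟨n, rfl⟩; exact (D.q_pos n).le⟩
lemma q_tendsto : Tendsto D.q atTop (𝓝 (⨅ k, D.q k)) := tendsto_atTop_ciInf D.q_anti D.q_bdd
lemma q_inf_pos : 0 < ⨅ k, D.q k := by
  have : (1:ℝ)/2 ≤ ⨅ k, D.q k := le_ciInf fun n => by
    have := D.q_ge n
    have h4 : (0:ℝ) < (1/2)^(n+1) := by positivity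
    linarith
  linarith
lemma p_pos (n : ℕ) : 0 < D.p n := div_pos D.q_inf_pos (D.q_pos n)
lemma p_le (n : ℕ) : D.p n ≤ 1 := by
  unfold p; rw [div_le_one (D.q_pos n)]; exact ciInf_le D.q_bdd n
lemma p_tendsto : Tendsto D.p atTop (𝓝 1) := by
  have := (tendsto_const_nhds (x := ⨅ k, D.q k)).div D.q_tendsto D.q_inf_pos.ne'
  rw [div_self D.q_inf_pos.ne'] at this
  exact this
lemma p_succ (n : ℕ) : D.p (n+1) * D.r n = D.p n := by
  unfold p; rw [q_succ]
  have := (D.q_pos n).ne'; have := (D.r_pos n).ne'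
  field_simp

/-- The law of the `n`-th coordinate. -/
noncomputable def lam (n : ℕ) : Measure H3 :=
  ENNReal.ofReal (D.p n / D.v n) • H3.haar.restrict (D.F n) +
    ENNReal.ofReal (1 - D.p n) • Measure.dirac inf

lemma haar_F (n : ℕ) : H3.haar (D.F n) = ENNReal.ofReal (D.v n) := by
  unfold v; rw [ofReal_measureReal (D.F_ne_top n)]

lemma lam_apply (n : ℕ) {A : Set H3} (hA : MeasurableSet A) (hi : inf ∉ A) :
    D.lam n A = ENNReal.ofReal (D.p n / D.v n) * H3.haar (A ∩ D.F n) := by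
  simp [lam, Measure.restrict_apply hA, Measure.dirac_apply' _ hA, hi]

instance lam_prob (n : ℕ) : IsProbabilityMeasure (D.lam n) := ⟨by
  simp only [lam, Measure.coe_add, Measure.coe_smul, Pi.add_apply, Pi.smul_apply,
    Measure.restrict_apply_univ, measure_univ, smul_eq_mul, mul_one]
  rw [D.haar_F, ← ENNReal.ofReal_mul (div_nonneg (D.p_pos n).le (D.v_pos n).le),
    ← ENNReal.ofReal_add]
  · rw [div_mul_cancel₀ _ (D.v_pos n).ne']; simp
  · rw [div_mul_cancel₀ _ (D.v_pos n).ne']; exact (D.p_pos n).le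
  · linarith [D.p_le n]⟩

lemma π_inf (n : ℕ) : D.π n inf = inf := prj_out fun h => D.inf_F (n+1) (D.FC_sub n h)

lemma π_mul (n : ℕ) {f x : H3} (hf : f ∈ D.F n) (hx : x ∈ D.C n) : D.π n (f * x) = f :=
  prj_mul (D.dj n) hf hx

lemma lam_map (n : ℕ) : (D.lam (n+1)).map (D.π n) = D.lam n := by
  have key : ∀ A : Set H3, MeasurableSet A → inf ∉ A →
      (D.lam (n+1)).map (D.π n) A = D.lam n A := by
    intro A hA hi
    rw [Measure.map_apply (D.meas_π n) hA, D.lam_apply n hA hi,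
      D.lam_apply (n+1) (D.meas_π n hA) (by rw [mem_preimage, D.π_inf]; exact hi)]
    have e : D.π n ⁻¹' A ∩ D.F (n+1) = (A ∩ D.F n) * (D.C n : Set H3) := by
      unfold π
      rw [prj_preim (D.dj n) (D.inf_F n)]
      have : {s | s ∉ D.F n * (D.C n : Set H3) ∧ inf ∈ A} = ∅ := by
        ext s; simp [hi]
      rw [this, union_empty, inter_eq_left]
      exact (Set.mul_subset_mul_right inter_subset_right).trans (D.FC_sub n)
    rw [e, D.haar_AC (hA.inter (D.meas_F n)) n inter_subset_right, ← mul_assoc]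
    congr 1
    rw [← ENNReal.ofReal_natCast, ← ENNReal.ofReal_mul (div_nonneg (D.p_pos _).le (D.v_pos _).le)]
    congr 1
    rw [← D.p_succ n, r]
    have := (D.v_pos n).ne'; have := (D.v_pos (n+1)).ne'
    field_simp
  have : IsProbabilityMeasure ((D.lam (n+1)).map (D.π n)) :=
    Measure.isProbabilityMeasure_map (D.meas_π n).aemeasurable
  ext A hA
  by_cases hi : inf ∈ A
  · have := key Aᶜ hA.compl (by simpa using hi)
    rw [prob_compl_eq_one_sub hA, prob_compl_eq_one_sub hA] at this
    have h3 := congrArg (fun t => 1 - t) this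
    beta_reduce at h3
    rwa [ENNReal.sub_sub_cancel ENNReal.one_ne_top prob_le_one,
      ENNReal.sub_sub_cancel ENNReal.one_ne_top prob_le_one] at h3
  · exact key A hA hi

lemma lam_real (n : ℕ) {A : Set H3} (hA : MeasurableSet A) (hAF : A ⊆ D.F n) :
    (D.lam n).real A = D.p n / D.v n * H3.haar.real A := by
  rw [measureReal_def, D.lam_apply n hA fun h => D.inf_F n (hAF h), inter_eq_left.2 hAF,
    ENNReal.toReal_mul, ENNReal.toReal_ofReal (div_nonneg (D.p_pos _).le (D.v_pos _).le)]
  rfl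

/-- `lam`-measure is at most normalized Haar measure on `F n`, plus the defect. -/
lemma lam_real_le (n : ℕ) {A : Set H3} (hA : MeasurableSet A) :
    (D.lam n).real A ≤ H3.haar.real (A ∩ D.F n) / D.v n + (1 - D.p n) := by
  have h1 : (D.lam n).real A ≤ (D.lam n).real (A ∩ D.F n) + (D.lam n).real (D.F n)ᶜ := by
    refine le_trans (measureReal_mono (μ := D.lam n) (s₂ := A ∩ D.F n ∪ (D.F n)ᶜ) ?_) (measureReal_union_le _ _)
    intro x hx
    by_cases h : x ∈ D.F n
    · exact Or.inl ⟨hx, h⟩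
    · exact Or.inr h
  have h2 : (D.lam n).real (D.F n)ᶜ = 1 - D.p n := by
    rw [probReal_compl_eq_one_sub (D.meas_F n), D.lam_real n (D.meas_F n) subset_rfl]
    change 1 - D.p n / D.v n * D.v n = _
    rw [div_mul_cancel₀ _ (D.v_pos n).ne']
  rw [h2, D.lam_real n (hA.inter (D.meas_F n)) inter_subset_right] at h1
  have h3 : D.p n / D.v n * H3.haar.real (A ∩ D.F n) ≤ H3.haar.real (A ∩ D.F n) / D.v n := by
    rw [div_mul_eq_mul_div]
    have := D.v_pos n
    gcongr
    exact mul_le_of_le_one_left measureReal_nonneg (D.p_le n)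
  linarith

end Dat
end HW

namespace HW
open MeasureTheory Set

namespace Dat
variable (D : Dat)

/-- The deep part of the `n`-th tower. -/
def dp (k : ℝ) (n : ℕ) : Set H3 := deep k (D.α n) (D.β n) (D.α n * D.β n)

lemma meas_dp (k : ℝ) (n : ℕ) : MeasurableSet (D.dp k n) := meas_deep _ _ _ _
lemma dp_sub_F {k : ℝ} (hk : 0 ≤ k) (n : ℕ) : D.dp k n ⊆ D.F n :=
  deep_sub_Bx (by positivity) hk
lemma dp_mono {k j : ℝ} (hk : 0 ≤ k) (hkj : k ≤ j) (n : ℕ) : D.dp j n ⊆ D.dp k n :=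
  deep_sub (by positivity) hk hkj
lemma dp_move {j k : ℝ} {n : ℕ} {g s : H3} (hk : 0 ≤ k) (hg : bd j g)
    (hs : s ∈ D.dp (k + j) n) : g * s ∈ D.dp k n := deep_move hk hg hs

lemma exists_bd (g : H3) : ∃ k : ℕ, bd k g := by
  obtain ⟨k, hk⟩ := exists_nat_ge (max |g.a| (max |g.b| |g.c|))
  exact ⟨k, (le_max_left _ _).trans hk, ((le_max_left _ _).trans (le_max_right _ _)).trans hk,
    ((le_max_right _ _).trans (le_max_right _ _)).trans hk⟩

lemma bd_mono {j k : ℝ} (h : j ≤ k) {g : H3} (hg : bd j g) : bd k g :=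
  ⟨hg.1.trans h, hg.2.1.trans h, hg.2.2.trans h⟩

lemma bd_nonneg {k : ℝ} {g : H3} (hg : bd k g) : 0 ≤ k := (abs_nonneg _).trans hg.1

/-- The shift-and-project map. -/
noncomputable def PP (z : ℕ → H3) : ℕ → H3 := fun n => D.π n (z (n+1))

lemma meas_PP : Measurable D.PP := by
  refine measurable_pi_lambda _ fun n => (D.meas_π n).comp (measurable_pi_apply _)

/-- The set of good sequences. -/
def XS : Set (ℕ → H3) := {x | D.PP x = x ∧ ∀ k N : ℕ, ∃ n, N ≤ n ∧ x n ∈ D.dp k n}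

lemma meas_XS : MeasurableSet D.XS := by
  have : D.XS = {x | D.PP x = x} ∩ ⋂ (k : ℕ), ⋂ (N : ℕ), ⋃ (n : ℕ), ⋃ (_ : N ≤ n),
      (fun x => x n) ⁻¹' D.dp k n := by
    ext x; simp [XS]
  rw [this]
  refine (measurableSet_eq_fun D.meas_PP measurable_id).inter ?_
  refine MeasurableSet.iInter fun k => MeasurableSet.iInter fun N => MeasurableSet.iUnion fun n =>
    MeasurableSet.iUnion fun _ => measurable_pi_apply n (D.meas_dp k n)

lemma succ_eq {x : ℕ → H3} (hx : D.PP x = x) {n : ℕ} (hn : x n ∈ D.F n) :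
    ∃ c ∈ D.C n, x (n+1) = x n * c := by
  have e : prj (D.F n) (D.C n) (x (n+1)) = x n := congrFun hx n
  rcases prj_cases (D.dj n) (x (n+1)) with ⟨c, hc, h1, h2⟩ | ⟨h1, h2⟩
  · rw [e] at h2; exact ⟨c, hc, h2⟩
  · rw [e] at h2; rw [h2] at hn; exact absurd hn (D.inf_F n)

lemma π_move {x : ℕ → H3} (hx : D.PP x = x) {n : ℕ} (hn : x n ∈ D.F n) {g : H3}
    (hg : g * x n ∈ D.F n) : x (n+1) ∈ D.F (n+1) ∧ g * x (n+1) ∈ D.F (n+1) ∧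
      D.π n (g * x (n+1)) = g * x n := by
  obtain ⟨c, hc, e⟩ := D.succ_eq hx hn
  rw [e, ← mul_assoc]
  exact ⟨D.FC_sub n ⟨_, hn, c, hc, rfl⟩, D.FC_sub n ⟨_, hg, c, hc, rfl⟩, D.π_mul n hg hc⟩

lemma prop_up {x : ℕ → H3} (hx : D.PP x = x) {n : ℕ} (hn : x n ∈ D.F n) {g : H3}
    (hg : g * x n ∈ D.F n) {m : ℕ} (hm : n ≤ m) : x m ∈ D.F m ∧ g * x m ∈ D.F m := by
  induction m, hm using Nat.le_induction with
  | base => exact ⟨hn, hg⟩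
  | succ m _ ih => obtain ⟨h1, h2, _⟩ := D.π_move hx ih.1 ih.2; exact ⟨h1, h2⟩

lemma iter_high {z : ℕ → H3} {N : ℕ} (hz : ∀ m, N ≤ m → D.π m (z (m+1)) = z m) (j : ℕ) :
    ∀ m, N ≤ m → (D.PP^[j] z) m = z m := by
  induction j with
  | zero => intro m _; rfl
  | succ j ih =>
    intro m hm
    rw [Function.iterate_succ_apply']
    change D.π m _ = _
    rw [ih (m+1) (by omega), hz m hm]

lemma iter_fix {z : ℕ → H3} {N : ℕ} (hz : ∀ m, N ≤ m → D.π m (z (m+1)) = z m) (j : ℕ) :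
    ∀ m, N ≤ m + j → D.π m ((D.PP^[j] z) (m+1)) = (D.PP^[j] z) m := by
  induction j with
  | zero => intro m hm; exact hz m hm
  | succ j ih =>
    intro m hm
    have h1 : (D.PP^[j+1] z) (m+1) = (D.PP^[j] z) (m+1) := by
      rw [Function.iterate_succ_apply']
      exact ih (m+1) (by omega)
    rw [h1]
    conv_rhs => rw [Function.iterate_succ_apply']
    rfl

lemma ex_in {x : ℕ → H3} (hx : x ∈ D.XS) (g : H3) : ∃ n, x n ∈ D.F n ∧ g * x n ∈ D.F n := by
  obtain ⟨k, hk⟩ := exists_bd g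
  obtain ⟨n, _, hn⟩ := hx.2 k 0
  refine ⟨n, D.dp_sub_F (by positivity) n hn, D.dp_sub_F le_rfl n (D.dp_move le_rfl hk ?_)⟩
  rwa [zero_add]

/-- The phase space. -/
abbrev X : Type := D.XS

open Classical in
/-- The action, on sequences. -/
noncomputable def TT (g : H3) (x : D.X) : ℕ → H3 :=
  D.PP^[Nat.find (D.ex_in x.2 g)] fun n => g * x.1 n

lemma TT_spec (g : H3) (x : D.X) : D.PP (D.TT g x) = D.TT g x ∧
    ∀ n, x.1 n ∈ D.F n → g * x.1 n ∈ D.F n → D.TT g x n = g * x.1 n := by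
  classical
  have hN := Nat.find_spec (D.ex_in x.2 g)
  have hmin : ∀ n, (x.1 n ∈ D.F n ∧ g * x.1 n ∈ D.F n) → Nat.find (D.ex_in x.2 g) ≤ n :=
    fun n h => Nat.find_min' _ h
  have e : D.TT g x = D.PP^[Nat.find (D.ex_in x.2 g)] fun n => g * x.1 n := by
    unfold TT; congr!
  rw [e]
  generalize Nat.find (D.ex_in x.2 g) = N at hN hmin
  have hz : ∀ m, N ≤ m → D.π m (g * x.1 (m+1)) = g * x.1 m := fun m hm => by
    obtain ⟨h1, h2⟩ := D.prop_up x.2.1 hN.1 hN.2 hm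
    exact (D.π_move x.2.1 h1 h2).2.2
  constructor
  · funext m
    exact D.iter_fix (z := fun n => g * x.1 n) hz N m (by omega)
  · intro n h1 h2
    exact D.iter_high (z := fun n => g * x.1 n) hz N n (hmin n ⟨h1, h2⟩)

lemma TT_mem (g : H3) (x : D.X) : D.TT g x ∈ D.XS := by
  obtain ⟨h1, h2⟩ := D.TT_spec g x
  refine ⟨h1, fun k N => ?_⟩
  obtain ⟨j, hj⟩ := exists_bd g
  obtain ⟨n, hn, hx⟩ := x.2.2 (k + j) N
  push_cast at hx
  have h3 := D.dp_move (by positivity) hj hx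
  refine ⟨n, hn, ?_⟩
  rw [h2 n (D.dp_sub_F (by positivity) n hx) (D.dp_sub_F (by positivity) n h3)]
  exact h3

/-- The action. -/
noncomputable def T (g : H3) (x : D.X) : D.X := ⟨D.TT g x, D.TT_mem g x⟩

/-- Coordinates. -/
def co (n : ℕ) (x : D.X) : H3 := x.1 n

lemma meas_co (n : ℕ) : Measurable (D.co n) := (measurable_pi_apply n).comp measurable_subtype_coe

lemma T_co {g : H3} {x : D.X} {n : ℕ} (h1 : D.co n x ∈ D.F n) (h2 : g * D.co n x ∈ D.F n) :
    D.co n (D.T g x) = g * D.co n x := (D.TT_spec g x).2 n h1 h2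

lemma co_π (n : ℕ) (x : D.X) : D.π n (D.co (n+1) x) = D.co n x := congrFun x.2.1 n

lemma co_succ {n : ℕ} {x : D.X} (h : D.co n x ∈ D.F n) :
    ∃ c ∈ D.C n, D.co (n+1) x = D.co n x * c := D.succ_eq x.2.1 h

lemma co_ext {x y : D.X} (h : ∀ N, ∃ n, N ≤ n ∧ D.co n x = D.co n y) : x = y := by
  have key : ∀ n k, k ≤ n → D.co n x = D.co n y → D.co k x = D.co k y := by
    intro n k hk
    induction n, hk using Nat.le_induction with
    | base => exact id
    | succ n _ ih =>
      intro e
      apply ih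
      rw [← D.co_π n x, ← D.co_π n y, e]
  apply Subtype.ext
  funext k
  obtain ⟨n, hn, e⟩ := h k
  exact key n k hn e

lemma ex_dp (x : D.X) (k N : ℕ) : ∃ n, N ≤ n ∧ D.co n x ∈ D.dp k n := x.2.2 k N

lemma T_one (x : D.X) : D.T 1 x = x := by
  refine D.co_ext fun N => ?_
  obtain ⟨n, hn, h⟩ := D.ex_dp x 0 N
  have h1 := D.dp_sub_F (by positivity) n h
  refine ⟨n, hn, ?_⟩
  rw [D.T_co h1 (by rwa [one_mul]), one_mul]

lemma T_mul (g h : H3) (x : D.X) : D.T (g * h) x = D.T g (D.T h x) := by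
  refine D.co_ext fun N => ?_
  obtain ⟨j, hj⟩ := exists_bd g
  obtain ⟨i, hi⟩ := exists_bd h
  obtain ⟨n, hn, hx⟩ := D.ex_dp x (j + i) N
  push_cast at hx
  have h0 := D.dp_sub_F (by positivity) n hx
  have h1 := D.dp_move (by positivity) hi hx
  have h1F := D.dp_sub_F (by positivity) n h1
  have h2 : g * (h * D.co n x) ∈ D.dp 0 n := D.dp_move le_rfl hj (by rwa [zero_add])
  have h2F := D.dp_sub_F (by positivity) n h2
  refine ⟨n, hn, ?_⟩
  have e1 := D.T_co h0 h1F
  rw [D.T_co h0 (by rwa [mul_assoc]), D.T_co (by rwa [e1]) (by rwa [e1]), e1, mul_assoc]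

lemma T_free {g : H3} {x : D.X} (h : D.T g x = x) : g = 1 := by
  obtain ⟨n, h1, h2⟩ := D.ex_in x.2 g
  have := D.T_co (g := g) (x := x) h1 h2
  rw [h] at this
  exact (mul_eq_right (a := g) (b := D.co n x)).1 this.symm

lemma T_meas : Measurable fun p : H3 × D.X => D.T p.1 p.2 := by
  classical
  refine Measurable.subtype_mk ?_
  have : (fun p : H3 × D.X => D.TT p.1 p.2) = fun p =>
      (fun N (p : H3 × D.X) => D.PP^[N] fun n => p.1 * D.co n p.2) (Nat.find (D.ex_in p.2.2 p.1)) p := by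
    funext p; unfold TT; simp only [co]
  rw [this]
  have hm : ∀ n, Measurable fun p : H3 × D.X => p.1 * D.co n p.2 := fun n =>
    measurable_fst.mul ((D.meas_co n).comp measurable_snd)
  refine Measurable.find (p := fun n (p : H3 × D.X) => p.2.1 n ∈ D.F n ∧ p.1 * p.2.1 n ∈ D.F n)
    (f := fun N (p : H3 × D.X) => D.PP^[N] fun n => p.1 * D.co n p.2) ?_ ?_ _
  · intro N
    exact (D.meas_PP.iterate N).comp (measurable_pi_lambda _ hm)
  · intro n
    exact ((((D.meas_co n).comp measurable_snd) (D.meas_F n)).inter (hm n (D.meas_F n)))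

lemma T_meas1 (g : H3) : Measurable (D.T g) := D.T_meas.comp measurable_prodMk_left

lemma T_inv (g : H3) (x : D.X) : D.T g⁻¹ (D.T g x) = x := by
  rw [← D.T_mul, inv_mul_cancel, D.T_one]

lemma T_inv' (g : H3) (x : D.X) : D.T g (D.T g⁻¹ x) = x := by
  rw [← D.T_mul, mul_inv_cancel, D.T_one]

end Dat
end HW

namespace HW
open MeasureTheory Set

namespace Dat
variable (D : Dat)

lemma F_diff_dp (k : ℕ) {n : ℕ} (hn : 0 < n) :
    H3.haar.real (D.F n \ D.dp k n) / D.v n ≤ 8 * k / n := by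
  have h1 : (0:ℝ) < D.α n := by exact_mod_cast D.α_pos n
  have h2 : (0:ℝ) < D.β n := by exact_mod_cast D.β_pos n
  have h3 : (n:ℝ) ≤ D.α n := by exact_mod_cast D.α_ge n
  have h4 : (n:ℝ) ≤ D.β n := by exact_mod_cast D.β_ge n
  have h5 : (1:ℝ) ≤ D.β n := by exact_mod_cast D.β_pos n
  have h6 : (0:ℝ) < n := by exact_mod_cast hn
  have hk : (0:ℝ) ≤ k := by positivity
  have := Bx_diff_deep (k := k) h1.le h2.le (mul_pos h1 h2).le hk
  rw [div_le_div_iff₀ (D.v_pos n) h6]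
  have e : D.v n = (D.α n : ℝ) * D.β n * (D.α n * D.β n) := haarR_FF _ _
  rw [e]
  refine (mul_le_mul_of_nonneg_right this h6.le).trans ?_
  generalize (D.α n : ℝ) = a at *
  generalize (D.β n : ℝ) = b at *
  generalize (n : ℝ) = t at *
  have e1 : t * b ≤ a * b := by nlinarith
  have e2 : t * a ≤ a * b := by nlinarith
  have ab : 0 < a * b := mul_pos h1 h2
  have e3 : (2 * k * (b * (a * b)) + 2 * k * (a * (a * b)) + (2 * k + 2 * k * b) * (a * b)) * t
    = 2 * k * (a * b) * (t * b + t * a + t + t * b) := by ring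
  rw [e3]
  have e4 : t * b + t * a + t + t * b ≤ 4 * (a * b) := by nlinarith
  calc _ ≤ 2 * k * (a * b) * (4 * (a * b)) := by gcongr
    _ = _ := by ring

lemma F_diff_dp_tendsto (k : ℕ) :
    Tendsto (fun n => H3.haar.real (D.F n \ D.dp k n) / D.v n) atTop (𝓝 0) := by
  refine squeeze_zero' (Eventually.of_forall fun n => div_nonneg measureReal_nonneg (D.v_pos n).le)
    ?_ (tendsto_const_div_atTop_nhds_zero_nat (8 * k : ℝ))
  filter_upwards [eventually_gt_atTop 0] with n hn using D.F_diff_dp k hn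

lemma lam_dp (k : ℕ) : Tendsto (fun n => (D.lam n).real (D.dp k n)ᶜ) atTop (𝓝 0) := by
  have h1 : Tendsto (fun n => H3.haar.real (D.F n \ D.dp k n) / D.v n + (1 - D.p n)) atTop (𝓝 0) := by
    have := (D.F_diff_dp_tendsto k).add ((tendsto_const_nhds (x := (1:ℝ))).sub D.p_tendsto)
    simpa using this
  refine squeeze_zero (fun n => measureReal_nonneg) (fun n => ?_) h1
  have := D.lam_real_le n (D.meas_dp k n).compl
  rwa [inter_comm, ← sdiff_eq] at this

lemma lam_F (n : ℕ) : (D.lam n).real (D.F n)ᶜ = 1 - D.p n := by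
  rw [probReal_compl_eq_one_sub (D.meas_F n), D.lam_real n (D.meas_F n) subset_rfl]
  change 1 - D.p n / D.v n * D.v n = _
  rw [div_mul_cancel₀ _ (D.v_pos n).ne']

lemma exists_mu : ∃ μ : Measure D.X, IsProbabilityMeasure μ ∧ ∀ n, μ.map (D.co n) = D.lam n := by
  have : Nonempty H3 := ⟨1⟩
  obtain ⟨P, hP, hl, hae⟩ := inverse_limit D.π D.meas_π D.lam (fun n => inferInstance) D.lam_map
  have hX : ∀ᵐ x ∂P, x ∈ D.XS := by
    have h2 : ∀ᵐ x ∂P, ∀ k N : ℕ, ∃ n, N ≤ n ∧ x n ∈ D.dp k n := by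
      rw [ae_all_iff]; intro k
      rw [ae_all_iff]; intro N
      rw [ae_iff]
      have h3 : ∀ n, N ≤ n → P.real {x | ¬ ∃ n, N ≤ n ∧ x n ∈ D.dp k n} ≤
          (D.lam n).real (D.dp k n)ᶜ := by
        intro n hn
        rw [← hl n, map_measureReal_apply (by fun_prop) (D.meas_dp k n).compl]
        refine measureReal_mono ?_
        intro x hx h
        exact hx ⟨n, hn, h⟩
      have h4 := ge_of_tendsto (D.lam_dp k) (eventually_atTop.2 ⟨N, h3⟩)
      have h5 := le_antisymm h4 measureReal_nonneg
      rwa [measureReal_eq_zero_iff] at h5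
    filter_upwards [hae, h2] with x h1 h2
    exact ⟨funext fun n => (h1 n).symm, h2⟩
  have hm : (P.comap ((↑) : D.X → ℕ → H3)).map (↑) = P := by
    rw [map_comap_subtype_coe D.meas_XS, Measure.restrict_eq_self_of_ae_mem hX]
  refine ⟨P.comap (↑), ⟨?_⟩, fun n => ?_⟩
  · have := congrArg (fun m => m univ) hm
    simp only [measure_univ] at this
    rwa [Measure.map_apply measurable_subtype_coe MeasurableSet.univ, preimage_univ] at this
  · rw [← hl n]
    conv_rhs => rw [← hm]
    rw [Measure.map_map (by fun_prop) measurable_subtype_coe]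
    rfl

/-- cylinder sets -/
def cyl : Set (Set D.X) := {E | ∃ n A, MeasurableSet A ∧ E = D.co n ⁻¹' A}

lemma cyl_lift {n m : ℕ} (h : n ≤ m) {A : Set H3} (hA : MeasurableSet A) :
    ∃ A', MeasurableSet A' ∧ D.co n ⁻¹' A = D.co m ⁻¹' A' := by
  induction m, h using Nat.le_induction with
  | base => exact ⟨A, hA, rfl⟩
  | succ m _ ih =>
    obtain ⟨A', h1, h2⟩ := ih
    refine ⟨D.π m ⁻¹' A', D.meas_π m h1, ?_⟩
    rw [h2]
    ext x
    simp only [mem_preimage]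
    rw [D.co_π]

lemma cyl_alg : IsSetAlgebra D.cyl where
  empty_mem := ⟨0, ∅, MeasurableSet.empty, rfl⟩
  compl_mem := by
    rintro _ ⟨n, A, hA, rfl⟩; exact ⟨n, Aᶜ, hA.compl, rfl⟩
  union_mem := by
    rintro _ _ ⟨n, A, hA, rfl⟩ ⟨m, B, hB, rfl⟩
    obtain ⟨A', h1, h2⟩ := D.cyl_lift (le_max_left n m) hA
    obtain ⟨B', h3, h4⟩ := D.cyl_lift (le_max_right n m) hB
    exact ⟨max n m, A' ∪ B', h1.union h3, by rw [h2, h4]; rfl⟩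

lemma cyl_gen : (inferInstance : MeasurableSpace D.X) = MeasurableSpace.generateFrom D.cyl := by
  apply le_antisymm
  · have : @Measurable D.X (ℕ → H3) (MeasurableSpace.generateFrom D.cyl) _ Subtype.val := by
      refine @measurable_pi_lambda _ _ _ (MeasurableSpace.generateFrom D.cyl) _ _ fun n A hA => ?_
      exact MeasurableSpace.measurableSet_generateFrom ⟨n, A, hA, rfl⟩
    exact this.comap_le
  · refine MeasurableSpace.generateFrom_le ?_
    rintro _ ⟨n, A, hA, rfl⟩
    exact D.meas_co n hA

variable {D} {μ : Measure D.X} [IsProbabilityMeasure μ]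

lemma law (hμ : ∀ n, μ.map (D.co n) = D.lam n) (n : ℕ) {A : Set H3} (hA : MeasurableSet A) :
    μ.real (D.co n ⁻¹' A) = (D.lam n).real A := by
  rw [← hμ n, map_measureReal_apply (D.meas_co n) hA]

lemma approx_cyl {E : Set D.X} (hE : MeasurableSet E) {δ : ℝ} (hδ : 0 < δ) :
    ∃ n A, MeasurableSet A ∧ μ.real (symmDiff E (D.co n ⁻¹' A)) < δ := by
  obtain ⟨t, ⟨n, A, hA, rfl⟩, h2⟩ := (Measure.MeasureDense.of_generateFrom_isSetAlgebra_finite μ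
    D.cyl_alg D.cyl_gen).approx E hE (measure_ne_top _ _) δ hδ
  exact ⟨n, A, hA, (ENNReal.lt_ofReal_iff_toReal_lt (measure_ne_top _ _)).1 h2⟩

/-- approximation by a member of the countable family -/
lemma approx_fam (hμ : ∀ n, μ.map (D.co n) = D.lam n) {E : Set D.X} (hE : MeasurableSet E) {δ : ℝ} (hδ : 0 < δ) :
    ∃ m i, μ.real (symmDiff E (D.co m ⁻¹' D.Q i)) < δ := by
  obtain ⟨n, A, hA, h1⟩ := approx_cyl (μ := μ) hE (half_pos hδ)
  obtain ⟨t, ⟨i, rfl⟩, h2⟩ := (Measure.MeasureDense.of_generateFrom_isSetAlgebra_finite (D.lam n)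
    D.Q_alg D.Q_gen).approx A hA (measure_ne_top _ _) (δ/2) (half_pos hδ)
  refine ⟨n, i, ?_⟩
  have hQm : MeasurableSet (D.Q i) := by
    have := MeasurableSpace.measurableSet_generateFrom (mem_range_self (f := D.Q) i)
    rw [← D.Q_gen] at this; exact this
  have h3 : μ.real (symmDiff (D.co n ⁻¹' A) (D.co n ⁻¹' D.Q i)) < δ/2 := by
    have : symmDiff (D.co n ⁻¹' A) (D.co n ⁻¹' D.Q i) = D.co n ⁻¹' (symmDiff A (D.Q i)) := rfl
    rw [this, law hμ n (hA.symmDiff hQm)]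
    exact (ENNReal.lt_ofReal_iff_toReal_lt (measure_ne_top _ _)).1 h2
  have h4 := measureReal_symmDiff_le (μ := μ) (s := E) (t := D.co n ⁻¹' A) (D.co n ⁻¹' D.Q i)
  linarith

lemma T_le (hμ : ∀ n, μ.map (D.co n) = D.lam n) (g : H3) {E : Set D.X} (hE : E ∈ D.cyl) : μ.real (D.T g ⁻¹' E) ≤ μ.real E := by
  obtain ⟨n, A, hA, rfl⟩ := hE
  obtain ⟨k, hk⟩ := exists_bd g
  have key : ∀ m, n ≤ m → μ.real (D.T g ⁻¹' (D.co n ⁻¹' A)) ≤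
      μ.real (D.co n ⁻¹' A) + (D.lam m).real (D.dp k m)ᶜ := by
    intro m hm
    obtain ⟨B, hB, e⟩ := D.cyl_lift hm hA
    rw [e, law hμ m hB]
    set U : Set H3 := D.F m ∩ (fun s => g * s) ⁻¹' (B ∩ D.F m) with hU
    have hUm : MeasurableSet U := (D.meas_F m).inter
      ((mp_left g).measurable (hB.inter (D.meas_F m)))
    have h1 : D.T g ⁻¹' (D.co m ⁻¹' B) ⊆ D.co m ⁻¹' U ∪ D.co m ⁻¹' (D.dp k m)ᶜ := by
      intro x hx
      by_cases hd : D.co m x ∈ D.dp k m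
      · left
        have h2 := D.dp_sub_F (by positivity) m hd
        have h3 : g * D.co m x ∈ D.F m := D.dp_sub_F le_rfl m (D.dp_move le_rfl hk (by rwa [zero_add]))
        have h4 := D.T_co h2 h3
        refine ⟨h2, ?_, h3⟩
        have : D.co m (D.T g x) ∈ B := hx
        rwa [h4] at this
      · right; exact hd
    have h2 : μ.real (D.T g ⁻¹' (D.co m ⁻¹' B)) ≤ (D.lam m).real U + (D.lam m).real (D.dp k m)ᶜ := by
      rw [← law hμ m hUm, ← law hμ m (D.meas_dp k m).compl]
      exact (measureReal_mono h1).trans (measureReal_union_le _ _)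
    refine h2.trans (add_le_add ?_ le_rfl)
    have h3 : (D.lam m).real U ≤ (D.lam m).real (B ∩ D.F m) := by
      rw [D.lam_real m hUm inter_subset_left, D.lam_real m (hB.inter (D.meas_F m)) inter_subset_right]
      refine mul_le_mul_of_nonneg_left ?_ (div_nonneg (D.p_pos m).le (D.v_pos m).le)
      rw [← (mp_left g).measureReal_preimage (hB.inter (D.meas_F m)).nullMeasurableSet]
      refine measureReal_mono inter_subset_right ?_
      rw [(mp_left g).measure_preimage (hB.inter (D.meas_F m)).nullMeasurableSet]
      exact measure_ne_top_of_subset inter_subset_right (D.F_ne_top m)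
    exact h3.trans (measureReal_mono inter_subset_left)
  have := (tendsto_const_nhds (x := μ.real (D.co n ⁻¹' A))).add (D.lam_dp k)
  rw [add_zero] at this
  exact ge_of_tendsto this (eventually_atTop.2 ⟨n, key⟩)

lemma T_mp (hμ : ∀ n, μ.map (D.co n) = D.lam n) (g : H3) : MeasurePreserving (D.T g) μ μ := by
  refine ⟨D.T_meas1 g, ?_⟩
  have : IsProbabilityMeasure (μ.map (D.T g)) :=
    Measure.isProbabilityMeasure_map (D.T_meas1 g).aemeasurable
  refine ext_of_generate_finite D.cyl D.cyl_gen ?_ ?_ (by simp)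
  · intro s hs t ht _
    exact D.cyl_alg.inter_mem hs ht
  · intro E hE
    have hEm : MeasurableSet E := by obtain ⟨n, A, hA, rfl⟩ := hE; exact D.meas_co n hA
    rw [Measure.map_apply (D.T_meas1 g) hEm, ← measureReal_eq_measureReal_iff]
    apply le_antisymm (T_le hμ g hE)
    have h2 := T_le hμ g (D.cyl_alg.compl_mem hE)
    rw [preimage_compl, probReal_compl_eq_one_sub hEm, probReal_compl_eq_one_sub (D.T_meas1 g hEm)] at h2
    linarith

end Dat
end HW

namespace HW
open MeasureTheory Set

lemma compact_closure_Bx (x y z : ℝ) : IsCompact (closure (Bx x y z)) := by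
  have h1 : IsCompact (homeo ⁻¹' (Icc 0 x ×ˢ (Icc 0 y ×ˢ Icc 0 z))) := by
    rw [← homeo.image_symm]
    exact (isCompact_Icc.prod (isCompact_Icc.prod isCompact_Icc)).image homeo.symm.continuous
  refine h1.closure_of_subset ?_
  rintro g ⟨⟨a, b⟩, ⟨c, d⟩, e, f⟩
  exact ⟨⟨a, b.le⟩, ⟨c, d.le⟩, e, f.le⟩

lemma tendsto_C {u : ℕ → ℝ} (hu : Tendsto u atTop atTop) :
    Tendsto (fun n => H3.C (u n)) atTop (cocompact H3) := by
  rw [hasBasis_cocompact.tendsto_right_iff]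
  intro K hK
  obtain ⟨M, hM⟩ := (hK.image continuous_c).bddAbove
  filter_upwards [hu.eventually_gt_atTop M] with n hn h
  exact absurd (hM ⟨_, h, rfl⟩) (not_le.2 hn)

namespace Dat
variable (D : Dat)

lemma F_diff_lt {g : H3} {k : ℕ} (hk : bd k g) (n : ℕ) :
    H3.haar ((g * ·) '' D.F n \ D.F n) ≤ H3.haar (D.F n \ D.dp k n) := by
  have : (g * ·) '' D.F n \ D.F n ⊆ (g * ·) '' (D.F n \ D.dp k n) := by
    rintro _ ⟨⟨s, hs, rfl⟩, h2⟩
    refine ⟨s, ⟨hs, fun h => h2 ?_⟩, rfl⟩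
    exact D.dp_sub_F le_rfl n (D.dp_move le_rfl hk (by rwa [zero_add]))
  exact (measure_mono this).trans_eq (haar_lt _ _)

lemma F_diff_gt {g : H3} {k : ℕ} (hk : bd k g⁻¹) (n : ℕ) :
    H3.haar (D.F n \ (g * ·) '' D.F n) ≤ H3.haar (D.F n \ D.dp k n) := by
  refine measure_mono ?_
  rintro s ⟨hs, h2⟩
  refine ⟨hs, fun h => h2 ⟨g⁻¹ * s, ?_, by simp⟩⟩
  exact D.dp_sub_F le_rfl n (D.dp_move le_rfl hk (by rwa [zero_add]))

lemma folner : IsFolnerSeq D.F := by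
  refine ⟨fun n => ⟨compact_closure_Bx _ _ _, ?_, (D.F_ne_top n).lt_top⟩, fun g => ?_⟩
  · rw [D.haar_F]; exact ENNReal.ofReal_pos.2 (D.v_pos n)
  · obtain ⟨k, hk⟩ := exists_bd g
    obtain ⟨j, hj⟩ := exists_bd g⁻¹
    have h1 : Tendsto (fun n => ENNReal.ofReal (H3.haar.real (D.F n \ D.dp k n) / D.v n) +
        ENNReal.ofReal (H3.haar.real (D.F n \ D.dp j n) / D.v n)) atTop (𝓝 0) := by
      have := (ENNReal.tendsto_ofReal (D.F_diff_dp_tendsto k)).add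
        (ENNReal.tendsto_ofReal (D.F_diff_dp_tendsto j))
      simpa using this
    refine tendsto_of_tendsto_of_tendsto_of_le_of_le tendsto_const_nhds h1 (fun n => zero_le) ?_
    intro n
    have e : ∀ i : ℕ, ENNReal.ofReal (H3.haar.real (D.F n \ D.dp i n) / D.v n) =
        H3.haar (D.F n \ D.dp i n) / H3.haar (D.F n) := by
      intro i
      rw [ENNReal.ofReal_div_of_pos (D.v_pos n), ← D.haar_F, ofReal_measureReal
        (measure_ne_top_of_subset sdiff_subset (D.F_ne_top n))]
    simp only [e]
    rw [← ENNReal.add_div]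
    refine ENNReal.div_le_div_right ?_ _
    refine (measure_union_le _ _).trans (add_le_add (D.F_diff_lt hk n) (D.F_diff_gt hj n))

variable {D} {μ : Measure D.X} [IsProbabilityMeasure μ]

/-- The system. -/
noncomputable def sys (hμ : ∀ n, μ.map (D.co n) = D.lam n) : H3System where
  X := D.X
  μ := μ
  T := D.T
  t_one := D.T_one
  t_mul := D.T_mul
  t_meas := D.T_meas
  t_mp := T_mp hμ

lemma sys_std (hμ : ∀ n, μ.map (D.co n) = D.lam n) : (sys hμ).IsStdProb := by
  refine ⟨?_, ?_⟩
  · exact D.meas_XS.standardBorel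
  · change IsProbabilityMeasure μ; infer_instance

lemma sys_free (hμ : ∀ n, μ.map (D.co n) = D.lam n) : (sys hμ).Free :=
  Eventually.of_forall fun _ _ h => D.T_free h

lemma sys_tower (hμ : ∀ n, μ.map (D.co n) = D.lam n) (n : ℕ) :
    IsRokhlinTower (sys hμ) (D.co n ⁻¹' D.F n) (D.co n) (D.F n) := by
  refine ⟨D.meas_co n (D.meas_F n), D.meas_co n, fun x hx => hx, ?_⟩
  intro H g _ hHF hgF
  ext y
  constructor
  · rintro ⟨h1, ⟨h', hh, e⟩⟩
    replace e : g * h' = D.co n y := e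
    replace h1 : D.co n y ∈ D.F n := h1
    have e2 : g⁻¹ * D.co n y = h' := by rw [← e]; simp
    have e3 := D.T_co (g := g⁻¹) h1 (by rw [e2]; exact hHF hh)
    rw [e2] at e3
    refine ⟨D.T g⁻¹ y, ⟨?_, ?_⟩, D.T_inv' g y⟩
    · change D.co n (D.T g⁻¹ y) ∈ D.F n; rw [e3]; exact hHF hh
    · change D.co n (D.T g⁻¹ y) ∈ H; rw [e3]; exact hh
  · rintro ⟨x, ⟨h1, h2⟩, rfl⟩
    have h3 : g * D.co n x ∈ D.F n := hgF ⟨_, h2, rfl⟩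
    have e3 := D.T_co h1 h3
    refine ⟨?_, ?_⟩
    · change D.co n (D.T g x) ∈ D.F n; rw [e3]; exact h3
    · change D.co n (D.T g x) ∈ (g * ·) '' H; rw [e3]; exact ⟨_, h2, rfl⟩

lemma rank_aux (hμ : ∀ n, μ.map (D.co n) = D.lam n) {B : Set D.X} (hB : MeasurableSet B) :
    ∃ Hs : ℕ → Set H3, (∀ n, MeasurableSet (Hs n) ∧ Hs n ⊆ D.F n) ∧
      Tendsto (fun n => μ (symmDiff B (D.co n ⁻¹' D.F n ∩ D.co n ⁻¹' Hs n))) atTop (𝓝 0) := by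
  have hch : ∀ n : ℕ, ∃ A : Set H3, MeasurableSet A ∧ ∀ A', MeasurableSet A' →
      μ.real (symmDiff B (D.co n ⁻¹' A)) ≤ μ.real (symmDiff B (D.co n ⁻¹' A')) + 1 / ((n:ℝ)+1) := by
    intro n
    set S : Set ℝ := {t | ∃ A, MeasurableSet A ∧ t = μ.real (symmDiff B (D.co n ⁻¹' A))}
    have hne : S.Nonempty := ⟨_, ∅, MeasurableSet.empty, rfl⟩
    have hbd : BddBelow S := ⟨0, by rintro _ ⟨A, _, rfl⟩; exact measureReal_nonneg⟩
    obtain ⟨_, ⟨A, hA, rfl⟩, h2⟩ := exists_lt_of_csInf_lt hne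
      (lt_add_of_pos_right (sInf S) (by positivity : 0 < 1 / ((n:ℝ)+1)))
    refine ⟨A, hA, fun A' hA' => h2.le.trans ?_⟩
    gcongr
    exact csInf_le hbd ⟨A', hA', rfl⟩
  choose A hA hmin using hch
  refine ⟨fun n => A n ∩ D.F n, fun n => ⟨(hA n).inter (D.meas_F n), inter_subset_right⟩, ?_⟩
  change Tendsto (fun n => μ (symmDiff B (D.co n ⁻¹' D.F n ∩ D.co n ⁻¹' (A n ∩ D.F n)))) atTop (𝓝 0)
  have hle : ∀ n, μ.real (symmDiff B (D.co n ⁻¹' D.F n ∩ D.co n ⁻¹' (A n ∩ D.F n))) ≤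
      μ.real (symmDiff B (D.co n ⁻¹' A n)) + (1 - D.p n) := by
    intro n
    rw [← D.lam_F n, ← law hμ n (D.meas_F n).compl]
    refine le_trans (measureReal_mono ?_) (measureReal_union_le _ _)
    intro x
    simp only [mem_symmDiff, mem_inter_iff, mem_preimage, mem_union, mem_compl_iff]
    tauto
  have hreal : Tendsto (fun n => μ.real (symmDiff B (D.co n ⁻¹' A n)) + (1 - D.p n)) atTop (𝓝 0) := by
    have h1 : Tendsto (fun n => μ.real (symmDiff B (D.co n ⁻¹' A n))) atTop (𝓝 0) := by
      rw [Metric.tendsto_atTop]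
      intro δ hδ
      obtain ⟨n, A', hA', h3⟩ := approx_cyl (μ := μ) hB (half_pos hδ)
      have h4 := (tendsto_order.1 tendsto_one_div_add_atTop_nhds_zero_nat).2 (δ/2) (half_pos hδ)
      obtain ⟨N, hN⟩ := eventually_atTop.1 h4
      refine ⟨max n N, fun m hm => ?_⟩
      obtain ⟨B', hB', e⟩ := D.cyl_lift ((le_max_left n N).trans hm) hA'
      rw [e] at h3
      have h5 := hmin m B' hB'
      have h6 := hN m ((le_max_right n N).trans hm)
      rw [Real.dist_0_eq_abs, abs_of_nonneg measureReal_nonneg]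
      linarith
    have h2 := h1.add ((tendsto_const_nhds (x := (1:ℝ))).sub D.p_tendsto)
    simpa using h2
  have h3 := squeeze_zero (fun n => measureReal_nonneg) hle hreal
  rw [← ENNReal.toReal_zero] at h3
  exact (ENNReal.tendsto_toReal_iff (fun n => measure_ne_top _ _) ENNReal.zero_ne_top).1 h3

lemma sys_rank (hμ : ∀ n, μ.map (D.co n) = D.lam n) : RankOne (sys hμ) :=
  ⟨D.F, D.folner, fun n => D.co n ⁻¹' D.F n, D.co, sys_tower hμ, fun _ hB => rank_aux hμ hB⟩

/-- The displacement set for the rigidity. -/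
lemma rig_small (hμ : ∀ n, μ.map (D.co n) = D.lam n) (n : ℕ) :
    μ.real {x | ¬ D.co n (D.T (H3.C (8 * D.h n : ℕ)) x) = D.co n x} ≤
      (1/2)^(n+2) + (1 - D.p (n+1)) := by
  classical
  set W : Finset H3 := (D.C n).filter fun x => H3.C (8 * D.h n : ℕ) * x ∈ D.C n with hW
  have hWs : (W : Set H3) = {x | x ∈ D.C n ∧ H3.C (8 * D.h n : ℕ) * x ∈ D.C n} := by
    ext x; simp [hW]
  have hm : MeasurableSet (D.F n * (W : Set H3)) := meas_mul_fin (D.meas_F n) W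
  have h6 := (D.step n).s6
  rw [← hWs] at h6
  have h1 : {x | ¬ D.co n (D.T (H3.C (8 * D.h n : ℕ)) x) = D.co n x} ⊆
      D.co (n+1) ⁻¹' (D.F n * (W : Set H3))ᶜ := by
    intro x hx hmem
    apply hx
    obtain ⟨f, hf, c, hc, e⟩ := hmem
    replace e : f * c = D.co (n+1) x := e
    rw [hWs] at hc
    have e1 : H3.C (8 * D.h n : ℕ) * D.co (n+1) x = f * (H3.C (8 * D.h n : ℕ) * c) := by
      rw [← e, ← mul_assoc, C_comm, mul_assoc]
    have h2 : D.co (n+1) x ∈ D.F (n+1) := by rw [← e]; exact D.FC_sub n ⟨f, hf, c, hc.1, rfl⟩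
    have h3 : H3.C (8 * D.h n : ℕ) * D.co (n+1) x ∈ D.F (n+1) := by
      rw [e1]; exact D.FC_sub n ⟨f, hf, _, hc.2, rfl⟩
    rw [← D.co_π n, D.T_co h2 h3, e1, D.π_mul n hf hc.2, ← D.co_π n, ← e, D.π_mul n hf hc.1]
  refine (measureReal_mono h1).trans ?_
  rw [law hμ _ hm.compl]
  refine (D.lam_real_le (n+1) hm.compl).trans ?_
  gcongr
  rw [div_le_iff₀ (D.v_pos _), inter_comm, ← sdiff_eq]
  exact h6

lemma eps_tendsto : Tendsto (fun n => ((1:ℝ)/2)^(n+2) + (1 - D.p (n+1))) atTop (𝓝 0) := by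
  have h1 : Tendsto (fun n : ℕ => ((1:ℝ)/2)^(n+2)) atTop (𝓝 0) :=
    (tendsto_add_atTop_iff_nat 2).2 (tendsto_pow_atTop_nhds_zero_of_lt_one (by norm_num) (by norm_num))
  have h2 := h1.add ((tendsto_const_nhds (x := (1:ℝ))).sub ((tendsto_add_atTop_iff_nat 1).2 D.p_tendsto))
  simpa using h2

lemma rig_tendsto (hμ : ∀ n, μ.map (D.co n) = D.lam n) {A : Set D.X} (hA : MeasurableSet A) :
    Tendsto (fun n => μ.real (symmDiff A (D.T (H3.C (8 * D.h n : ℕ)) ⁻¹' A))) atTop (𝓝 0) := by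
  rw [Metric.tendsto_atTop]
  intro δ hδ
  obtain ⟨m, A', hA', h3⟩ := approx_cyl (μ := μ) hA (by positivity : 0 < δ/4)
  obtain ⟨N, hN⟩ := eventually_atTop.1 ((tendsto_order.1 (eps_tendsto (D := D))).2 (δ/4) (by positivity))
  refine ⟨max m N, fun n hn => ?_⟩
  rw [Real.dist_0_eq_abs, abs_of_nonneg measureReal_nonneg]
  obtain ⟨B, hB, e⟩ := D.cyl_lift ((le_max_left m N).trans hn) hA'
  rw [e] at h3
  set g := H3.C (8 * D.h n : ℕ)
  have h4 := (rig_small hμ n).trans_lt (hN n ((le_max_right m N).trans hn))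
  have h5 : μ.real (D.T g ⁻¹' (symmDiff A (D.co n ⁻¹' B))) < δ/4 := by
    rwa [(T_mp hμ g).measureReal_preimage (hA.symmDiff (D.meas_co n hB)).nullMeasurableSet]
  have h6 : symmDiff A (D.T g ⁻¹' A) ⊆ symmDiff A (D.co n ⁻¹' B) ∪
      D.T g ⁻¹' (symmDiff A (D.co n ⁻¹' B)) ∪ {x | ¬ D.co n (D.T g x) = D.co n x} := by
    intro x hx
    simp only [mem_symmDiff, mem_preimage, mem_union, mem_ofPred_eq] at hx ⊢
    by_cases h : D.co n (D.T g x) = D.co n x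
    · rw [h]; tauto
    · right; exact h
  have h7 := (measureReal_mono (μ := μ) h6).trans ((measureReal_union_le _ _).trans
    (add_le_add (measureReal_union_le _ _) le_rfl))
  linarith

lemma T_image (g : H3) (A : Set D.X) : D.T g '' A = D.T g⁻¹ ⁻¹' A := by
  ext x; constructor
  · rintro ⟨y, hy, rfl⟩; rw [mem_preimage, D.T_inv]; exact hy
  · intro hx; exact ⟨_, hx, D.T_inv' g x⟩

lemma h_tendsto : Tendsto (fun n => ((D.h n : ℕ) : ℝ)) atTop atTop :=
  tendsto_natCast_atTop_atTop.comp (tendsto_atTop_mono D.h_ge tendsto_id)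

lemma rigid_aux (hμ : ∀ n, μ.map (D.co n) = D.lam n) {A B : Set D.X} (hA : MeasurableSet A) :
    Tendsto (fun n => μ (D.T (H3.C (8 * D.h n : ℕ)) '' A ∩ B)) atTop (𝓝 (μ (A ∩ B))) := by
  rw [← ENNReal.tendsto_toReal_iff (fun n => measure_ne_top _ _) (measure_ne_top _ _)]
  change Tendsto (fun n => μ.real (D.T (H3.C (8 * D.h n : ℕ)) '' A ∩ B)) atTop (𝓝 (μ.real (A ∩ B)))
  rw [tendsto_iff_dist_tendsto_zero]
  refine squeeze_zero (fun n => dist_nonneg) (fun n => ?_) (rig_tendsto hμ hA)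
  set g := H3.C (8 * D.h n : ℕ)
  have hgA : MeasurableSet (D.T g '' A) := by rw [T_image]; exact D.T_meas1 _ hA
  rw [Real.dist_eq]
  have h1 : symmDiff A (D.T g ⁻¹' A) = D.T g ⁻¹' (symmDiff (D.T g '' A) A) := by
    ext x
    simp only [mem_symmDiff, mem_preimage, T_image, D.T_inv]
  rw [h1, (T_mp hμ g).measureReal_preimage (hgA.symmDiff hA).nullMeasurableSet]
  have h2 : μ.real (D.T g '' A ∩ B) ≤ μ.real (A ∩ B) + μ.real (symmDiff (D.T g '' A) A) := by
    refine (measureReal_mono ?_).trans (measureReal_union_le _ _)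
    intro x; simp only [mem_symmDiff, mem_inter_iff, mem_union]; tauto
  have h3 : μ.real (A ∩ B) ≤ μ.real (D.T g '' A ∩ B) + μ.real (symmDiff (D.T g '' A) A) := by
    refine (measureReal_mono ?_).trans (measureReal_union_le _ _)
    intro x; simp only [mem_symmDiff, mem_inter_iff, mem_union]; tauto
  rw [abs_le]; constructor <;> linarith

lemma sys_rigid (hμ : ∀ n, μ.map (D.co n) = D.lam n) : (sys hμ).Rigid := by
  refine ⟨fun n => H3.C (8 * D.h n : ℕ), tendsto_C ?_, fun A B hA hB => rigid_aux hμ hA⟩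
  push_cast
  exact (h_tendsto (D := D)).const_mul_atTop (by norm_num)

end Dat
end HW

namespace HW
open MeasureTheory Set

lemma ext_half {Y : Type*} [MeasurableSpace Y] {m : Measure Y} [IsProbabilityMeasure m]
    {ν : ℕ → Measure Y} (hν : ∀ n, ν n ≤ m) {κ : ℝ} {s : Set (Set Y)}
    (hgen : (inferInstance : MeasurableSpace Y) = MeasurableSpace.generateFrom s)
    (hpi : IsPiSystem s) (huniv : Tendsto (fun n => (ν n).real univ) atTop (𝓝 κ))
    (h : ∀ B ∈ s, Tendsto (fun n => (ν n).real B) atTop (𝓝 (κ * m.real B)))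
    {B : Set Y} (hB : MeasurableSet B) :
    Tendsto (fun n => (ν n).real B) atTop (𝓝 (κ * m.real B)) := by
  have hf : ∀ n, IsFiniteMeasure (ν n) := fun n => isFiniteMeasure_of_le m (hν n)
  have hle : ∀ n B, (ν n).real B ≤ m.real B := fun n B =>
    ENNReal.toReal_mono (measure_ne_top _ _) (hν n B)
  induction B, hB using MeasurableSpace.induction_on_inter hgen hpi with
  | empty => simp
  | basic t ht => exact h t ht
  | compl t ht ih =>
    have e : ∀ n, (ν n).real tᶜ = (ν n).real univ - (ν n).real t := fun n => measureReal_compl ht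
    simp only [e, probReal_compl_eq_one_sub ht, mul_sub, mul_one]
    exact huniv.sub ih
  | iUnion f hd hm ih =>
    have e : ∀ n, (ν n).real (⋃ i, f i) = ∑' i, (ν n).real (f i) := fun n => by
      simp only [measureReal_def]
      rw [measure_iUnion hd hm, ENNReal.tsum_toReal_eq fun i => measure_ne_top _ _]
    have em : m.real (⋃ i, f i) = ∑' i, m.real (f i) := by
      simp only [measureReal_def]
      rw [measure_iUnion hd hm, ENNReal.tsum_toReal_eq fun i => measure_ne_top _ _]
    have hsum : Summable fun i => m.real (f i) :=
      ENNReal.summable_toReal (by rw [← measure_iUnion hd hm]; exact measure_ne_top _ _)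
    simp only [e, em, ← tsum_mul_left]
    refine tendsto_tsum_of_dominated_convergence hsum ih (Eventually.of_forall fun n i => ?_)
    rw [Real.norm_of_nonneg measureReal_nonneg]
    exact hle n _

lemma mix_ext {Y : Type*} [MeasurableSpace Y] {m : Measure Y} [IsProbabilityMeasure m]
    {S : ℕ → Y → Y} (hS : ∀ n, MeasurePreserving (S n) m m) {s : Set (Set Y)}
    (hgen : (inferInstance : MeasurableSpace Y) = MeasurableSpace.generateFrom s)
    (hpi : IsPiSystem s)
    (h : ∀ A ∈ s, ∀ B ∈ s, Tendsto (fun n => m.real (A ∩ S n ⁻¹' B)) atTop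
      (𝓝 (m.real A * m.real B)))
    {A B : Set Y} (hA : MeasurableSet A) (hB : MeasurableSet B) :
    Tendsto (fun n => m.real (A ∩ S n ⁻¹' B)) atTop (𝓝 (m.real A * m.real B)) := by
  have hs : ∀ A ∈ s, MeasurableSet A := fun A hA => by
    have := MeasurableSpace.measurableSet_generateFrom hA
    rw [← hgen] at this; exact this
  have e1 : ∀ {A B : Set Y}, MeasurableSet B → ∀ n,
      ((m.restrict A).map (S n)).real B = m.real (A ∩ S n ⁻¹' B) := by
    intro A B hB n
    rw [map_measureReal_apply (hS n).measurable hB,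
      measureReal_restrict_apply ((hS n).measurable hB), inter_comm]
  have e2 : ∀ {A B : Set Y}, MeasurableSet A → ∀ n,
      (m.restrict (S n ⁻¹' B)).real A = m.real (A ∩ S n ⁻¹' B) := by
    intro A B hA n
    rw [measureReal_restrict_apply hA]
  have step1 : ∀ A ∈ s, ∀ B, MeasurableSet B →
      Tendsto (fun n => m.real (A ∩ S n ⁻¹' B)) atTop (𝓝 (m.real A * m.real B)) := by
    intro A hA B hB
    have := ext_half (m := m) (ν := fun n => (m.restrict A).map (S n)) (κ := m.real A) (fun n => ?_)
      hgen hpi ?_ ?_ hB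
    · simpa only [e1 hB] using this
    · exact (Measure.map_mono Measure.restrict_le_self (hS n).measurable).trans_eq (hS n).map_eq
    · simp only [e1 MeasurableSet.univ]; simp
    · intro B hB
      simpa only [e1 (hs B hB)] using h A hA B hB
  have := ext_half (m := m) (ν := fun n => m.restrict (S n ⁻¹' B)) (κ := m.real B) (fun n => ?_)
      hgen hpi ?_ ?_ hA
  · simpa only [e2 hA, mul_comm (m.real B)] using this
  · exact Measure.restrict_le_self
  · simp only [e2 MeasurableSet.univ, univ_inter, (hS _).measureReal_preimage hB.nullMeasurableSet]
    exact tendsto_const_nhds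
  · intro A hA
    simpa only [e2 (hs A hA), mul_comm (m.real B)] using step1 A hA B hB

namespace Dat
variable {D : Dat}

lemma fam_co {m n k : ℕ} (hk : (Nat.unpair k).1 = m) (hn : m ≤ n) :
    D.co n ⁻¹' D.fam n k = D.co m ⁻¹' D.Q (Nat.unpair k).2 := by
  induction n, hn using Nat.le_induction with
  | base => rw [← D.fam_same k, hk]
  | succ n hn ih =>
    rw [← ih, D.fam_succ n k (by omega)]
    ext x
    change D.π n (D.co (n+1) x) ∈ D.fam n k ↔ _
    rw [D.co_π]; rfl

lemma mem_lift {n : ℕ} {x : D.X} {A : Set H3} (h : D.co n x ∈ A) (h2 : D.co n x ∈ D.F n) :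
    D.co (n+1) x ∈ (A ∩ D.F n) * (D.C n : Set H3) := by
  obtain ⟨c, hc, e⟩ := D.co_succ h2
  rw [e]; exact ⟨_, ⟨h, h2⟩, c, hc, rfl⟩

lemma mem_lift' {n : ℕ} {x : D.X} {g : H3} {A : Set H3} (h : D.co n (D.T g x) ∈ A)
    (h2 : D.co n (D.T g x) ∈ D.F n) (h3 : D.co (n+1) x ∈ D.F (n+1)) :
    g * D.co (n+1) x ∈ (A ∩ D.F n) * (D.C n : Set H3) ∨ g * D.co (n+1) x ∉ D.F (n+1) := by
  by_cases h4 : g * D.co (n+1) x ∈ D.F (n+1)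
  · left
    rw [← D.T_co h3 h4]
    exact mem_lift h h2
  · right; exact h4

variable {μ : Measure D.X} [IsProbabilityMeasure μ]

lemma approx_famn (hμ : ∀ n, μ.map (D.co n) = D.lam n) {E : Set D.X} (hE : MeasurableSet E)
    {δ : ℝ} (hδ : 0 < δ) :
    ∃ k m, ∀ n, m ≤ n → μ.real (symmDiff E (D.co n ⁻¹' D.fam n k)) < δ := by
  obtain ⟨m, i, h⟩ := approx_fam hμ hE hδ
  refine ⟨Nat.pair m i, m, fun n hn => ?_⟩
  rw [fam_co (by simp) hn]
  simpa using h

lemma ratio_le (hμ : ∀ n, μ.map (D.co n) = D.lam n) (n : ℕ) {A : Set H3} (hA : MeasurableSet A) :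
    H3.haar.real (A ∩ D.F n) / D.v n ≤ μ.real (D.co n ⁻¹' A) / D.p n := by
  have hp := D.p_pos n
  rw [law hμ n hA, le_div_iff₀ hp]
  have h1 := D.lam_real n (hA.inter (D.meas_F n)) inter_subset_right
  have h2 : (D.lam n).real (A ∩ D.F n) ≤ (D.lam n).real A := measureReal_mono inter_subset_left
  rw [h1] at h2
  calc _ = _ := by ring
    _ ≤ _ := h2

/-- error term -/
noncomputable def err (D : Dat) (n : ℕ) : ℝ :=
  (1 / (D.p n * D.p n) - 1) + ((1/2)^(n+2) + (1 - D.p (n+1))) + 3 * (1 - D.p n)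

lemma err_tendsto : Tendsto (err D) atTop (𝓝 0) := by
  have h1 : Tendsto (fun n => 1 / (D.p n * D.p n) - 1) atTop (𝓝 (1 / (1 * 1) - 1)) :=
    (tendsto_const_nhds.div (D.p_tendsto.mul D.p_tendsto) (by norm_num)).sub tendsto_const_nhds
  have h2 := (h1.add (eps_tendsto (D := D))).add
    (((tendsto_const_nhds (x := (1:ℝ))).sub D.p_tendsto).const_mul 3)
  have e : (1 / (1 * 1) - 1 + 0 + 3 * (1 - 1) : ℝ) = 0 := by norm_num
  rw [e] at h2
  exact h2

lemma out_F (hμ : ∀ n, μ.map (D.co n) = D.lam n) (n : ℕ) (g : H3) :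
    μ.real {x | D.co n (D.T g x) ∉ D.F n} = 1 - D.p n := by
  have : {x | D.co n (D.T g x) ∉ D.F n} = D.T g ⁻¹' (D.co n ⁻¹' (D.F n)ᶜ) := rfl
  rw [this, (T_mp hμ g).measureReal_preimage (D.meas_co n (D.meas_F n).compl).nullMeasurableSet,
    law hμ n (D.meas_F n).compl, D.lam_F]

lemma gen_bound (hμ : ∀ n, μ.map (D.co n) = D.lam n) (n : ℕ) {A B : Set H3}
    (hA : MeasurableSet A) (hB : MeasurableSet B) {Z : Set H3} (hZm : MeasurableSet Z)
    (hZF : Z ⊆ D.F (n+1))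
    (hZ : H3.haar.real Z ≤ (H3.haar.real (A ∩ D.F n) / D.v n * (H3.haar.real (B ∩ D.F n) / D.v n) +
      (1/2)^(n+2)) * D.v (n+1)) {g g' : H3} {U : Set D.X}
    (hU : ∀ x ∈ U, D.co n x ∈ D.F n → D.co n (D.T g x) ∈ D.F n → D.co n (D.T g' x) ∈ D.F n →
      D.co (n+1) x ∈ D.F (n+1) → D.co (n+1) x ∈ Z) :
    μ.real U ≤ μ.real (D.co n ⁻¹' A) * μ.real (D.co n ⁻¹' B) + err D n := by
  have h0 : D.co n ⁻¹' (D.F n)ᶜ = {x | D.co n (D.T 1 x) ∉ D.F n} := by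
    ext x
    simp only [D.T_one]; rfl
  have hsub : U ⊆ D.co (n+1) ⁻¹' (Z ∪ (D.F (n+1))ᶜ) ∪ {x | D.co n (D.T 1 x) ∉ D.F n} ∪
      {x | D.co n (D.T g x) ∉ D.F n} ∪ {x | D.co n (D.T g' x) ∉ D.F n} := by
    intro x hx
    by_contra hc
    rw [← h0] at hc
    simp only [mem_union, mem_ofPred_eq, mem_preimage, mem_compl_iff, not_or, not_not] at hc
    exact hc.1.1.1.1 (hU x hx hc.1.1.2 hc.1.2 hc.2 hc.1.1.1.2)
  have h1 := (measureReal_mono (μ := μ) hsub).trans ((measureReal_union_le _ _).trans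
    (add_le_add ((measureReal_union_le _ _).trans (add_le_add (measureReal_union_le _ _) le_rfl))
      le_rfl))
  rw [out_F hμ, out_F hμ, out_F hμ, law hμ _ (hZm.union (D.meas_F _).compl)] at h1
  have h2 := D.lam_real_le (n+1) (hZm.union (D.meas_F (n+1)).compl)
  have e : (Z ∪ (D.F (n+1))ᶜ) ∩ D.F (n+1) = Z := by
    ext x; constructor
    · rintro ⟨h | h, h'⟩
      · exact h
      · exact absurd h' h
    · intro h; exact ⟨Or.inl h, hZF h⟩
  rw [e] at h2
  have h3 : H3.haar.real Z / D.v (n+1) ≤ H3.haar.real (A ∩ D.F n) / D.v n *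
      (H3.haar.real (B ∩ D.F n) / D.v n) + (1/2)^(n+2) := by
    rwa [div_le_iff₀ (D.v_pos _)]
  set P := μ.real (D.co n ⁻¹' A)
  set P' := μ.real (D.co n ⁻¹' B)
  have hp := D.p_pos n
  have h4 : H3.haar.real (A ∩ D.F n) / D.v n * (H3.haar.real (B ∩ D.F n) / D.v n) ≤
      (P / D.p n) * (P' / D.p n) :=
    mul_le_mul (ratio_le hμ n hA) (ratio_le hμ n hB)
      (div_nonneg measureReal_nonneg (D.v_pos n).le) (div_nonneg measureReal_nonneg hp.le)
  have h5 : (P / D.p n) * (P' / D.p n) ≤ P * P' + (1 / (D.p n * D.p n) - 1) := by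
    have hPP : P * P' ≤ 1 := mul_le_one₀ measureReal_le_one measureReal_nonneg measureReal_le_one
    have hu : 1 ≤ 1 / (D.p n * D.p n) := by
      rw [le_div_iff₀ (by positivity), one_mul]
      exact mul_le_one₀ (D.p_le n) hp.le (D.p_le n)
    have e : (P / D.p n) * (P' / D.p n) = P * P' * (1 / (D.p n * D.p n)) := by
      field_simp
    rw [e]
    nlinarith
  unfold err
  linarith

lemma mix5 (hμ : ∀ n, μ.map (D.co n) = D.lam n) {n i j : ℕ} (hi : i < n) (hj : j < n) :
    μ.real (D.co n ⁻¹' D.fam n i ∩ D.T (H3.C (4 * D.h n : ℕ)) ⁻¹' (D.co n ⁻¹' D.fam n j)) ≤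
      μ.real (D.co n ⁻¹' D.fam n i) * μ.real (D.co n ⁻¹' D.fam n j) + err D n := by
  have mm : ∀ k, MeasurableSet ((D.fam n k ∩ D.F n) * (D.C n : Set H3)) := fun k =>
    meas_mul_fin ((D.fam_meas n k).inter (D.meas_F n)) _
  refine gen_bound hμ n (D.fam_meas n i) (D.fam_meas n j) ?_ ?_ ((D.step n).s5 i hi j hj)
    (g := H3.C (4 * D.h n : ℕ)) (g' := 1) ?_
  · have hL := (mp_left (H3.C (4 * D.h n : ℕ))).measurable
    exact (D.meas_F (n+1)).inter ((mm i).inter ((hL (mm j)).union (hL (D.meas_F (n+1)).compl)))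
  · exact fun x hx => hx.1
  · rintro x ⟨hx1, hx2⟩ h1 h2 _ h4
    exact ⟨h4, mem_lift hx1 h1, mem_lift' hx2 h2 h4⟩

lemma mix8 (hμ : ∀ n, μ.map (D.co n) = D.lam n) {n i : ℕ} (hi : i < n) :
    μ.real (D.co n ⁻¹' D.fam n i ∩ (D.T (H3.C (2 * D.h n : ℕ)) ⁻¹' (D.co n ⁻¹' D.fam n i) ∩
      D.T (H3.C (3 * D.h n : ℕ)) ⁻¹' (D.co n ⁻¹' D.fam n i))) ≤
      μ.real (D.co n ⁻¹' D.fam n i) * μ.real (D.co n ⁻¹' D.fam n i) + err D n := by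
  have mm : ∀ k, MeasurableSet ((D.fam n k ∩ D.F n) * (D.C n : Set H3)) := fun k =>
    meas_mul_fin ((D.fam_meas n k).inter (D.meas_F n)) _
  refine gen_bound hμ n (D.fam_meas n i) (D.fam_meas n i) ?_ ?_ ((D.step n).s8 i hi)
    (g := H3.C (2 * D.h n : ℕ)) (g' := H3.C (3 * D.h n : ℕ)) ?_
  · have hL := (mp_left (H3.C (2 * D.h n : ℕ))).measurable
    have hL' := (mp_left (H3.C (3 * D.h n : ℕ))).measurable
    exact (D.meas_F (n+1)).inter ((mm i).inter (((hL (mm i)).union (hL (D.meas_F (n+1)).compl)).inter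
      ((hL' (mm i)).union (hL' (D.meas_F (n+1)).compl))))
  · exact fun x hx => hx.1
  · rintro x ⟨hx1, hx2, hx3⟩ h1 h2 h3 h4
    exact ⟨h4, mem_lift hx1 h1, mem_lift' hx2 h2 h4, mem_lift' hx3 h3 h4⟩

lemma sd1 {A B : Set D.X} {δ : ℝ} (h : μ.real (symmDiff A B) < δ) :
    μ.real B ≤ μ.real A + δ := by
  have h1 : μ.real B ≤ μ.real A + μ.real (symmDiff A B) := by
    refine (measureReal_mono ?_).trans (measureReal_union_le _ _)
    intro x; simp only [mem_symmDiff, mem_union]; tauto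
  linarith

lemma sdT (hμ : ∀ n, μ.map (D.co n) = D.lam n) {A B : Set D.X} (hA : MeasurableSet A)
    (hB : MeasurableSet B) (g : H3) :
    μ.real (D.T g ⁻¹' symmDiff A B) = μ.real (symmDiff A B) :=
  (T_mp hμ g).measureReal_preimage (hA.symmDiff hB).nullMeasurableSet

lemma mix5_limsup (hμ : ∀ n, μ.map (D.co n) = D.lam n) {E E' : Set D.X} (hE : MeasurableSet E)
    (hE' : MeasurableSet E') {δ : ℝ} (hδ : 0 < δ) : ∀ᶠ n in atTop,
    μ.real (E ∩ D.T (H3.C (4 * D.h n : ℕ)) ⁻¹' E') < μ.real E * μ.real E' + δ := by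
  set d := min 1 (δ/8)
  have hd : 0 < d := lt_min one_pos (by positivity)
  have hd1 : d ≤ 1 := min_le_left _ _
  have hd2 : d ≤ δ/8 := min_le_right _ _
  obtain ⟨i, m, h1⟩ := approx_famn hμ hE hd
  obtain ⟨j, m', h2⟩ := approx_famn hμ hE' hd
  filter_upwards [eventually_ge_atTop m, eventually_ge_atTop m', eventually_gt_atTop i,
    eventually_gt_atTop j, (tendsto_order.1 (err_tendsto (D := D))).2 d hd] with n a1 a2 a3 a4 a5
  have b1 := h1 n a1
  have b2 := h2 n a2
  have b3 := mix5 hμ a3 a4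
  set g := H3.C (4 * D.h n : ℕ)
  set A := D.co n ⁻¹' D.fam n i
  set B := D.co n ⁻¹' D.fam n j
  have hA : MeasurableSet A := D.meas_co n (D.fam_meas n i)
  have hB : MeasurableSet B := D.meas_co n (D.fam_meas n j)
  have c1 : E ∩ D.T g ⁻¹' E' ⊆ (A ∩ D.T g ⁻¹' B) ∪ symmDiff E A ∪ D.T g ⁻¹' symmDiff E' B := by
    intro x; simp only [mem_symmDiff, mem_inter_iff, mem_union, mem_preimage]; tauto
  have c2 := (measureReal_mono (μ := μ) c1).trans ((measureReal_union_le _ _).trans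
    (add_le_add (measureReal_union_le _ _) le_rfl))
  rw [sdT hμ hE' hB] at c2
  have c3 := sd1 b1
  have c4 := sd1 b2
  have c5 : μ.real A * μ.real B ≤ (μ.real E + d) * (μ.real E' + d) :=
    mul_le_mul c3 c4 measureReal_nonneg (add_nonneg measureReal_nonneg hd.le)
  have e1 : μ.real E ≤ 1 := measureReal_le_one
  have e2 : μ.real E' ≤ 1 := measureReal_le_one
  nlinarith

lemma mix8_limsup (hμ : ∀ n, μ.map (D.co n) = D.lam n) {E : Set D.X} (hE : MeasurableSet E)
    {δ : ℝ} (hδ : 0 < δ) : ∀ᶠ n in atTop,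
    μ.real (E ∩ (D.T (H3.C (2 * D.h n : ℕ)) ⁻¹' E ∩ D.T (H3.C (3 * D.h n : ℕ)) ⁻¹' E)) <
      μ.real E * μ.real E + δ := by
  set d := min 1 (δ/8)
  have hd : 0 < d := lt_min one_pos (by positivity)
  have hd1 : d ≤ 1 := min_le_left _ _
  have hd2 : d ≤ δ/8 := min_le_right _ _
  obtain ⟨i, m, h1⟩ := approx_famn hμ hE hd
  filter_upwards [eventually_ge_atTop m, eventually_gt_atTop i,
    (tendsto_order.1 (err_tendsto (D := D))).2 d hd] with n a1 a3 a5
  have b1 := h1 n a1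
  have b3 := mix8 hμ a3
  set g := H3.C (2 * D.h n : ℕ)
  set g' := H3.C (3 * D.h n : ℕ)
  set A := D.co n ⁻¹' D.fam n i
  have hA : MeasurableSet A := D.meas_co n (D.fam_meas n i)
  have c1 : E ∩ (D.T g ⁻¹' E ∩ D.T g' ⁻¹' E) ⊆ (A ∩ (D.T g ⁻¹' A ∩ D.T g' ⁻¹' A)) ∪
      symmDiff E A ∪ D.T g ⁻¹' symmDiff E A ∪ D.T g' ⁻¹' symmDiff E A := by
    intro x; simp only [mem_symmDiff, mem_inter_iff, mem_union, mem_preimage]; tauto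
  have c2 := (measureReal_mono (μ := μ) c1).trans ((measureReal_union_le _ _).trans
    (add_le_add ((measureReal_union_le _ _).trans
    (add_le_add (measureReal_union_le _ _) le_rfl)) le_rfl))
  rw [sdT hμ hE hA, sdT hμ hE hA] at c2
  have c3 := sd1 b1
  have c5 : μ.real A * μ.real A ≤ (μ.real E + d) * (μ.real E + d) :=
    mul_le_mul c3 c3 measureReal_nonneg (add_nonneg measureReal_nonneg hd.le)
  have e1 : μ.real E ≤ 1 := measureReal_le_one
  nlinarith

lemma mixing (hμ : ∀ n, μ.map (D.co n) = D.lam n) {E E' : Set D.X} (hE : MeasurableSet E)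
    (hE' : MeasurableSet E') : Tendsto (fun n => μ.real (E ∩ D.T (H3.C (4 * D.h n : ℕ)) ⁻¹' E'))
      atTop (𝓝 (μ.real E * μ.real E')) := by
  rw [tendsto_order]
  constructor
  · intro a ha
    filter_upwards [mix5_limsup hμ hE hE'.compl (sub_pos.2 ha)] with n hn
    have h1 : μ.real (E ∩ D.T (H3.C (4 * D.h n : ℕ)) ⁻¹' E') +
        μ.real (E \ D.T (H3.C (4 * D.h n : ℕ)) ⁻¹' E') = μ.real E :=
      measureReal_inter_add_sdiff (D.T_meas1 _ hE')
    rw [preimage_compl, ← sdiff_eq, probReal_compl_eq_one_sub hE'] at hn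
    linarith
  · intro a ha
    filter_upwards [mix5_limsup hμ hE hE' (sub_pos.2 ha)] with n hn
    linarith

lemma C_nat (k : ℕ) (x : D.X) : D.T (H3.C (k : ℕ)) x = (D.T (H3.C 1))^[k] x := by
  induction k with
  | zero =>
    have : H3.C ((0 : ℕ) : ℝ) = 1 := by ext <;> simp [H3.C]
    rw [this, D.T_one]; rfl
  | succ k ih =>
    have : H3.C ((k + 1 : ℕ) : ℝ) = H3.C 1 * H3.C (k : ℕ) := by
      ext <;> simp [H3.C]; ring
    rw [this, D.T_mul, ih, Function.iterate_succ_apply']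

lemma zero_one {Y : Type*} [MeasurableSpace Y] {m : Measure Y} [IsProbabilityMeasure m] {A : Set Y}
    (hA : MeasurableSet A) (h : m.real A = m.real A * m.real A) : m A = 0 ∨ m Aᶜ = 0 := by
  have h2 : m.real A * (1 - m.real A) = 0 := by linarith
  rcases mul_eq_zero.1 h2 with h3 | h3
  · left; exact (measureReal_eq_zero_iff).1 h3
  · right
    rw [← probReal_compl_eq_one_sub hA] at h3
    exact (measureReal_eq_zero_iff).1 h3

lemma ergodic (hμ : ∀ n, μ.map (D.co n) = D.lam n) {A : Set D.X} (hA : MeasurableSet A)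
    (h : D.T (H3.C 1) ⁻¹' A = A) : μ A = 0 ∨ μ Aᶜ = 0 := by
  have h1 : ∀ k : ℕ, D.T (H3.C (k : ℕ)) ⁻¹' A = A := by
    intro k
    have : D.T (H3.C (k : ℕ)) = (D.T (H3.C 1))^[k] := funext (C_nat k)
    rw [this]
    induction k with
    | zero => rfl
    | succ k ih => rw [Function.iterate_succ, preimage_comp, ih (funext (C_nat k)), h]
  have h2 := mixing hμ hA hA
  simp only [h1, inter_self] at h2
  exact zero_one hA (tendsto_nhds_unique tendsto_const_nhds h2)

lemma wmix (hμ : ∀ n, μ.map (D.co n) = D.lam n) {A : Set (D.X × D.X)} (hA : MeasurableSet A)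
    (h : ∀ g : H3, (fun p : D.X × D.X => (D.T g p.1, D.T g p.2)) ⁻¹' A = A) :
    (μ.prod μ) A = 0 ∨ (μ.prod μ) Aᶜ = 0 := by
  have h2 := mix_ext (m := μ.prod μ)
    (S := fun n => Prod.map (D.T (H3.C (4 * D.h n : ℕ))) (D.T (H3.C (4 * D.h n : ℕ))))
    (fun n => (T_mp hμ _).prod (T_mp hμ _)) generateFrom_prod.symm isPiSystem_prod ?_ hA hA
  · have h3 : ∀ n, Prod.map (D.T (H3.C (4 * D.h n : ℕ))) (D.T (H3.C (4 * D.h n : ℕ))) ⁻¹' A = A :=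
      fun n => h _
    simp only [h3, inter_self] at h2
    exact zero_one hA (tendsto_nhds_unique tendsto_const_nhds h2)
  · rintro _ ⟨A, hA, A', hA', rfl⟩ _ ⟨B, hB, B', hB', rfl⟩
    have e : ∀ n, (μ.prod μ).real (A ×ˢ A' ∩ Prod.map (D.T (H3.C (4 * D.h n : ℕ)))
        (D.T (H3.C (4 * D.h n : ℕ))) ⁻¹' (B ×ˢ B')) =
        μ.real (A ∩ D.T (H3.C (4 * D.h n : ℕ)) ⁻¹' B) *
        μ.real (A' ∩ D.T (H3.C (4 * D.h n : ℕ)) ⁻¹' B') := by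
      intro n
      rw [← measureReal_prod_prod]
      congr 1
      ext p
      simp only [mem_inter_iff, mem_prod, mem_preimage, Prod.map]
      tauto
    simp only [e, measureReal_prod_prod]
    have := (mixing hμ hA hB).mul (mixing hμ hA' hB')
    convert this using 2
    ring

end Dat
end HW

namespace HW
open MeasureTheory Set
namespace Dat
variable {D : Dat} {μ : Measure D.X} [IsProbabilityMeasure μ]

lemma same_co {n : ℕ} {g f c : H3} {t : ℝ} (hg : g = H3.C t) {x : D.X} (hf : f ∈ D.F n)
    (hc : c ∈ D.C n) (hgc : g * c ∈ D.C n) (e : f * c = D.co (n+1) x) :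
    D.co n x = f ∧ D.co n (D.T g x) = f := by
  have e1 : g * D.co (n+1) x = f * (g * c) := by
    rw [← e, hg, ← mul_assoc, C_comm, mul_assoc]
  have h2 : D.co (n+1) x ∈ D.F (n+1) := by rw [← e]; exact D.FC_sub n ⟨f, hf, c, hc, rfl⟩
  have h3 : g * D.co (n+1) x ∈ D.F (n+1) := by
    rw [e1]; exact D.FC_sub n ⟨f, hf, _, hgc, rfl⟩
  constructor
  · rw [← D.co_π n, ← e, D.π_mul n hf hc]
  · rw [← D.co_π n, D.T_co h2 h3, e1, D.π_mul n hf hgc]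

lemma low7 (hμ : ∀ n, μ.map (D.co n) = D.lam n) (n : ℕ) {A : Set H3} (hA : MeasurableSet A) :
    μ.real (D.co n ⁻¹' A) / 8 - err D n ≤
      μ.real (D.co n ⁻¹' A ∩ (D.T (H3.C (D.h n : ℕ)) ⁻¹' (D.co n ⁻¹' A) ∩
        D.T (H3.C (3 * D.h n : ℕ)) ⁻¹' (D.co n ⁻¹' A))) := by
  obtain ⟨W, hWC, hW, hcard⟩ := (D.step n).s7
  replace hcard : (1 / 8 - (1/2)^(n+2)) * D.v (n+1) ≤ W.card * D.v n := hcard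
  have hAF : MeasurableSet (A ∩ D.F n) := hA.inter (D.meas_F n)
  have hm : MeasurableSet ((A ∩ D.F n) * (W : Set H3)) := meas_mul_fin hAF W
  have hsub : D.co (n+1) ⁻¹' ((A ∩ D.F n) * (W : Set H3)) ⊆
      D.co n ⁻¹' A ∩ (D.T (H3.C (D.h n : ℕ)) ⁻¹' (D.co n ⁻¹' A) ∩
        D.T (H3.C (3 * D.h n : ℕ)) ⁻¹' (D.co n ⁻¹' A)) := by
    rintro x ⟨f, hf, c, hc, e⟩
    obtain ⟨a1, a2⟩ := same_co rfl hf.2 (hWC hc) (hW c hc).1 e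
    obtain ⟨_, a3⟩ := same_co rfl hf.2 (hWC hc) (hW c hc).2 e
    refine ⟨?_, ?_, ?_⟩
    · change D.co n x ∈ A; rw [a1]; exact hf.1
    · change D.co n (D.T _ x) ∈ A; rw [a2]; exact hf.1
    · change D.co n (D.T _ x) ∈ A; rw [a3]; exact hf.1
  refine le_trans ?_ (measureReal_mono (μ := μ) hsub)
  have hF' : (A ∩ D.F n) * (W : Set H3) ⊆ D.F (n+1) := by
    rintro _ ⟨f, hf, c, hc, rfl⟩
    exact D.FC_sub n ⟨f, hf.2, c, hWC hc, rfl⟩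
  rw [law hμ _ hm, D.lam_real (n+1) hm hF']
  have eh : H3.haar.real ((A ∩ D.F n) * (W : Set H3)) = W.card * H3.haar.real (A ∩ D.F n) := by
    rw [measureReal_def, haar_mul_eq hAF inter_subset_right W
      (fun f hf f' hf' x hx x' hx' => (D.step n).s1 f hf f' hf' x (hWC hx) x' (hWC hx')),
      ENNReal.toReal_mul]
    simp [measureReal_def]
  rw [eh]
  set L := (D.lam n).real (A ∩ D.F n) with hL
  have hL0 : 0 ≤ L := measureReal_nonneg
  have hL1 : L ≤ 1 := measureReal_le_one
  have hP : μ.real (D.co n ⁻¹' A) ≤ L + (1 - D.p n) := by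
    rw [law hμ n hA, ← D.lam_F n]
    refine (measureReal_mono ?_).trans (measureReal_union_le _ _)
    intro x hx
    by_cases h : x ∈ D.F n
    · left; exact ⟨hx, h⟩
    · right; exact h
  have hLe : L = D.p n / D.v n * H3.haar.real (A ∩ D.F n) := D.lam_real n hAF inter_subset_right
  have hv := D.v_pos n
  have hv' := D.v_pos (n+1)
  have hp := D.p_pos n
  have hp' := D.p_pos (n+1)
  have hp1 := D.p_le n
  have hp1' := D.p_le (n+1)
  have k1 : D.v n * L ≤ H3.haar.real (A ∩ D.F n) := by
    have : D.v n * L = D.p n * H3.haar.real (A ∩ D.F n) := by rw [hLe]; field_simp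
    rw [this]
    exact mul_le_of_le_one_left measureReal_nonneg hp1
  have k2 : D.p (n+1) * ((1/8 - (1/2)^(n+2)) * L) ≤
      D.p (n+1) / D.v (n+1) * (W.card * H3.haar.real (A ∩ D.F n)) := by
    have a1 : (1/8 - (1/2)^(n+2)) * D.v (n+1) * L ≤ W.card * H3.haar.real (A ∩ D.F n) := by
      calc _ ≤ W.card * D.v n * L := mul_le_mul_of_nonneg_right hcard hL0
        _ = W.card * (D.v n * L) := by ring
        _ ≤ _ := mul_le_mul_of_nonneg_left k1 (by positivity)
    calc D.p (n+1) * ((1/8 - (1/2)^(n+2)) * L) =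
        D.p (n+1) / D.v (n+1) * ((1/8 - (1/2)^(n+2)) * D.v (n+1) * L) := by field_simp
      _ ≤ _ := mul_le_mul_of_nonneg_left a1 (by positivity)
  refine le_trans ?_ k2
  have hu : 1 ≤ 1 / (D.p n * D.p n) := by
    rw [le_div_iff₀ (by positivity), one_mul]
    exact mul_le_one₀ (D.p_le n) hp.le (D.p_le n)
  have he : (0:ℝ) ≤ (1/2)^(n+2) := by positivity
  set ε : ℝ := (1/2)^(n+2) with hε
  have b1 : (1 - D.p (n+1)) * L ≤ 1 - D.p (n+1) := mul_le_of_le_one_right (by linarith) hL1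
  have b2 : D.p (n+1) * ε * L ≤ ε := by
    calc D.p (n+1) * ε * L ≤ 1 * ε * 1 := by gcongr
      _ = ε := by ring
  unfold err
  rw [← hε]
  nlinarith

lemma low7_lim (hμ : ∀ n, μ.map (D.co n) = D.lam n) {E : Set D.X} (hE : MeasurableSet E)
    {δ : ℝ} (hδ : 0 < δ) : ∀ᶠ n in atTop, μ.real E / 8 - δ <
    μ.real (E ∩ (D.T (H3.C (D.h n : ℕ)) ⁻¹' E ∩ D.T (H3.C (3 * D.h n : ℕ)) ⁻¹' E)) := by
  obtain ⟨m, A, hA, h1⟩ := approx_cyl (μ := μ) hE (by positivity : 0 < δ/8)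
  filter_upwards [eventually_ge_atTop m,
    (tendsto_order.1 (err_tendsto (D := D))).2 (δ/8) (by positivity)] with n hn h2
  obtain ⟨B, hB, e⟩ := D.cyl_lift hn hA
  rw [e] at h1
  have h3 := low7 hμ n hB
  set g := H3.C (D.h n : ℕ)
  set g' := H3.C (3 * D.h n : ℕ)
  set S := D.co n ⁻¹' B
  have hS : MeasurableSet S := D.meas_co n hB
  have c1 : (S ∩ (D.T g ⁻¹' S ∩ D.T g' ⁻¹' S)) ⊆ E ∩ (D.T g ⁻¹' E ∩ D.T g' ⁻¹' E) ∪
      symmDiff E S ∪ D.T g ⁻¹' symmDiff E S ∪ D.T g' ⁻¹' symmDiff E S := by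
    intro x; simp only [mem_symmDiff, mem_inter_iff, mem_union, mem_preimage]; tauto
  have c2 := (measureReal_mono (μ := μ) c1).trans ((measureReal_union_le _ _).trans
    (add_le_add ((measureReal_union_le _ _).trans
    (add_le_add (measureReal_union_le _ _) le_rfl)) le_rfl))
  rw [sdT hμ hE hS, sdT hμ hE hS] at c2
  have c3 : μ.real E ≤ μ.real S + δ/8 := sd1 (by rwa [symmDiff_comm])
  linarith

lemma exists_small (hμ : ∀ n, μ.map (D.co n) = D.lam n) :
    ∃ E : Set D.X, MeasurableSet E ∧ 0 < μ.real E ∧ μ.real E < 1/8 := by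
  have hF : D.F 0 = Bx 1 1 1 := by
    change FF (D.α 0) (D.β 0) = _
    rw [D.α_zero, D.β_zero, FF]; norm_num
  have hv : D.v 0 = 1 := by
    change H3.haar.real (D.F 0) = 1
    rw [hF, haarR_Bx _ _ _ (by norm_num) (by norm_num) (by norm_num)]; norm_num
  have hsub : Bx (1/16) 1 1 ⊆ D.F 0 := by
    rw [hF]; rintro g ⟨⟨a, b⟩, c⟩
    exact ⟨⟨a, by linarith⟩, c⟩
  refine ⟨D.co 0 ⁻¹' Bx (1/16) 1 1, D.meas_co 0 (meas_Bx _ _ _), ?_⟩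
  rw [law hμ 0 (meas_Bx _ _ _), D.lam_real 0 (meas_Bx _ _ _) hsub, hv,
    haarR_Bx _ _ _ (by norm_num) (by norm_num) (by norm_num)]
  have := D.p_pos 0
  have := D.p_le 0
  constructor <;> linarith

lemma conj_iter (hμ : ∀ n, μ.map (D.co n) = D.lam n) {R : D.X → D.X}
    (hR : ∀ᵐ x ∂μ, R (D.T (H3.C 1) x) = D.T (H3.C 1)⁻¹ (R x)) (k : ℕ) :
    ∀ᵐ x ∂μ, R (D.T (H3.C (k : ℕ)) x) = D.T (H3.C (k : ℕ))⁻¹ (R x) := by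
  induction k with
  | zero =>
    have : H3.C ((0 : ℕ) : ℝ) = 1 := by ext <;> simp [H3.C]
    rw [this, inv_one]
    refine Eventually.of_forall fun x => ?_
    rw [D.T_one, D.T_one]
  | succ k ih =>
    have e : H3.C ((k + 1 : ℕ) : ℝ) = H3.C 1 * H3.C (k : ℕ) := by
      ext <;> simp [H3.C]; ring
    have e' : (H3.C ((k + 1 : ℕ) : ℝ))⁻¹ = (H3.C 1)⁻¹ * (H3.C (k : ℕ))⁻¹ := by
      rw [e, C_comm, mul_inv_rev]
    filter_upwards [ih, (T_mp hμ (H3.C (k : ℕ))).quasiMeasurePreserving.ae hR] with x h1 h2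
    rw [e', e, D.T_mul, D.T_mul, h2, h1]

lemma asym (hμ : ∀ n, μ.map (D.co n) = D.lam n) {R : D.X → D.X} (hRm : MeasurePreserving R μ μ)
    (hR : ∀ᵐ x ∂μ, R (D.T (H3.C 1) x) = D.T (H3.C 1)⁻¹ (R x)) : False := by
  obtain ⟨E, hE, h0, h1⟩ := exists_small hμ
  have hδ : 0 < (μ.real E / 8 - μ.real E * μ.real E) / 2 := by nlinarith
  have hRE : MeasurableSet (R ⁻¹' E) := hRm.measurable hE
  obtain ⟨n, a, b⟩ := ((mix8_limsup hμ hE hδ).and (low7_lim hμ hRE hδ)).exists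
  have e1 : μ.real (R ⁻¹' E) = μ.real E := hRm.measureReal_preimage hE.nullMeasurableSet
  have e2 : μ.real (R ⁻¹' E ∩ (D.T (H3.C (D.h n : ℕ)) ⁻¹' (R ⁻¹' E) ∩
      D.T (H3.C (3 * D.h n : ℕ)) ⁻¹' (R ⁻¹' E))) =
      μ.real (R ⁻¹' (E ∩ (D.T (H3.C (D.h n : ℕ))⁻¹ ⁻¹' E ∩ D.T (H3.C (3 * D.h n : ℕ))⁻¹ ⁻¹' E))) := by
    refine measureReal_congr ?_
    filter_upwards [conj_iter hμ hR (D.h n), conj_iter hμ hR (3 * D.h n)] with x h1 h2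
    change (R x ∈ E ∧ R (D.T _ x) ∈ E ∧ R (D.T _ x) ∈ E) = 
      (R x ∈ E ∧ D.T _ (R x) ∈ E ∧ D.T _ (R x) ∈ E)
    rw [h1, h2]
  have hm : MeasurableSet (E ∩ (D.T (H3.C (D.h n : ℕ))⁻¹ ⁻¹' E ∩
      D.T (H3.C (3 * D.h n : ℕ))⁻¹ ⁻¹' E)) :=
    hE.inter ((D.T_meas1 _ hE).inter (D.T_meas1 _ hE))
  have e3 : D.T (H3.C (3 * D.h n : ℕ)) ⁻¹' (E ∩ (D.T (H3.C (D.h n : ℕ))⁻¹ ⁻¹' E ∩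
      D.T (H3.C (3 * D.h n : ℕ))⁻¹ ⁻¹' E)) =
      E ∩ (D.T (H3.C (2 * D.h n : ℕ)) ⁻¹' E ∩ D.T (H3.C (3 * D.h n : ℕ)) ⁻¹' E) := by
    have e4 : H3.C (3 * D.h n : ℕ) = H3.C (D.h n : ℕ) * H3.C (2 * D.h n : ℕ) := by
      ext <;> simp [H3.C]; ring
    ext x
    have e5 : D.T (H3.C (D.h n : ℕ))⁻¹ (D.T (H3.C (3 * D.h n : ℕ)) x) =
        D.T (H3.C (2 * D.h n : ℕ)) x := by
      rw [e4, D.T_mul, D.T_inv]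
    simp only [mem_inter_iff, mem_preimage, e5, D.T_inv]
    tauto
  rw [e2, hRm.measureReal_preimage hm.nullMeasurableSet,
    ← (T_mp hμ (H3.C (3 * D.h n : ℕ))).measureReal_preimage hm.nullMeasurableSet, e3, e1] at b
  linarith

end Dat
end HW

section Statement
open MeasureTheory

/-- **Theorem 0.4.** There is a rigid, weakly mixing, rank-one free measure-preserving
action `T` of `H₃(ℝ)` on a standard probability space such that the transformation
`T_{c(1)}` is ergodic and is not conjugate to its inverse: no invertible measure-preserving
transformation `R` satisfies `R ∘ T_{c(1)} = T_{c(1)}⁻¹ ∘ R` (mod `μ`). -/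
theorem exists_rigid_weakly_mixing_asymmetric_action :
    ∃ s : H3System, s.IsStdProb ∧ s.Free ∧ s.Rigid ∧ s.WeaklyMixing ∧ RankOne s ∧
      (∀ A : Set s.X, MeasurableSet A → s.T (H3.C 1) ⁻¹' A = A →
        s.μ A = 0 ∨ s.μ Aᶜ = 0) ∧
      ¬ ∃ R R' : s.X → s.X, Measurable R ∧ MeasurePreserving R s.μ s.μ ∧
          Measurable R' ∧ MeasurePreserving R' s.μ s.μ ∧
          (∀ᵐ x ∂s.μ, R' (R x) = x) ∧ (∀ᵐ x ∂s.μ, R (R' x) = x) ∧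
          (∀ᵐ x ∂s.μ, R (s.T (H3.C 1) x) = s.T (H3.C 1)⁻¹ (R x)) := by
  obtain ⟨D⟩ := HW.exists_Dat
  obtain ⟨μ, _, hμ⟩ := D.exists_mu
  refine ⟨HW.Dat.sys hμ, HW.Dat.sys_std hμ, HW.Dat.sys_free hμ, HW.Dat.sys_rigid hμ,
    fun A hA h => HW.Dat.wmix hμ hA h, HW.Dat.sys_rank hμ, fun A hA h => HW.Dat.ergodic hμ hA h, ?_⟩
  rintro ⟨R, R', _, hR, _, _, _, _, h⟩
  exact HW.Dat.asym hμ hR h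

end Statement
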